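/- Positivity on a segment by iteration of the key lemma (consequence (2.6) of Lemma 2.5): Let K>0. There exist constants M>0 and δ∈(0,1) depending only on n, λ, Λ and K such that the following holds for every 0<r≤1. Assume [g]_{C^{1,1/2}} ≤ K, and let w be a solution of w_t = Lw in 𝒞_r^− whose negative part w⁻ vanishes continuously on Γ. If w ≥ M on 𝒜_r and w ≥ −1 on 𝒞_r^−, then w((0',s),0) > 0 for every 0<s<r. -/

import Mathlib

noncomputable section
open scoped BigOperators
open Classical

abbrev Spc (m : ℕ) := EuclideanSpace ℝ (Fin (m + 1))
abbrev Spc' (m : ℕ) := EuclideanSpace ℝ (Fin m)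

/-- The horizontal coordinates `x' ∈ ℝ^{n-1}` of a point `x ∈ ℝⁿ`. -/
def xprime {m : ℕ} (x : Spc m) : Spc' m :=
  (WithLp.equiv 2 _).symm fun i => x i.castSucc

/-- The last (vertical) coordinate `x_n` of a point `x ∈ ℝⁿ`. -/
def xlast {m : ℕ} (x : Spc m) : ℝ := x (Fin.last m)

/-- Build a point of `ℝⁿ` from `x' ∈ ℝ^{n-1}` and the vertical coordinate. -/
def mkPt {m : ℕ} (x' : Spc' m) (xn : ℝ) : Spc m :=
  (WithLp.equiv 2 _).symm fun i => if h : i = Fin.last m then xn else x' (i.castPred h)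

/-- The `i`-th standard basis vector. -/
def eVec (m : ℕ) (i : Fin (m + 1)) : Spc m := EuclideanSpace.single i 1

/-- The entry `∂²u/∂xᵢ∂xⱼ` of the spatial Hessian of `u(x,t)` at `p = (x,t)`. -/
def sHess {m : ℕ} (u : Spc m × ℝ → ℝ) (p : Spc m × ℝ) (i j : Fin (m + 1)) : ℝ :=
  fderiv ℝ (fun y => fderiv ℝ (fun z => u (z, p.2)) y (eVec m j)) p.1 (eVec m i)

/-- The operator `Lu = tr(A(x) D²ₓu)` at the point `p = (x,t)`. -/
def Lop {m : ℕ} (A : Spc m → Matrix (Fin (m + 1)) (Fin (m + 1)) ℝ)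
    (u : Spc m × ℝ → ℝ) (p : Spc m × ℝ) : ℝ :=
  ∑ i, ∑ j, A p.1 i j * sHess u p j i

/-- Uniform ellipticity with symmetric coefficients: `λ|ξ|² ≤ ξ·A(x)ξ ≤ Λ|ξ|²`. -/
def IsElliptic {m : ℕ} (lam Lam : ℝ)
    (A : Spc m → Matrix (Fin (m + 1)) (Fin (m + 1)) ℝ) : Prop :=
  (∀ x, (A x).IsSymm) ∧
  ∀ (x ξ : Spc m),
    lam * ‖ξ‖ ^ 2 ≤ ∑ i, ∑ j, ξ i * A x i j * ξ j ∧
      ∑ i, ∑ j, ξ i * A x i j * ξ j ≤ Lam * ‖ξ‖ ^ 2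

/-- `u` is (pointwise) a solution of `u_t = Lu` on `Ω`: twice continuously
differentiable in `x`, differentiable in `t`, with `∂ₜu = tr(A(x)D²ₓu)`. -/
def SolvesL {m : ℕ} (A : Spc m → Matrix (Fin (m + 1)) (Fin (m + 1)) ℝ)
    (u : Spc m × ℝ → ℝ) (Ω : Set (Spc m × ℝ)) : Prop :=
  ∀ p ∈ Ω, ContDiffAt ℝ 2 (fun y => u (y, p.2)) p.1 ∧
    HasDerivAt (fun s => u (p.1, s)) (Lop A u p) p.2

/-- `u` is a pointwise subsolution: `u_t ≤ Lu` on `Ω`. -/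
def SubSolvesL {m : ℕ} (A : Spc m → Matrix (Fin (m + 1)) (Fin (m + 1)) ℝ)
    (u : Spc m × ℝ → ℝ) (Ω : Set (Spc m × ℝ)) : Prop :=
  ∀ p ∈ Ω, ContDiffAt ℝ 2 (fun y => u (y, p.2)) p.1 ∧
    DifferentiableAt ℝ (fun s => u (p.1, s)) p.2 ∧
    deriv (fun s => u (p.1, s)) p.2 ≤ Lop A u p

/-- `u` solves the heat equation `∂ₜu = Δu` on `Ω`. -/
def SolvesHeat {m : ℕ} (u : Spc m × ℝ → ℝ) (Ω : Set (Spc m × ℝ)) : Prop :=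
  ∀ p ∈ Ω, ContDiffAt ℝ 2 (fun y => u (y, p.2)) p.1 ∧
    HasDerivAt (fun s => u (p.1, s)) (∑ i, sHess u p i i) p.2

/-- The graph `Γ = {x_n = g(x',t)}`. -/
def graphSet {m : ℕ} (g : Spc' m → ℝ → ℝ) : Set (Spc m × ℝ) :=
  {p | xlast p.1 = g (xprime p.1) p.2}

/-- The cylinder `𝒞_r` of size `r` on top of the graph of `g`. -/
def Cyl {m : ℕ} (g : Spc' m → ℝ → ℝ) (r : ℝ) : Set (Spc m × ℝ) :=
  {p | ‖xprime p.1‖ < r ∧ -r ^ 2 < p.2 ∧ p.2 < r ^ 2 ∧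
    g (xprime p.1) p.2 < xlast p.1 ∧ xlast p.1 < g (xprime p.1) p.2 + r}

/-- The point `Ē = ((0', g(0',1/2) + 1/2), 1/2)`. -/
def Ebar {m : ℕ} (g : Spc' m → ℝ → ℝ) : Spc m × ℝ := (mkPt 0 (g 0 (1 / 2) + 1 / 2), 1 / 2)

/-- The point `E̲ = ((0', g(0',−1/2) + 1/2), −1/2)`. -/
def Eund {m : ℕ} (g : Spc' m → ℝ → ℝ) : Spc m × ℝ := (mkPt 0 (g 0 (-(1 / 2)) + 1 / 2), -(1 / 2))

/-- `u` vanishes continuously on `Γ`: `u(Q) → 0` as `Q → P` within `Ω`,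
for every `P ∈ Γ` in the closure of `Ω`. -/
def VanishesOn {m : ℕ} (u : Spc m × ℝ → ℝ) (Ω Γ : Set (Spc m × ℝ)) : Prop :=
  ∀ P ∈ Γ ∩ closure Ω, Filter.Tendsto u (nhdsWithin P Ω) (nhds 0)

/-- `[g]_{C^{α,β}} ≤ K`. -/
def HolderSemi {m : ℕ} (α β K : ℝ) (g : Spc' m → ℝ → ℝ) : Prop :=
  ∀ x' y' t s, |g x' t - g y' s| ≤ K * (‖x' - y'‖ ^ α + |t - s| ^ β)

/-- The backward-in-time cylinder `𝒞_r^−` (Lipschitz setting, parabolic scaling). -/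
def CylB {m : ℕ} (g : Spc' m → ℝ → ℝ) (r : ℝ) : Set (Spc m × ℝ) :=
  {p | (∀ i : Fin m, -r < xprime p.1 i ∧ xprime p.1 i < r) ∧ -r ^ 2 < p.2 ∧ p.2 ≤ 0 ∧
    g (xprime p.1) p.2 < xlast p.1 ∧ xlast p.1 < g (xprime p.1) p.2 + r}

/-- The set `𝒜_r` of points of `𝒞_r^−` at height at least `δr` above `Γ`. -/
def ASet {m : ℕ} (g : Spc' m → ℝ → ℝ) (δ r : ℝ) : Set (Spc m × ℝ) :=
  {p ∈ CylB g r | g (xprime p.1) p.2 + δ * r ≤ xlast p.1}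

/-- The backward-in-time cylinder `𝒞_r^−` (Hölder setting, time interval `(−r,0]`). -/
def CylBH {m : ℕ} (g : Spc' m → ℝ → ℝ) (r : ℝ) : Set (Spc m × ℝ) :=
  {p | (∀ i : Fin m, -r < xprime p.1 i ∧ xprime p.1 i < r) ∧ -r < p.2 ∧ p.2 ≤ 0 ∧
    g (xprime p.1) p.2 < xlast p.1 ∧ xlast p.1 < g (xprime p.1) p.2 + r}

/-- The set `𝒜_r` of points of the Hölder cylinder `𝒞_r^−` at height at least `r^β` above `Γ`. -/
def ASetH {m : ℕ} (g : Spc' m → ℝ → ℝ) (β r : ℝ) : Set (Spc m × ℝ) :=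
  {p ∈ CylBH g r | g (xprime p.1) p.2 + r ^ β ≤ xlast p.1}

/-- The height `h_Γ(x,t) = x_n − g(x',t)` above the graph. -/
def hGamma {m : ℕ} (g : Spc' m → ℝ → ℝ) (p : Spc m × ℝ) : ℝ :=
  xlast p.1 - g (xprime p.1) p.2

section

/-- The spatial Hessian as a continuous bilinear form. -/
def D2 {m : ℕ} (u : Spc m → ℝ) (x : Spc m) : Spc m →L[ℝ] Spc m →L[ℝ] ℝ :=
  fderiv ℝ (fderiv ℝ u) x

/-- The contraction `tr(a B)` of a matrix with a bilinear form. -/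
def trA {m : ℕ} (a : Matrix (Fin (m + 1)) (Fin (m + 1)) ℝ)
    (B : Spc m →L[ℝ] Spc m →L[ℝ] ℝ) : ℝ :=
  ∑ i, ∑ j, a i j * B (eVec m j) (eVec m i)

/-- Ellipticity of a single symmetric matrix. -/
def EllM {m : ℕ} (lam Lam : ℝ) (a : Matrix (Fin (m + 1)) (Fin (m + 1)) ℝ) : Prop :=
  a.IsSymm ∧ ∀ ξ : Spc m,
    lam * ‖ξ‖ ^ 2 ≤ ∑ i, ∑ j, ξ i * a i j * ξ j ∧
      ∑ i, ∑ j, ξ i * a i j * ξ j ≤ Lam * ‖ξ‖ ^ 2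

/-- Symmetric positive semidefinite bilinear forms. -/
def PSDB {m : ℕ} (B : Spc m →L[ℝ] Spc m →L[ℝ] ℝ) : Prop :=
  (∀ v w, B v w = B w v) ∧ ∀ v, 0 ≤ B v v

/-- The matrix of a bilinear form in the standard basis. -/
def hmat {m : ℕ} (B : Spc m →L[ℝ] Spc m →L[ℝ] ℝ) : Matrix (Fin (m + 1)) (Fin (m + 1)) ℝ :=
  fun i j => B (eVec m i) (eVec m j)

variable {m : ℕ}

lemma IsElliptic.ellM {lam Lam : ℝ} {A : Spc m → Matrix (Fin (m + 1)) (Fin (m + 1)) ℝ}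
    (hA : IsElliptic lam Lam A) (x : Spc m) : EllM lam Lam (A x) :=
  ⟨hA.1 x, fun ξ => hA.2 x ξ⟩

lemma trA_add (a : Matrix (Fin (m + 1)) (Fin (m + 1)) ℝ) (B C : Spc m →L[ℝ] Spc m →L[ℝ] ℝ) :
    trA a (B + C) = trA a B + trA a C := by
  simp [trA, mul_add, Finset.sum_add_distrib]

lemma trA_smul (a : Matrix (Fin (m + 1)) (Fin (m + 1)) ℝ) (c : ℝ)
    (B : Spc m →L[ℝ] Spc m →L[ℝ] ℝ) : trA a (c • B) = c * trA a B := by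
  simp only [trA, Finset.mul_sum, smul_apply, smul_eq_mul]
  exact Finset.sum_congr rfl fun i _ => Finset.sum_congr rfl fun j _ => by ring

lemma trA_zero (a : Matrix (Fin (m + 1)) (Fin (m + 1)) ℝ) :
    trA a (0 : Spc m →L[ℝ] Spc m →L[ℝ] ℝ) = 0 := by
  simp [trA]

lemma trA_sub (a : Matrix (Fin (m + 1)) (Fin (m + 1)) ℝ) (B C : Spc m →L[ℝ] Spc m →L[ℝ] ℝ) :
    trA a (B - C) = trA a B - trA a C := by
  simp [trA, mul_sub, Finset.sum_sub_distrib]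

lemma trA_sum {ι : Type*} (s : Finset ι) (a : Matrix (Fin (m + 1)) (Fin (m + 1)) ℝ)
    (B : ι → Spc m →L[ℝ] Spc m →L[ℝ] ℝ) : trA a (∑ i ∈ s, B i) = ∑ i ∈ s, trA a (B i) := by
  induction s using Finset.induction_on with
  | empty => simp [trA_zero]
  | insert i s hi ih => rw [Finset.sum_insert hi, Finset.sum_insert hi, trA_add, ih]

lemma eVec_sum (v : Spc m) : v = ∑ i, v i • eVec m i := by
  ext k
  simp [eVec, Finset.sum_apply, Pi.single_apply]

lemma bilin_apply (B : Spc m →L[ℝ] Spc m →L[ℝ] ℝ) (v w : Spc m) :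
    B v w = ∑ i, ∑ j, v i * B (eVec m i) (eVec m j) * w j := by
  conv_lhs => rw [eVec_sum v, eVec_sum w]
  simp only [map_sum, sum_apply, map_smul, smul_apply,
    smul_eq_mul]
  simp only [Finset.mul_sum]
  rw [Finset.sum_comm]
  exact Finset.sum_congr rfl fun i _ => Finset.sum_congr rfl fun j _ => by ring

lemma PSDB.posSemidef {B : Spc m →L[ℝ] Spc m →L[ℝ] ℝ} (hB : PSDB B) : (hmat B).PosSemidef := by
  refine Matrix.PosSemidef.of_dotProduct_mulVec_nonneg ?_ ?_
  · ext i j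
    simp [Matrix.conjTranspose_apply, hmat, hB.1 (eVec m j)]
  · intro x
    have h := hB.2 (WithLp.toLp 2 x)
    rw [bilin_apply] at h
    refine h.trans_eq ?_
    simp only [dotProduct, Matrix.mulVec, hmat, Finset.mul_sum, star_trivial]
    exact Finset.sum_congr rfl fun i _ => Finset.sum_congr rfl fun j _ => by ring

lemma trA_eq (a : Matrix (Fin (m + 1)) (Fin (m + 1)) ℝ) (B : Spc m →L[ℝ] Spc m →L[ℝ] ℝ)
    (hB : PSDB B) : trA a B = ∑ i, ∑ j, a i j * hmat B i j := by
  simp only [trA, hmat]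
  exact Finset.sum_congr rfl fun i _ => Finset.sum_congr rfl fun j _ => by rw [hB.1]

lemma trA_nonneg_of_posSemidef {a : Matrix (Fin (m + 1)) (Fin (m + 1)) ℝ} (ha : a.PosSemidef)
    {B : Spc m →L[ℝ] Spc m →L[ℝ] ℝ} (hB : PSDB B) : 0 ≤ trA a B := by
  have h := (ha.hadamard hB.posSemidef).dotProduct_mulVec_nonneg 1
  rw [trA_eq a B hB]
  simpa [dotProduct, Matrix.mulVec] using h

/-- The trace of a bilinear form. -/
def trB (B : Spc m →L[ℝ] Spc m →L[ℝ] ℝ) : ℝ := ∑ i, B (eVec m i) (eVec m i)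

lemma trA_one (B : Spc m →L[ℝ] Spc m →L[ℝ] ℝ) : trA 1 B = trB B := by
  simp [trA, trB, Matrix.one_apply]

lemma trA_sub_left (a b : Matrix (Fin (m + 1)) (Fin (m + 1)) ℝ)
    (B : Spc m →L[ℝ] Spc m →L[ℝ] ℝ) : trA (a - b) B = trA a B - trA b B := by
  simp [trA, sub_mul, Finset.sum_sub_distrib]

lemma trA_smul_left (a : Matrix (Fin (m + 1)) (Fin (m + 1)) ℝ) (c : ℝ)
    (B : Spc m →L[ℝ] Spc m →L[ℝ] ℝ) : trA (c • a) B = c * trA a B := by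
  simp only [trA, Finset.mul_sum, Matrix.smul_apply, smul_eq_mul]
  exact Finset.sum_congr rfl fun i _ => Finset.sum_congr rfl fun j _ => by ring

variable {lam Lam : ℝ} {a : Matrix (Fin (m + 1)) (Fin (m + 1)) ℝ}

lemma posSemidef_of_quad {b : Matrix (Fin (m + 1)) (Fin (m + 1)) ℝ} (hs : b.IsSymm)
    (h : ∀ ξ : Spc m, 0 ≤ ∑ i, ∑ j, ξ i * b i j * ξ j) : b.PosSemidef := by
  refine Matrix.PosSemidef.of_dotProduct_mulVec_nonneg ?_ ?_
  · rw [Matrix.IsHermitian, Matrix.conjTranspose_eq_transpose_of_trivial]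
    exact hs
  · intro x
    refine (h (WithLp.toLp 2 x)).trans_eq ?_
    simp only [dotProduct, Matrix.mulVec, Finset.mul_sum, star_trivial]
    exact Finset.sum_congr rfl fun i _ => Finset.sum_congr rfl fun j _ => by ring

lemma sum_one_quad (c : ℝ) (ξ : Spc m) :
    ∑ i, ∑ j, ξ i * (c • (1 : Matrix (Fin (m + 1)) (Fin (m + 1)) ℝ)) i j * ξ j
      = c * ‖ξ‖ ^ 2 := by
  rw [EuclideanSpace.real_norm_sq_eq, Finset.mul_sum]
  refine Finset.sum_congr rfl fun i _ => ?_
  simp only [Matrix.smul_apply, Matrix.one_apply, smul_eq_mul, mul_ite, ite_mul]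
  simp
  ring

lemma EllM.lower (ha : EllM lam Lam a) {B : Spc m →L[ℝ] Spc m →L[ℝ] ℝ} (hB : PSDB B) :
    lam * trB B ≤ trA a B := by
  have h : (a - lam • (1 : Matrix (Fin (m + 1)) (Fin (m + 1)) ℝ)).PosSemidef := by
    refine posSemidef_of_quad (ha.1.sub (by simp [Matrix.IsSymm])) fun ξ => ?_
    have h1 := (ha.2 ξ).1
    have h2 := sum_one_quad lam ξ
    simp only [Matrix.sub_apply, mul_sub, sub_mul, Finset.sum_sub_distrib]
    linarith
  have := trA_nonneg_of_posSemidef h hB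
  rw [trA_sub_left, trA_smul_left, trA_one] at this
  linarith

lemma EllM.upper (ha : EllM lam Lam a) {B : Spc m →L[ℝ] Spc m →L[ℝ] ℝ} (hB : PSDB B) :
    trA a B ≤ Lam * trB B := by
  have h : (Lam • (1 : Matrix (Fin (m + 1)) (Fin (m + 1)) ℝ) - a).PosSemidef := by
    refine posSemidef_of_quad (Matrix.IsSymm.sub (by simp [Matrix.IsSymm]) ha.1) fun ξ => ?_
    have h1 := (ha.2 ξ).2
    have h2 := sum_one_quad Lam ξ
    simp only [Matrix.sub_apply, mul_sub, sub_mul, Finset.sum_sub_distrib]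
    linarith
  have := trA_nonneg_of_posSemidef h hB
  rw [trA_sub_left, trA_smul_left, trA_one] at this
  linarith

lemma eVec_norm (i : Fin (m + 1)) : ‖eVec m i‖ = 1 := by simp [eVec]

lemma PSDB.trB_nonneg {B : Spc m →L[ℝ] Spc m →L[ℝ] ℝ} (hB : PSDB B) : 0 ≤ trB B :=
  Finset.sum_nonneg fun _ _ => hB.2 _

lemma PSDB.trA_nonneg (hlam : 0 ≤ lam) (ha : EllM lam Lam a)
    {B : Spc m →L[ℝ] Spc m →L[ℝ] ℝ} (hB : PSDB B) : 0 ≤ trA a B :=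
  (mul_nonneg hlam hB.trB_nonneg).trans (ha.lower hB)

/-- The inner product as a bilinear form. -/
def inB (m : ℕ) : Spc m →L[ℝ] Spc m →L[ℝ] ℝ := innerSL ℝ

lemma inB_apply (v w : Spc m) : inB m v w = inner ℝ v w := rfl

lemma inB_psd : PSDB (inB m) :=
  ⟨fun v w => by simp only [inB_apply]; exact real_inner_comm _ _,
    fun v => by simp only [inB_apply]; exact real_inner_self_nonneg⟩

lemma trB_inB : trB (inB m) = m + 1 := by
  simp [trB, inB_apply, eVec_norm]

lemma trA_inB_le (ha : EllM lam Lam a) : trA a (inB m) ≤ Lam * (m + 1) := by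
  simpa [trB_inB] using ha.upper inB_psd

lemma trA_le_of_norm (hlam : 0 ≤ lam) (ha : EllM lam Lam a) {B : Spc m →L[ℝ] Spc m →L[ℝ] ℝ}
    (hs : ∀ v w, B v w = B w v) : |trA a B| ≤ ‖B‖ * (Lam * (m + 1)) := by
  have key : ∀ C : Spc m →L[ℝ] Spc m →L[ℝ] ℝ, (∀ v w, C v w = C w v) →
      trA a C ≤ ‖C‖ * (Lam * (m + 1)) := by
    intro C hC
    have hp : PSDB (‖C‖ • inB m - C) := by
      refine ⟨fun v w => ?_, fun v => ?_⟩
      · simp only [sub_apply, smul_apply, inB_psd.1 v w,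
          hC v w]
      · have h1 : C v v ≤ ‖C‖ * ‖v‖ * ‖v‖ := (le_abs_self _).trans (C.le_opNorm₂ v v)
        simp only [sub_apply, smul_apply, inB_apply,
          real_inner_self_eq_norm_sq, smul_eq_mul]
        nlinarith
    have h := hp.trA_nonneg hlam ha
    rw [trA_sub, trA_smul] at h
    nlinarith [trA_inB_le ha, norm_nonneg C]
  refine abs_le.2 ⟨?_, key B hs⟩
  have h := key (0 - B) fun v w => by simp only [sub_apply, zero_apply, hs v w]
  have hn : ‖0 - B‖ = ‖B‖ :=
    (congrArg norm (zero_sub B)).trans (norm_neg B)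
  rw [trA_sub, trA_zero, hn] at h
  linarith

lemma PSDB.abs_det_lt {B : Spc m →L[ℝ] Spc m →L[ℝ] ℝ} (hB : PSDB B) {k : ℝ} (hk : trB B < k) :
    |(hmat B).det| < k ^ (m + 1) := by
  have hp := hB.posSemidef
  have ht : trB B = ∑ i, hp.1.eigenvalues i := by
    have := hp.1.trace_eq_sum_eigenvalues
    simpa [Matrix.trace, hmat, trB] using this
  have hd : (hmat B).det = ∏ i, hp.1.eigenvalues i := by
    have := hp.1.det_eq_prod_eigenvalues
    simpa using this
  have h0 := hp.eigenvalues_nonneg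
  rw [abs_of_nonneg hp.det_nonneg, hd]
  calc ∏ i, hp.1.eigenvalues i ≤ ∏ _i : Fin (m + 1), trB B := by
        refine Finset.prod_le_prod (fun i _ => h0 i) fun i _ => ?_
        rw [ht]
        exact Finset.single_le_sum (fun j _ => h0 j) (Finset.mem_univ i)
    _ = trB B ^ (m + 1) := by simp
    _ < k ^ (m + 1) := pow_lt_pow_left₀ hk hB.trB_nonneg (by simp)

end

section

open Filter Topology

variable {m : ℕ}

lemma ContDiffAt.differentiableAt_fderiv {u : Spc m → ℝ} {x : Spc m} (hu : ContDiffAt ℝ 2 u x) :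
    DifferentiableAt ℝ (fderiv ℝ u) x :=
  (hu.fderiv_right (m := 1) (by norm_num)).differentiableAt (by norm_num)

lemma ContDiffAt.hasFDerivAt_fderiv {u : Spc m → ℝ} {x : Spc m} (hu : ContDiffAt ℝ 2 u x) :
    HasFDerivAt (fderiv ℝ u) (D2 u x) x :=
  hu.differentiableAt_fderiv.hasFDerivAt

lemma ContDiffAt.eventually_differentiableAt {u : Spc m → ℝ} {x : Spc m}
    (hu : ContDiffAt ℝ 2 u x) : ∀ᶠ y in 𝓝 x, DifferentiableAt ℝ u y :=
  (hu.eventually (by simp)).mono fun _ h => h.differentiableAt (by norm_num)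

lemma Lop_eq (A : Spc m → Matrix (Fin (m + 1)) (Fin (m + 1)) ℝ) (u : Spc m × ℝ → ℝ)
    (x : Spc m) (t : ℝ) (hu : ContDiffAt ℝ 2 (fun y => u (y, t)) x) :
    Lop A u (x, t) = trA (A x) (D2 (fun y => u (y, t)) x) := by
  unfold Lop trA
  refine Finset.sum_congr rfl fun i _ => Finset.sum_congr rfl fun j _ => ?_
  congr 1
  have h := (hu.hasFDerivAt_fderiv.clm_apply (hasFDerivAt_const (eVec m i) x)).fderiv
  simp only [sHess]
  rw [h]
  simp

lemma D2_symm {u : Spc m → ℝ} {x : Spc m} (hu : ContDiffAt ℝ 2 u x) (v w : Spc m) :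
    D2 u x v w = D2 u x w v :=
  (hu.isSymmSndFDerivAt (by simp)) v w

lemma D2_of_hasFDerivAt {u : Spc m → ℝ} {x : Spc m} {du : Spc m → Spc m →L[ℝ] ℝ}
    {B : Spc m →L[ℝ] Spc m →L[ℝ] ℝ} (h : ∀ᶠ y in 𝓝 x, HasFDerivAt u (du y) y)
    (h2 : HasFDerivAt du B x) : D2 u x = B := by
  have : fderiv ℝ u =ᶠ[𝓝 x] du := h.mono fun y hy => hy.fderiv
  exact this.fderiv_eq.trans h2.fderiv

lemma D2_add {u v : Spc m → ℝ} {x : Spc m} (hu : ContDiffAt ℝ 2 u x) (hv : ContDiffAt ℝ 2 v x) :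
    D2 (fun y => u y + v y) x = D2 u x + D2 v x := by
  refine D2_of_hasFDerivAt (du := fun y => fderiv ℝ u y + fderiv ℝ v y) ?_
    (hu.hasFDerivAt_fderiv.add hv.hasFDerivAt_fderiv)
  filter_upwards [hu.eventually_differentiableAt, hv.eventually_differentiableAt] with y h1 h2
  exact h1.hasFDerivAt.add h2.hasFDerivAt

lemma D2_const_mul {u : Spc m → ℝ} {x : Spc m} (hu : ContDiffAt ℝ 2 u x) (c : ℝ) :
    D2 (fun y => c * u y) x = c • D2 u x := by
  refine D2_of_hasFDerivAt (du := fun y => c • fderiv ℝ u y) ?_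
    (hu.hasFDerivAt_fderiv.const_smul c)
  filter_upwards [hu.eventually_differentiableAt] with y h1
  exact h1.hasFDerivAt.const_mul c

lemma D2_sum {ι : Type*} (s : Finset ι) {u : ι → Spc m → ℝ} {x : Spc m}
    (hu : ∀ i ∈ s, ContDiffAt ℝ 2 (u i) x) :
    D2 (fun y => ∑ i ∈ s, u i y) x = ∑ i ∈ s, D2 (u i) x := by
  refine D2_of_hasFDerivAt (du := fun y => ∑ i ∈ s, fderiv ℝ (u i) y) ?_
    (HasFDerivAt.fun_sum fun i hi => (hu i hi).hasFDerivAt_fderiv)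
  have : ∀ᶠ y in 𝓝 x, ∀ i ∈ s, DifferentiableAt ℝ (u i) y :=
    (Finset.eventually_all s).2 fun i hi => (hu i hi).eventually_differentiableAt
  filter_upwards [this] with y hy
  exact HasFDerivAt.fun_sum fun i hi => (hy i hi).hasFDerivAt

lemma D2_linear (l : Spc m →L[ℝ] ℝ) (x : Spc m) : D2 (fun y => l y) x = 0 :=
  D2_of_hasFDerivAt (du := fun _ => l) (Eventually.of_forall fun _ => l.hasFDerivAt)
    (hasFDerivAt_const _ x)

lemma hasFDerivAt_normSq (c x : Spc m) :
    HasFDerivAt (fun y : Spc m => ‖y - c‖ ^ 2) ((2 : ℝ) • inB m (x - c)) x := by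
  have h := ((hasFDerivAt_id (𝕜 := ℝ) x).sub_const c).norm_sq
  refine h.congr_fderiv ?_
  ext v
  simp [inB]
  rfl

lemma contDiff_normSq (c : Spc m) : ContDiff ℝ 2 (fun y : Spc m => ‖y - c‖ ^ 2) :=
  (contDiff_id.sub contDiff_const).norm_sq ℝ

lemma D2_normSq (c x : Spc m) : D2 (fun y : Spc m => ‖y - c‖ ^ 2) x = (2 : ℝ) • inB m := by
  refine D2_of_hasFDerivAt (Eventually.of_forall fun y => hasFDerivAt_normSq c y) ?_
  have h := ((inB m).hasFDerivAt (x := x - c)).comp x ((hasFDerivAt_id (𝕜 := ℝ) x).sub_const c)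
  exact h.const_smul (2 : ℝ)

lemma D2_comp_real {u : Spc m → ℝ} {x : Spc m} (hu : ContDiffAt ℝ 2 u x) {θ θ' : ℝ → ℝ} {c : ℝ}
    (h1 : ∀ y, HasDerivAt θ (θ' y) y) (h2 : HasDerivAt θ' c (u x)) :
    D2 (fun y => θ (u y)) x
      = θ' (u x) • D2 u x + c • (fderiv ℝ u x).smulRight (fderiv ℝ u x) := by
  refine D2_of_hasFDerivAt (du := fun y => θ' (u y) • fderiv ℝ u y) ?_ ?_
  · filter_upwards [hu.eventually_differentiableAt] with y hy
    exact (h1 (u y)).comp_hasFDerivAt y hy.hasFDerivAt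
  · have hux := (hu.differentiableAt (by norm_num)).hasFDerivAt
    have h := (h2.comp_hasFDerivAt x hux).smul hu.hasFDerivAt_fderiv
    refine h.congr_fderiv ?_
    ext v w
    simp
    ring

lemma D2_comp_affine {u : Spc m → ℝ} (c : Spc m) (s : ℝ) {x : Spc m}
    (hu : ContDiffAt ℝ 2 u (c + s • x)) :
    D2 (fun y => u (c + s • y)) x = s ^ 2 • D2 u (c + s • x) := by
  have hl : ∀ y : Spc m, HasFDerivAt (fun y : Spc m => c + s • y)
      (s • ContinuousLinearMap.id ℝ (Spc m)) y := fun y =>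
    ((hasFDerivAt_id (𝕜 := ℝ) y).const_smul s).const_add c
  have hcont : Tendsto (fun y : Spc m => c + s • y) (𝓝 x) (𝓝 (c + s • x)) :=
    (hl x).continuousAt
  refine D2_of_hasFDerivAt (du := fun y => s • fderiv ℝ u (c + s • y)) ?_ ?_
  · filter_upwards [hcont.eventually hu.eventually_differentiableAt] with y hy
    refine (hy.hasFDerivAt.comp y (hl y)).congr_fderiv ?_
    ext v
    simp
  · refine ((hu.hasFDerivAt_fderiv.comp x (hl x)).const_smul s).congr_fderiv ?_
    ext v w
    simp
    ring

lemma trA_smulRight_bounds {lam Lam : ℝ} {a : Matrix (Fin (m + 1)) (Fin (m + 1)) ℝ}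
    (ha : EllM lam Lam a) (v : Spc m) :
    lam * ‖v‖ ^ 2 ≤ trA a ((inB m v).smulRight (inB m v)) ∧
      trA a ((inB m v).smulRight (inB m v)) ≤ Lam * ‖v‖ ^ 2 := by
  have h : trA a ((inB m v).smulRight (inB m v)) = ∑ i, ∑ j, v i * a i j * v j := by
    unfold trA
    refine Finset.sum_congr rfl fun i _ => Finset.sum_congr rfl fun j _ => ?_
    simp [inB_apply, eVec, EuclideanSpace.inner_single_right]
    ring
  rw [h]
  exact ha.2 v

lemma trA_smulRight_nonneg {lam Lam : ℝ} (hlam : 0 ≤ lam)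
    {a : Matrix (Fin (m + 1)) (Fin (m + 1)) ℝ} (ha : EllM lam Lam a) (l : Spc m →L[ℝ] ℝ) :
    0 ≤ trA a (l.smulRight l) := by
  refine PSDB.trA_nonneg hlam ha ⟨fun v w => ?_, fun v => ?_⟩
  · simp; ring
  · simpa using mul_self_nonneg _

lemma D2_psd_of_isLocalMin {u : Spc m → ℝ} {x : Spc m} (hu : ContDiffAt ℝ 2 u x)
    (h : IsLocalMin u x) : PSDB (D2 u x) := by
  refine ⟨D2_symm hu, fun v => ?_⟩
  by_contra! hneg
  have hl : ∀ t : ℝ, HasDerivAt (fun t : ℝ => x + t • v) v t := fun t => by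
    simpa using ((hasDerivAt_id t).smul_const v).const_add x
  have hl0 : Tendsto (fun t : ℝ => x + t • v) (𝓝 0) (𝓝 x) := by
    simpa using (hl 0).continuousAt.tendsto
  set φ : ℝ → ℝ := fun t => u (x + t • v)
  have hd : ∀ᶠ t in 𝓝 (0 : ℝ), HasDerivAt φ (fderiv ℝ u (x + t • v) v) t := by
    filter_upwards [hl0.eventually hu.eventually_differentiableAt] with t ht
    exact ht.hasFDerivAt.comp_hasDerivAt t (hl t)
  have hd' : deriv φ =ᶠ[𝓝 0] fun t => fderiv ℝ u (x + t • v) v := hd.mono fun t ht => ht.deriv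
  have hdd : HasDerivAt (fun t : ℝ => fderiv ℝ u (x + t • v) v) (D2 u x v v) 0 := by
    have h0 : HasFDerivAt (fderiv ℝ u) (D2 u x) (x + (0 : ℝ) • v) := by
      simpa using hu.hasFDerivAt_fderiv
    have h3 : HasDerivAt (fun t : ℝ => fderiv ℝ u (x + t • v)) (D2 u x v) 0 :=
      HasFDerivAt.comp_hasDerivAt (f := fun t : ℝ => x + t • v) (0 : ℝ) h0 (hl 0)
    have h4 := h3.clm_apply (hasDerivAt_const (0 : ℝ) v)
    simpa only [map_zero, add_zero] using h4
  have h2 : deriv (deriv φ) 0 = D2 u x v v := hd'.deriv_eq.trans hdd.deriv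
  have hmin : IsLocalMin φ 0 := by
    have := hl0.eventually h
    refine this.mono fun t ht => ?_
    simpa [φ] using ht
  have h1 : deriv φ 0 = 0 := hmin.deriv_eq_zero
  have hmax : IsLocalMax φ 0 :=
    isLocalMax_of_deriv_deriv_neg (by rw [h2]; exact hneg) h1 hd.self_of_nhds.continuousAt
  have hconst : φ =ᶠ[𝓝 0] fun _ => φ 0 := by
    filter_upwards [hmin, hmax] with t h1 h2
    exact le_antisymm h2 h1
  have : deriv φ =ᶠ[𝓝 0] fun _ => 0 := by
    refine hconst.deriv.trans (Eventually.of_forall fun t => ?_)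
    simp
  have h3 := this.deriv_eq
  rw [h2] at h3
  simp at h3
  linarith

end

section

open Filter Topology Set MeasureTheory

/-- The lower left slope of `f` at `t` is at least `c`. -/
def LSlope (f : ℝ → ℝ) (t c : ℝ) : Prop :=
  ∀ η > 0, ∀ᶠ s in 𝓝[<] t, f s ≤ f t - (c - η) * (t - s)

/-- Lower semicontinuity of `f` at `t` from the right. -/
def RLsc (f : ℝ → ℝ) (t : ℝ) : Prop := ∀ η > 0, ∀ᶠ s in 𝓝[>] t, f t - η < f s

lemma LSlope.mono {f : ℝ → ℝ} {t c c' : ℝ} (h : LSlope f t c) (hc : c' ≤ c) : LSlope f t c' := by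
  intro η hη
  filter_upwards [h η hη, self_mem_nhdsWithin] with s hs hst
  have : s < t := hst
  nlinarith

lemma HasDerivAt.lslope {f : ℝ → ℝ} {t c : ℝ} (h : HasDerivAt f c t) : LSlope f t c := by
  intro η hη
  have h1 := (hasDerivAt_iff_isLittleO.1 h).bound hη
  filter_upwards [nhdsWithin_le_nhds h1, self_mem_nhdsWithin] with s hs hst
  have hst' : s < t := hst
  rw [Real.norm_eq_abs, Real.norm_eq_abs, abs_of_neg (sub_neg.2 hst'), smul_eq_mul] at hs
  have := (abs_le.1 hs).2
  nlinarith

lemma LSlope.add {f g : ℝ → ℝ} {t c d : ℝ} (hf : LSlope f t c) (hg : LSlope g t d) :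
    LSlope (fun s => f s + g s) t (c + d) := by
  intro η hη
  filter_upwards [hf (η / 2) (by positivity), hg (η / 2) (by positivity)] with s h1 h2
  linarith

lemma lslope_zero_of_eventually_le {f : ℝ → ℝ} {t : ℝ} (h : ∀ᶠ s in 𝓝[<] t, f s ≤ f t) :
    LSlope f t 0 := by
  intro η hη
  filter_upwards [h, self_mem_nhdsWithin] with s hs hst
  have : s < t := hst
  nlinarith

lemma RLsc.add {f g : ℝ → ℝ} {t : ℝ} (hf : RLsc f t) (hg : RLsc g t) :
    RLsc (fun s => f s + g s) t := by
  intro η hη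
  filter_upwards [hf (η / 2) (by positivity), hg (η / 2) (by positivity)] with s h1 h2
  linarith

lemma ContinuousAt.rlsc {f : ℝ → ℝ} {t : ℝ} (h : ContinuousAt f t) : RLsc f t := fun _ hη =>
  nhdsWithin_le_nhds (h.eventually (lt_mem_nhds (sub_lt_self _ hη)))

lemma rlsc_of_eventually_le {f : ℝ → ℝ} {t : ℝ} (h : ∀ᶠ s in 𝓝[>] t, f t ≤ f s) : RLsc f t :=
  fun _ _ => h.mono fun _ hs => by linarith

/-- A right lower semicontinuous function with nonnegative left slopes increases. -/
lemma le_of_lslope {h : ℝ → ℝ} {a b : ℝ} (hab : a ≤ b) (h1 : ∀ t ∈ Ioc a b, LSlope h t 0)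
    (h2 : ∀ t ∈ Ico a b, RLsc h t) : h a ≤ h b := by
  have key : ∀ η > 0, h a ≤ h b + η * (b - a) := by
    intro η hη
    set S : Set ℝ := {τ | τ ∈ Icc a b ∧ h τ ≤ h b + η * (b - τ)} with hS
    have hbS : b ∈ S := ⟨⟨hab, le_rfl⟩, by simp⟩
    have hbdd : BddBelow S := ⟨a, fun τ hτ => hτ.1.1⟩
    set c := sInf S with hc
    have hca : a ≤ c := le_csInf ⟨b, hbS⟩ fun τ hτ => hτ.1.1
    have hcb : c ≤ b := csInf_le hbdd hbS
    have hcS : c ∈ S := by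
      by_contra hcS
      have hlt : c < b := lt_of_le_of_ne hcb fun h => hcS (h ▸ hbS)
      have hx : h b + η * (b - c) < h c := by
        by_contra! hle
        exact hcS ⟨⟨hca, hcb⟩, hle⟩
      have h3 := h2 c ⟨hca, hlt⟩ (h c - (h b + η * (b - c))) (by linarith)
      obtain ⟨d, hd, hd2⟩ := (mem_nhdsGT_iff_exists_Ioo_subset).1 h3
      obtain ⟨τ, hτS, hτd⟩ := exists_lt_of_csInf_lt ⟨b, hbS⟩ (show sInf S < d from hd)
      have hcτ : c < τ := lt_of_le_of_ne (csInf_le hbdd hτS) fun h => hcS (h ▸ hτS)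
      have h4 : h c - (h c - (h b + η * (b - c))) < h τ := hd2 ⟨hcτ, hτd⟩
      have := hτS.2
      nlinarith
    rcases hca.eq_or_lt with h0 | h0
    · rw [h0]; exact hcS.2
    · exfalso
      have h3 := h1 c ⟨h0, hcb⟩ η hη
      obtain ⟨d, hd, hd2⟩ := (mem_nhdsLT_iff_exists_Ioo_subset).1 h3
      have hd' : d < c := hd
      have hm : max a d < c := max_lt h0 hd'
      set s := (max a d + c) / 2
      have hs1 : max a d < s := by simp only [s]; linarith
      have hs2 : s < c := by simp only [s]; linarith
      have h4 : h s ≤ h c - (0 - η) * (c - s) := hd2 ⟨(le_max_right _ _).trans_lt hs1, hs2⟩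
      have : s ∈ S := ⟨⟨((le_max_left _ _).trans_lt hs1).le, hs2.le.trans hcb⟩, by
        have := hcS.2
        nlinarith⟩
      exact absurd (csInf_le hbdd this) (not_le.2 hs2)
  by_contra! hlt
  have := key ((h a - h b) / (2 * (b - a + 1))) (by
    apply div_pos <;> linarith)
  have h5 : (h a - h b) / (2 * (b - a + 1)) * (b - a) ≤ (h a - h b) / 2 := by
    rw [div_mul_eq_mul_div, div_le_div_iff₀ (by linarith) (by norm_num)]
    nlinarith
  linarith

lemma hasDerivAt_linear (c t : ℝ) : HasDerivAt (fun s : ℝ => c * s) c t := by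
  simpa using (hasDerivAt_id t).const_mul c

/-- Increase of a function with lower left slope `≥ K` off a small set of times. -/
lemma growth_of_lslope {h : ℝ → ℝ} {a b C K β : ℝ} (hab : a ≤ b) (hKC : 0 ≤ K + C) (hβ : 0 ≤ β)
    {Bad : Set ℝ} (hbad : volume Bad ≤ ENNReal.ofReal β)
    (h1 : ∀ t ∈ Ioc a b, LSlope h t (-C)) (h1' : ∀ t ∈ Ioc a b, t ∉ Bad → LSlope h t K)
    (h2 : ∀ t ∈ Ico a b, RLsc h t) : h a + K * (b - a) - (K + C) * β ≤ h b := by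
  refine le_of_forall_pos_le_add fun ε hε => ?_
  set ε' : ℝ := ε / (K + C + 1)
  have hε' : 0 < ε' := by positivity
  obtain ⟨U, hUs, hUo, hUv⟩ := Bad.exists_isOpen_lt_of_lt (μ := volume)
    (ENNReal.ofReal (β + ε')) (hbad.trans_lt (by
      rw [ENNReal.ofReal_lt_ofReal_iff (by linarith)]; linarith))
  have hfin : ∀ t, volume (U ∩ Ioc a t) ≠ ⊤ := fun t =>
    ((measure_mono inter_subset_left).trans_lt (hUv.trans ENNReal.ofReal_lt_top)).ne
  set V : ℝ → ℝ := fun t => (volume (U ∩ Ioc a t)).toReal with hV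
  have hVmono : Monotone V := fun s t hst =>
    ENNReal.toReal_mono (hfin t) (measure_mono (by gcongr))
  have hVslope : ∀ t ∈ Ioc a b, t ∈ U → LSlope V t 1 := by
    intro t ht htU η hη
    obtain ⟨l, hl, hlU⟩ := mem_nhdsLE_iff_exists_Ioc_subset.1
      (nhdsWithin_le_nhds (hUo.mem_nhds htU) : U ∈ 𝓝[≤] t)
    have hlt : max l a < t := max_lt hl ht.1
    filter_upwards [Ioo_mem_nhdsLT hlt] with s hs
    have hls : l < s := (le_max_left _ _).trans_lt hs.1
    have has : a < s := (le_max_right _ _).trans_lt hs.1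
    have hun : U ∩ Ioc a t = (U ∩ Ioc a s) ∪ Ioc s t := by
      ext x
      simp only [mem_inter_iff, mem_Ioc, mem_union]
      constructor
      · rintro ⟨h1, h2, h3⟩
        rcases le_or_gt x s with h | h
        · exact Or.inl ⟨h1, h2, h⟩
        · exact Or.inr ⟨h, h3⟩
      · rintro (⟨h1, h2, h3⟩ | ⟨h1, h2⟩)
        · exact ⟨h1, h2, h3.trans hs.2.le⟩
        · exact ⟨hlU ⟨hls.trans h1, h2⟩, has.trans h1, h2⟩
    have hVt : V t = V s + (t - s) := by
      simp only [hV]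
      rw [hun, measure_union _ measurableSet_Ioc, ENNReal.toReal_add (hfin s) (by simp),
        Real.volume_Ioc, ENNReal.toReal_ofReal (by linarith [hs.2])]
      exact disjoint_left.2 fun x hx hx' => absurd hx.2.2 (not_le.2 hx'.1)
    rw [hVt]
    nlinarith [hs.2]
  have hlin : ∀ t, LSlope (fun s => -K * s) t (-K) := fun t => (hasDerivAt_linear (-K) t).lslope
  have hVK : ∀ t c, 0 ≤ c → LSlope V t c → LSlope (fun s => (K + C) * V s) t ((K + C) * c) := by
    intro t c _ hc η hη
    filter_upwards [hc (η / (K + C + 1)) (by positivity), self_mem_nhdsWithin] with s hs hst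
    have hst' : s < t := hst
    have h3 : (K + C) * V s ≤ (K + C) * (V t - (c - η / (K + C + 1)) * (t - s)) :=
      mul_le_mul_of_nonneg_left hs hKC
    have h4 : (K + C) * (η / (K + C + 1)) ≤ η := by
      rw [mul_div_assoc', div_le_iff₀ (by linarith)]
      nlinarith
    nlinarith
  have hmain := le_of_lslope (h := fun t => (h t + -K * t) + (K + C) * V t) hab ?_ ?_
  · have hVa : 0 ≤ V a := ENNReal.toReal_nonneg
    have hVb : V b ≤ β + ε' := by
      refine (ENNReal.toReal_mono ENNReal.ofReal_ne_top
        ((measure_mono inter_subset_left).trans hUv.le)).trans_eq ?_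
      rw [ENNReal.toReal_ofReal (by linarith)]
    have h5 : (K + C) * V b ≤ (K + C) * β + ε := by
      have h6 : (K + C) * ε' ≤ ε := by
        simp only [ε']
        rw [mul_div_assoc', div_le_iff₀ (by linarith)]
        nlinarith
      nlinarith
    have h7 : 0 ≤ (K + C) * V a := mul_nonneg hKC hVa
    linarith
  · intro t ht
    by_cases htU : t ∈ U
    · refine (((h1 t ht).add (hlin t)).add (hVK t 1 zero_le_one (hVslope t ht htU))).mono ?_
      linarith
    · refine (((h1' t ht fun hb => htU (hUs hb)).add (hlin t)).add (hVK t 0 le_rfl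
        (lslope_zero_of_eventually_le ?_))).mono ?_
      · filter_upwards [self_mem_nhdsWithin] with s hs using hVmono (le_of_lt hs)
      · linarith
  · intro t ht
    refine ((h2 t ht).add ?_).add (rlsc_of_eventually_le ?_)
    · exact (hasDerivAt_linear (-K) t).continuousAt.rlsc
    · filter_upwards [self_mem_nhdsWithin] with s hs
      exact mul_le_mul_of_nonneg_left (hVmono (le_of_lt hs)) hKC

end

section

open Filter Topology Set MeasureTheory

variable {m : ℕ}

/-- The gradient of a function on `ℝⁿ`. -/
def gradV (u : Spc m → ℝ) (x : Spc m) : Spc m := WithLp.toLp 2 fun i => fderiv ℝ u x (eVec m i)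

/-- The linear map attached to a bilinear form. -/
def linB (B : Spc m →L[ℝ] Spc m →L[ℝ] ℝ) : Spc m →L[ℝ] Spc m :=
  ((PiLp.continuousLinearEquiv 2 ℝ fun _ : Fin (m + 1) => ℝ).symm :
      (Fin (m + 1) → ℝ) →L[ℝ] Spc m) ∘L
    ContinuousLinearMap.pi fun i => B.flip (eVec m i)

lemma linB_apply (B : Spc m →L[ℝ] Spc m →L[ℝ] ℝ) (v : Spc m) (i : Fin (m + 1)) :
    linB B v i = B v (eVec m i) := rfl

lemma linB_det (B : Spc m →L[ℝ] Spc m →L[ℝ] ℝ) : (linB B).det = (hmat B).det := by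
  rw [← Matrix.det_transpose, ContinuousLinearMap.det,
    ← LinearMap.det_toMatrix (EuclideanSpace.basisFun (Fin (m + 1)) ℝ).toBasis]
  congr 1

lemma gradV_hasFDerivAt {u : Spc m → ℝ} {x : Spc m} (hu : ContDiffAt ℝ 2 u x) :
    HasFDerivAt (gradV u) (linB (D2 u x)) x := by
  rw [← hasFDerivWithinAt_univ, hasFDerivWithinAt_euclidean]
  intro i
  rw [hasFDerivWithinAt_univ]
  have h := hu.hasFDerivAt_fderiv.clm_apply (hasFDerivAt_const (eVec m i) x)
  refine (h.congr_of_eventuallyEq (Eventually.of_forall fun y => rfl)).congr_fderiv ?_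
  ext v
  simp [linB_apply]

lemma gradV_eq_of_fderiv {u : Spc m → ℝ} {x p : Spc m} (h : fderiv ℝ u x = inB m p) :
    gradV u x = p := by
  ext i
  simp [gradV, h, inB_apply, eVec, EuclideanSpace.inner_single_right]

lemma continuousAt_det_D2 {u : Spc m → ℝ} {x : Spc m} (hu : ContDiffAt ℝ 2 u x) :
    ContinuousAt (fun y => (hmat (D2 u y)).det) x := by
  have h : ContinuousAt (D2 u) x :=
    ((hu.fderiv_right (m := 1) (by norm_num)).fderiv_right (m := 0) (by norm_num)).continuousAt
  have h2 : Continuous fun B : Spc m →L[ℝ] Spc m →L[ℝ] ℝ => (hmat B).det := by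
    refine Continuous.matrix_det (continuous_matrix fun i j => ?_)
    unfold hmat
    fun_prop
  exact h2.continuousAt.comp h

lemma area_bound {u : Spc m → ℝ} {Z : Set (Spc m)} (hZ : IsOpen Z)
    (hu : ∀ x ∈ Z, ContDiffAt ℝ 2 u x) (k : ℝ) :
    volume (gradV u '' {x ∈ Z | |(hmat (D2 u x)).det| < k ^ (m + 1)})
      ≤ ENNReal.ofReal (k ^ (m + 1)) * volume Z := by
  set s := {x ∈ Z | |(hmat (D2 u x)).det| < k ^ (m + 1)}
  have hs : IsOpen s := by
    have hc : ContinuousOn (fun y => |(hmat (D2 u y)).det|) Z := fun x hx =>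
      (continuousAt_det_D2 (hu x hx)).abs.continuousWithinAt
    exact hc.isOpen_inter_preimage hZ isOpen_Iio
  calc volume (gradV u '' s) ≤ ∫⁻ x in s, ENNReal.ofReal |(linB (D2 u x)).det| :=
        addHaar_image_le_lintegral_abs_det_fderiv volume hs.measurableSet
          fun x hx => (gradV_hasFDerivAt (hu x hx.1)).hasFDerivWithinAt
    _ ≤ ∫⁻ _x in s, ENNReal.ofReal (k ^ (m + 1)) := by
        refine setLIntegral_mono measurable_const fun x hx => ?_
        rw [linB_det]
        exact ENNReal.ofReal_le_ofReal hx.2.le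
    _ = ENNReal.ofReal (k ^ (m + 1)) * volume s := by rw [setLIntegral_const]
    _ ≤ _ := by
        gcongr
        exact fun x hx => hx.1

/-- Left slope of an average of functions of time. -/
lemma lslope_integral {P : Set (Spc m)} (hP : MeasurableSet P) (hPf : volume P ≠ ⊤)
    {f : ℝ → Spc m → ℝ} {t C ρ N : ℝ} (hρ : 0 ≤ ρ + C) (hN : 0 ≤ N)
    (hint : ∀ᶠ s in 𝓝[≤] t, IntegrableOn (f s) P)
    (hC : ∀ᶠ s in 𝓝[<] t, ∀ p ∈ P, f s p ≤ f t p + C * (t - s))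
    (hbad : volume {p ∈ P | ¬ LSlope (fun s => f s p) t ρ} ≤ ENNReal.ofReal N) :
    LSlope (fun s => ∫ p in P, f s p) t (ρ * (volume P).toReal - (ρ + C) * N) := by
  set bad := {p ∈ P | ¬ LSlope (fun s => f s p) t ρ}
  set B := toMeasurable volume bad with hB
  have hBm : MeasurableSet B := measurableSet_toMeasurable _ _
  have hBv : volume B ≤ ENNReal.ofReal N := by rwa [hB, measure_toMeasurable]
  have hft : IntegrableOn (f t) P := hint.self_of_nhdsWithin (mem_Iic.2 le_rfl)
  have hint' : ∀ᶠ s in 𝓝[<] t, IntegrableOn (f s) P :=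
    hint.filter_mono (nhdsWithin_mono _ Iio_subset_Iic_self)
  set G : ℝ → Spc m → ℝ := fun s =>
    B.piecewise (fun _ => ρ + C) fun p => max (ρ - (f t p - f s p) / (t - s)) 0 with hG
  set g : Spc m → ℝ := B.indicator fun _ => ρ + C with hg
  have hGb : ∀ᶠ s in 𝓝[<] t, ∀ p ∈ P, ‖G s p‖ ≤ ρ + C := by
    filter_upwards [hC, self_mem_nhdsWithin] with s hs hst p hp
    have hst' : 0 < t - s := sub_pos.2 hst
    by_cases hpB : p ∈ B
    · simp [hG, hpB, abs_of_nonneg hρ]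
    · simp only [hG, piecewise, hpB, if_false, Real.norm_eq_abs]
      rw [abs_of_nonneg (le_max_right _ _)]
      refine max_le ?_ hρ
      have : -C ≤ (f t p - f s p) / (t - s) := by
        rw [le_div_iff₀ hst']
        linarith [hs p hp]
      linarith
  have hGm : ∀ᶠ s in 𝓝[<] t, AEStronglyMeasurable (G s) (volume.restrict P) := by
    filter_upwards [hint'] with s hs
    have h1 : AEStronglyMeasurable (fun p => max (ρ - (f t p - f s p) / (t - s)) 0)
        (volume.restrict P) := by
      have h2 := (hft.1.sub hs.1).mul_const (t - s)⁻¹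
      exact (aestronglyMeasurable_const.sub h2).sup aestronglyMeasurable_const
    exact AEStronglyMeasurable.piecewise hBm aestronglyMeasurable_const h1.restrict
  have hlim : Tendsto (fun s => ∫ p in P, G s p) (𝓝[<] t) (𝓝 (∫ p in P, g p)) := by
    refine tendsto_integral_filter_of_dominated_convergence (fun _ => ρ + C) hGm ?_ ?_ ?_
    · filter_upwards [hGb] with s hs
      exact (ae_restrict_iff' hP).2 (Eventually.of_forall hs)
    · exact integrableOn_const hPf
    · refine (ae_restrict_iff' hP).2 (Eventually.of_forall fun p hp => ?_)
      by_cases hpB : p ∈ B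
      · simp [hG, hg, hpB]
      · simp only [hG, hg, piecewise, hpB, if_false, indicator_of_notMem, not_false_eq_true]
        have hsl : LSlope (fun s => f s p) t ρ := by
          by_contra hcon
          exact hpB (subset_toMeasurable _ _ ⟨hp, hcon⟩)
        rw [Metric.tendsto_nhds]
        intro ε hε
        filter_upwards [hsl (ε / 2) (by positivity), self_mem_nhdsWithin] with s hs hst
        have hst' : 0 < t - s := sub_pos.2 hst
        rw [Real.dist_eq, sub_zero, abs_of_nonneg (le_max_right _ _)]
        refine max_lt ?_ hε
        have : ρ - ε / 2 ≤ (f t p - f s p) / (t - s) := by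
          rw [le_div_iff₀ hst']
          linarith
        linarith
  have hgint : ∫ p in P, g p ≤ (ρ + C) * N := by
    rw [hg, setIntegral_indicator hBm, setIntegral_const, smul_eq_mul, mul_comm]
    refine mul_le_mul_of_nonneg_left ?_ hρ
    refine (ENNReal.toReal_mono ENNReal.ofReal_ne_top
      ((measure_mono inter_subset_right).trans hBv)).trans_eq ?_
    rw [ENNReal.toReal_ofReal hN]
  intro η hη
  have hlt : ∀ᶠ s in 𝓝[<] t, ∫ p in P, G s p < (ρ + C) * N + η :=
    hlim.eventually (gt_mem_nhds (by linarith))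
  filter_upwards [hlt, hC, hGb, hGm, hint', self_mem_nhdsWithin] with s h1 h2 h3 h4 h5 hst
  have hst' : 0 < t - s := sub_pos.2 hst
  have hGi : IntegrableOn (G s) P :=
    Integrable.mono' (integrableOn_const hPf) h4
      ((ae_restrict_iff' hP).2 (Eventually.of_forall h3))
  have hpt : ∀ p ∈ P, f s p ≤ f t p - (t - s) * (ρ - G s p) := by
    intro p hp
    by_cases hpB : p ∈ B
    · simp only [hG, piecewise, hpB, if_true]
      have := h2 p hp
      nlinarith
    · simp only [hG, piecewise, hpB, if_false]
      have h6 : ρ - (f t p - f s p) / (t - s) ≤ max (ρ - (f t p - f s p) / (t - s)) 0 :=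
        le_max_left _ _
      have h7 : (f t p - f s p) / (t - s) * (t - s) = f t p - f s p :=
        div_mul_cancel₀ _ hst'.ne'
      nlinarith
  have hci : IntegrableOn (fun _ : Spc m => ρ) P := integrableOn_const hPf
  have hsub : IntegrableOn (fun p => (t - s) * (ρ - G s p)) P := (hci.sub hGi).const_mul _
  have hle := setIntegral_mono_on h5 (hft.sub hsub) hP hpt
  simp only [Pi.sub_apply] at hle
  rw [integral_sub hft hsub, integral_const_mul, integral_sub hci hGi, setIntegral_const,
    smul_eq_mul, Measure.real] at hle
  nlinarith

end

section
open Filter Topology Set MeasureTheory Metric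
variable {m : ℕ}

/-- Hypotheses for the sliding-slope argument: `v` is a supersolution with source `S ≤ C` on
`ball 0 R × (t0, t1]`, nonnegative on the lateral boundary. -/
structure SliceHyp (lam Lam R t0 t1 C : ℝ)
    (a : Spc m → Matrix (Fin (m + 1)) (Fin (m + 1)) ℝ) (v S : ℝ → Spc m → ℝ) : Prop where
  lam_pos : 0 < lam
  R_pos : 0 < R
  C_nonneg : 0 ≤ C
  ell : ∀ x, EllM lam Lam (a x)
  c2 : ∀ t ∈ Ioc t0 t1, ∀ x ∈ ball (0 : Spc m) R, ContDiffAt ℝ 2 (v t) x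
  cont : ∀ t ∈ Icc t0 t1, ContinuousOn (v t) (closedBall 0 R)
  bd : ∀ t ∈ Icc t0 t1, ∀ x, ‖x‖ = R → 0 ≤ v t x
  rl : ∀ t ∈ Ico t0 t1, ∀ x ∈ closedBall (0 : Spc m) R, ∀ η > 0,
    ∀ᶠ q in 𝓝[>] t ×ˢ 𝓝 x, q.2 ∈ closedBall (0 : Spc m) R → v t x - η < v q.1 q.2
  ls : ∀ t ∈ Ioc t0 t1, ∀ x ∈ ball (0 : Spc m) R,
    LSlope (fun s => v s x) t (trA (a x) (D2 (v t) x) - S t x)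
  src : ∀ t ∈ Ioc t0 t1, ∀ x ∈ ball (0 : Spc m) R, S t x ≤ C

/-- The capped minimum of `v(·,t) - ⟨p,·⟩`. -/
def slice (r R : ℝ) (v : ℝ → Spc m → ℝ) (t : ℝ) (p : Spc m) : ℝ :=
  min (-2 * r * R) (sInf ((fun x => v t x - inner ℝ p x) '' closedBall 0 R))

namespace SliceHyp

variable {lam Lam R t0 t1 C r : ℝ} {a : Spc m → Matrix (Fin (m + 1)) (Fin (m + 1)) ℝ}
  {v S : ℝ → Spc m → ℝ}

lemma contOn (H : SliceHyp lam Lam R t0 t1 C a v S) {t : ℝ} (ht : t ∈ Icc t0 t1) (p : Spc m) :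
    ContinuousOn (fun x => v t x - inner ℝ p x) (closedBall 0 R) :=
  (H.cont t ht).sub (by fun_prop)

lemma slice_le (H : SliceHyp lam Lam R t0 t1 C a v S) {t : ℝ} (ht : t ∈ Icc t0 t1) (p : Spc m)
    {x : Spc m} (hx : x ∈ closedBall 0 R) : slice r R v t p ≤ v t x - inner ℝ p x :=
  (min_le_right _ _).trans (csInf_le
    ((isCompact_closedBall 0 R).bddBelow_image (H.contOn ht p)) (mem_image_of_mem _ hx))

lemma slice_eq (H : SliceHyp lam Lam R t0 t1 C a v S) {t : ℝ} (ht : t ∈ Icc t0 t1) (p : Spc m) :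
    slice r R v t p = -2 * r * R ∨
      ∃ x ∈ closedBall (0 : Spc m) R, slice r R v t p = v t x - inner ℝ p x := by
  rcases min_choice (-2 * r * R)
    (sInf ((fun x => v t x - inner ℝ p x) '' closedBall (0 : Spc m) R)) with h | h
  · exact Or.inl h
  · obtain ⟨x, hx, hxe⟩ := (isCompact_closedBall (0 : Spc m) R).exists_sInf_image_eq
      ⟨0, mem_closedBall_self H.R_pos.le⟩ (H.contOn ht p)
    exact Or.inr ⟨x, hx, by rw [slice, h, hxe]⟩

lemma slice_lt (H : SliceHyp lam Lam R t0 t1 C a v S) {t : ℝ} (ht : t ∈ Icc t0 t1) (p : Spc m)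
    {c : ℝ} (hc : c < -2 * r * R)
    (h : ∀ x ∈ closedBall (0 : Spc m) R, c < v t x - inner ℝ p x) : c < slice r R v t p := by
  rcases H.slice_eq (r := r) ht p with h1 | ⟨x, hx, h1⟩
  · rwa [h1]
  · rw [h1]; exact h x hx

lemma le_slice (H : SliceHyp lam Lam R t0 t1 C a v S) {t : ℝ} (ht : t ∈ Icc t0 t1) (p : Spc m)
    {c : ℝ} (hc : c ≤ -2 * r * R)
    (h : ∀ x ∈ closedBall (0 : Spc m) R, c ≤ v t x - inner ℝ p x) : c ≤ slice r R v t p := by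
  rcases H.slice_eq (r := r) ht p with h1 | ⟨x, hx, h1⟩
  · rwa [h1]
  · rw [h1]; exact h x hx

lemma slice_lip (H : SliceHyp lam Lam R t0 t1 C a v S) {t : ℝ} (ht : t ∈ Icc t0 t1)
    (p q : Spc m) : slice r R v t p ≤ slice r R v t q + R * dist p q := by
  have hd : 0 ≤ R * dist p q := mul_nonneg H.R_pos.le dist_nonneg
  rcases H.slice_eq (r := r) ht q with h1 | ⟨x, hx, h1⟩
  · rw [h1]
    exact (min_le_left _ _).trans (by linarith)
  · rw [h1]
    refine (H.slice_le ht p hx).trans ?_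
    have h2 : inner ℝ (q - p) x ≤ ‖q - p‖ * ‖x‖ := real_inner_le_norm _ _
    rw [inner_sub_left] at h2
    have h3 : ‖q - p‖ = dist p q := by rw [dist_comm, dist_eq_norm]
    have h4 : ‖x‖ ≤ R := by simpa using hx
    rw [h3] at h2
    nlinarith [dist_nonneg (x := p) (y := q)]

lemma slice_continuous (H : SliceHyp lam Lam R t0 t1 C a v S) {t : ℝ} (ht : t ∈ Icc t0 t1) :
    Continuous (slice r R v t) :=
  (LipschitzWith.of_le_add_mul R.toNNReal fun p q => by
    simpa [Real.coe_toNNReal _ H.R_pos.le] using H.slice_lip ht p q).continuous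

lemma slice_slope (H : SliceHyp lam Lam R t0 t1 C a v S) (hr : 0 < r) {t : ℝ}
    (ht : t ∈ Ioc t0 t1) {p : Spc m} (hp : ‖p‖ ≤ r) :
    (slice r R v t p = -2 * r * R ∧ LSlope (fun s => slice r R v s p) t 0) ∨
      ∃ x ∈ ball (0 : Spc m) R, slice r R v t p = v t x - inner ℝ p x ∧
        gradV (v t) x = p ∧ PSDB (D2 (v t) x) ∧
        LSlope (fun s => slice r R v s p) t (lam * trB (D2 (v t) x) - S t x) := by
  have ht' : t ∈ Icc t0 t1 := ⟨ht.1.le, ht.2⟩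
  by_cases hcap : slice r R v t p = -2 * r * R
  · refine Or.inl ⟨hcap, lslope_zero_of_eventually_le (Eventually.of_forall fun s => ?_)⟩
    rw [hcap]
    exact min_le_left _ _
  right
  rcases H.slice_eq (r := r) ht' p with h1 | ⟨x, hx, h1⟩
  · exact absurd h1 hcap
  have hxR : ‖x‖ ≤ R := by simpa using hx
  have hrR : 0 < r * R := mul_pos hr H.R_pos
  have hxb : x ∈ ball (0 : Spc m) R := by
    rw [mem_ball_zero_iff]
    refine lt_of_le_of_ne hxR fun hxe => ?_
    have h2 := H.bd t ht' x hxe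
    have h3 : inner ℝ p x ≤ ‖p‖ * ‖x‖ := real_inner_le_norm _ _
    rw [hxe] at h3
    have h4 : slice r R v t p ≤ -2 * r * R := min_le_left _ _
    have h5 : ‖p‖ * R ≤ r * R := mul_le_mul_of_nonneg_right hp H.R_pos.le
    linarith
  have hc2 := H.c2 t ht x hxb
  have hlin : ContDiffAt ℝ 2 (fun y => -1 * inB m p y) x := by fun_prop
  set φ : Spc m → ℝ := fun y => v t y + -1 * inB m p y
  have hφ : ContDiffAt ℝ 2 φ x := hc2.add hlin
  have hmin : IsLocalMin φ x := by
    filter_upwards [isOpen_ball.mem_nhds hxb] with y hy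
    have h2 := H.slice_le (r := r) ht' p (ball_subset_closedBall hy)
    rw [h1] at h2
    simp only [φ, inB_apply]
    linarith
  have hD : D2 φ x = D2 (v t) x := by
    rw [D2_add hc2 hlin, D2_const_mul (by fun_prop), D2_linear]
    ext v w
    simp
  have hpsd : PSDB (D2 (v t) x) := hD ▸ D2_psd_of_isLocalMin hφ hmin
  have hgrad : fderiv ℝ (v t) x = inB m p := by
    have h2 := hmin.fderiv_eq_zero
    have h3 : HasFDerivAt φ (fderiv ℝ (v t) x + (-1 : ℝ) • inB m p) x :=
      (hc2.differentiableAt (by norm_num)).hasFDerivAt.add ((inB m p).hasFDerivAt.const_mul (-1))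
    rw [h3.fderiv] at h2
    ext y
    have h4 := congrArg (fun l => l y) h2
    simp at h4
    linarith
  refine ⟨x, hxb, h1, gradV_eq_of_fderiv hgrad, hpsd, ?_⟩
  have hl := (H.ls t ht x hxb).mono (sub_le_sub_right ((H.ell x).lower hpsd) (S t x))
  intro η hη
  filter_upwards [hl η hη, Ioo_mem_nhdsLT ht.1] with s hs hst
  have h2 := H.slice_le (r := r) ⟨hst.1.le, hst.2.le.trans ht.2⟩ p hx
  rw [h1]
  linarith

lemma slice_slope' (H : SliceHyp lam Lam R t0 t1 C a v S) (hr : 0 < r) {t : ℝ}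
    (ht : t ∈ Ioc t0 t1) {p : Spc m} (hp : ‖p‖ ≤ r) :
    LSlope (fun s => slice r R v s p) t (-C) := by
  rcases H.slice_slope hr ht hp with ⟨-, h⟩ | ⟨x, hx, -, -, hpsd, h⟩
  · exact h.mono (by linarith [H.C_nonneg])
  · refine h.mono ?_
    have := mul_nonneg H.lam_pos.le hpsd.trB_nonneg
    linarith [H.src t ht x hx]

lemma slice_rlsc (H : SliceHyp lam Lam R t0 t1 C a v S) {t : ℝ}
    (ht : t ∈ Ico t0 t1) (p : Spc m) : RLsc (fun s => slice r R v s p) t := by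
  intro η hη
  have key : ∀ᶠ q in 𝓝[>] t ×ˢ 𝓝ˢ (closedBall (0 : Spc m) R),
      q.2 ∈ closedBall (0 : Spc m) R → slice r R v t p - η < v q.1 q.2 - inner ℝ p q.2 := by
    refine (isCompact_closedBall (0 : Spc m) R).mem_prod_nhdsSet_of_forall fun x hx => ?_
    have h1 := H.slice_le (r := r) ⟨ht.1, ht.2.le⟩ p hx
    have h2 : ∀ᶠ y in 𝓝 x, inner ℝ p y < inner ℝ p x + η / 2 := by
      have hc : Continuous fun y : Spc m => inner ℝ p y := by fun_prop
      exact hc.continuousAt.eventually (gt_mem_nhds (by linarith))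
    filter_upwards [H.rl t ht x hx (η / 2) (by positivity), h2.prod_inr (𝓝[>] t)]
      with q hq1 hq2 hq
    have := hq1 hq
    linarith
  have h3 : ∀ᶠ s in 𝓝[>] t, ∀ y ∈ closedBall (0 : Spc m) R,
      slice r R v t p - η < v s y - inner ℝ p y := by
    have h4 := key.filter_mono (prod_mono_right _ (principal_le_nhdsSet))
    have := eventually_prod_principal_iff.1 h4
    filter_upwards [this] with s hs y hy using hs y hy hy
  filter_upwards [h3, Ioo_mem_nhdsGT ht.2] with s hs hst
  refine H.slice_lt ⟨ht.1.trans hst.1.le, hst.2.le⟩ p ?_ hs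
  have : slice r R v t p ≤ -2 * r * R := min_le_left _ _
  linarith

lemma slice_mono (H : SliceHyp lam Lam R t0 t1 C a v S) (hr : 0 < r) {p : Spc m} (hp : ‖p‖ ≤ r)
    {s t : ℝ} (hs : t0 ≤ s) (hst : s ≤ t) (ht : t ≤ t1) :
    slice r R v s p ≤ slice r R v t p + C * (t - s) := by
  have := le_of_lslope (h := fun τ => slice r R v τ p + C * τ) hst
    (fun τ hτ => ((H.slice_slope' hr ⟨hs.trans_lt hτ.1, hτ.2.trans ht⟩ hp).add
      (hasDerivAt_linear C τ).lslope).mono (by simp))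
    (fun τ hτ => (H.slice_rlsc ⟨hs.trans hτ.1, hτ.2.trans_le ht⟩ p).add
      (hasDerivAt_linear C τ).continuousAt.rlsc)
  linarith

/-- The average over slopes of the capped minima. -/
def avg (r R : ℝ) (v : ℝ → Spc m → ℝ) (t : ℝ) : ℝ :=
  ∫ p in closedBall (0 : Spc m) r, slice r R v t p

lemma slice_integrableOn (H : SliceHyp lam Lam R t0 t1 C a v S) {t : ℝ} (ht : t ∈ Icc t0 t1) :
    IntegrableOn (slice r R v t) (closedBall 0 r) :=
  (H.slice_continuous ht).continuousOn.integrableOn_compact (isCompact_closedBall 0 r)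

lemma avg_slope (H : SliceHyp lam Lam R t0 t1 C a v S) (hr : 0 < r) {t : ℝ}
    (ht : t ∈ Ioc t0 t1) {ρ k N : ℝ} {Z : Set (Spc m)} (hk : 0 ≤ k) (hN : 0 ≤ N)
    (hZ : IsOpen Z) (hZR : Z ⊆ ball 0 R) (hZN : volume Z ≤ ENNReal.ofReal N)
    (hρ : -C ≤ ρ) (hρk : ρ ≤ lam * k - C)
    (hp : ∀ p : Spc m, ‖p‖ ≤ r → ∀ x ∈ ball (0 : Spc m) R, x ∉ Z →
      slice r R v t p = v t x - inner ℝ p x → ρ ≤ -S t x)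
    (hcap : 0 < ρ → ∀ p : Spc m, ‖p‖ ≤ r → slice r R v t p ≠ -2 * r * R) :
    LSlope (avg r R v) t
      (ρ * (volume (closedBall (0 : Spc m) r)).toReal - (ρ + C) * (k ^ (m + 1) * N)) := by
  refine lslope_integral measurableSet_closedBall
    (isCompact_closedBall (0 : Spc m) r).measure_lt_top.ne (by linarith) (by positivity)
    ?_ ?_ ?_
  · filter_upwards [Ioc_mem_nhdsLE ht.1] with s hs
    exact H.slice_integrableOn ⟨hs.1.le, hs.2.trans ht.2⟩
  · filter_upwards [Ioo_mem_nhdsLT ht.1] with s hs p hp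
    exact H.slice_mono hr (by simpa using hp) hs.1.le hs.2.le ht.2
  · calc volume {p ∈ closedBall (0 : Spc m) r | ¬ LSlope (fun s => slice r R v s p) t ρ}
        ≤ volume (gradV (v t) '' {x ∈ Z | |(hmat (D2 (v t) x)).det| < k ^ (m + 1)}) := by
          refine measure_mono fun p hp' => ?_
          have hpr : ‖p‖ ≤ r := by simpa using hp'.1
          rcases H.slice_slope hr ht hpr with ⟨h1, h2⟩ | ⟨x, hx, hxe, hg, hpsd, hl⟩
          · by_cases hρ0 : 0 < ρ
            · exact absurd h1 (hcap hρ0 p hpr)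
            · exact absurd (h2.mono (not_lt.1 hρ0)) hp'.2
          · have htr := mul_nonneg H.lam_pos.le hpsd.trB_nonneg
            have hxZ : x ∈ Z := by
              by_contra hxZ
              refine hp'.2 (hl.mono ?_)
              linarith [hp p hpr x hx hxZ hxe]
            refine ⟨x, ⟨hxZ, hpsd.abs_det_lt ?_⟩, hg⟩
            by_contra! hk'
            refine hp'.2 (hl.mono ?_)
            have h3 := H.src t ht x hx
            have h4 := mul_le_mul_of_nonneg_left hk' H.lam_pos.le
            linarith
      _ ≤ ENNReal.ofReal (k ^ (m + 1)) * volume Z :=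
          area_bound hZ (fun x hx => H.c2 t ht x (hZR hx)) k
      _ ≤ ENNReal.ofReal (k ^ (m + 1)) * ENNReal.ofReal N := by gcongr
      _ = ENNReal.ofReal (k ^ (m + 1) * N) := (ENNReal.ofReal_mul (by positivity)).symm

lemma avg_rlsc (H : SliceHyp lam Lam R t0 t1 C a v S) (hr : 0 < r) {t : ℝ}
    (ht : t ∈ Ico t0 t1) : RLsc (avg r R v) t := by
  have h : RLsc (fun s => (avg r R v s + C * (volume (closedBall (0 : Spc m) r)).toReal * s) +
      -(C * (volume (closedBall (0 : Spc m) r)).toReal) * s) t := by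
    refine RLsc.add (rlsc_of_eventually_le ?_) (hasDerivAt_linear _ t).continuousAt.rlsc
    filter_upwards [Ioo_mem_nhdsGT ht.2] with s hs
    have hi1 := H.slice_integrableOn (r := r) ⟨ht.1, ht.2.le⟩
    have hi2 := H.slice_integrableOn (r := r) ⟨ht.1.trans hs.1.le, hs.2.le⟩
    have hc : IntegrableOn (fun _ : Spc m => C * (s - t)) (closedBall 0 r) :=
      integrableOn_const (isCompact_closedBall (0 : Spc m) r).measure_lt_top.ne
    have h2 := setIntegral_mono_on hi1 (hi2.add hc) measurableSet_closedBall fun p hp =>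
      H.slice_mono hr (by simpa using hp) ht.1 hs.1.le hs.2.le
    simp only [Pi.add_apply] at h2
    rw [integral_add hi2 hc, setIntegral_const, smul_eq_mul, Measure.real] at h2
    simp only [avg]
    nlinarith
  intro η hη
  filter_upwards [h η hη] with s hs
  linarith

end SliceHyp

/-- Joint lower semicontinuity from the right in time. -/
def JRL (v : ℝ → Spc m → ℝ) (t : ℝ) (x : Spc m) : Prop :=
  ∀ η > 0, ∀ᶠ q in 𝓝[>] t ×ˢ 𝓝 x, v t x - η < v q.1 q.2

lemma JRL.add {u v : ℝ → Spc m → ℝ} {t : ℝ} {x : Spc m} (hu : JRL u t x) (hv : JRL v t x) :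
    JRL (fun s y => u s y + v s y) t x := by
  intro η hη
  filter_upwards [hu (η / 2) (by positivity), hv (η / 2) (by positivity)] with q h1 h2
  linarith

lemma JRL.const_mul {v : ℝ → Spc m → ℝ} {t : ℝ} {x : Spc m} (hv : JRL v t x) {c : ℝ}
    (hc : 0 < c) : JRL (fun s y => c * v s y) t x := by
  intro η hη
  filter_upwards [hv (η / c) (by positivity)] with q h1
  have h2 := mul_lt_mul_of_pos_left h1 hc
  rw [mul_sub, mul_div_cancel₀ _ hc.ne'] at h2
  exact h2

lemma jrl_of_continuousAt {v : ℝ → Spc m → ℝ} {t : ℝ} {x : Spc m}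
    (h : ContinuousAt (fun q : ℝ × Spc m => v q.1 q.2) (t, x)) : JRL v t x := by
  intro η hη
  have h1 : ∀ᶠ q in 𝓝 (t, x), v t x - η < v q.1 q.2 :=
    h.eventually (lt_mem_nhds (sub_lt_self _ hη))
  rw [nhds_prod_eq] at h1
  exact h1.filter_mono (prod_mono_left _ nhdsWithin_le_nhds)

lemma jrl_sum {ι : Type*} (s : Finset ι) {u : ι → ℝ → Spc m → ℝ} {t : ℝ} {x : Spc m}
    (hu : ∀ i ∈ s, JRL (u i) t x) : JRL (fun τ y => ∑ i ∈ s, u i τ y) t x := by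
  induction s using Finset.induction_on with
  | empty => simpa using jrl_of_continuousAt (v := fun _ _ => 0) (t := t) (x := x) (by fun_prop)
  | insert i s hi ih =>
    simp only [Finset.sum_insert hi]
    exact (hu i (by simp)).add (ih fun j hj => hu j (by simp [hj]))

lemma JRL.congr {u v : ℝ → Spc m → ℝ} {t : ℝ} {x : Spc m} (hu : JRL u t x)
    (h0 : v t x = u t x) (h : ∀ᶠ s in 𝓝[>] t, ∀ y, v s y = u s y) : JRL v t x := by
  intro η hη
  filter_upwards [hu η hη, h.prod_inl (𝓝 x)] with q h1 h2
  rwa [h0, h2]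

lemma JRL.shift {u : ℝ → Spc m → ℝ} {t d : ℝ} {x : Spc m} (hu : JRL u (t - d) x) :
    JRL (fun s y => u (s - d) y) t x := by
  intro η hη
  have h : Tendsto (fun s => s - d) (𝓝[>] t) (𝓝[>] (t - d)) := by
    refine tendsto_nhdsWithin_of_tendsto_nhds_of_eventually_within _ ?_ ?_
    · exact ((continuous_id.sub continuous_const).tendsto t).mono_left nhdsWithin_le_nhds
    · filter_upwards [self_mem_nhdsWithin] with s hs
      exact sub_lt_sub_right hs d
  exact (h.prodMap tendsto_id).eventually (hu η hη)

lemma LSlope.const_mul {f : ℝ → ℝ} {t c k : ℝ} (hf : LSlope f t c) (hk : 0 < k) :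
    LSlope (fun s => k * f s) t (k * c) := by
  intro η hη
  filter_upwards [hf (η / k) (by positivity)] with s h1
  have h2 := mul_le_mul_of_nonneg_left h1 hk.le
  have h3 : k * (f t - (c - η / k) * (t - s)) = k * f t - (k * c - η) * (t - s) := by
    field_simp
  linarith

lemma lslope_sum {ι : Type*} (s : Finset ι) {f : ι → ℝ → ℝ} {c : ι → ℝ} {t : ℝ}
    (hf : ∀ i ∈ s, LSlope (f i) t (c i)) :
    LSlope (fun τ => ∑ i ∈ s, f i τ) t (∑ i ∈ s, c i) := by
  induction s using Finset.induction_on with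
  | empty => simpa using (hasDerivAt_const t (0 : ℝ)).lslope
  | insert i s hi ih =>
    simp only [Finset.sum_insert hi]
    exact (hf i (by simp)).add (ih fun j hj => hf j (by simp [hj]))

lemma LSlope.congr {f g : ℝ → ℝ} {t c : ℝ} (hf : LSlope f t c) (h0 : g t = f t)
    (h : ∀ᶠ s in 𝓝[<] t, g s = f s) : LSlope g t c := by
  intro η hη
  filter_upwards [hf η hη, h] with s h1 h2
  rwa [h0, h2]

lemma LSlope.shift {f : ℝ → ℝ} {t c d : ℝ} (hf : LSlope f (t - d) c) :
    LSlope (fun s => f (s - d)) t c := by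
  intro η hη
  have h : Tendsto (fun s => s - d) (𝓝[<] t) (𝓝[<] (t - d)) := by
    refine tendsto_nhdsWithin_of_tendsto_nhds_of_eventually_within _ ?_ ?_
    · exact ((continuous_id.sub continuous_const).tendsto t).mono_left nhdsWithin_le_nhds
    · filter_upwards [self_mem_nhdsWithin] with s hs
      exact sub_lt_sub_right hs d
  filter_upwards [h.eventually (hf η hη)] with s hs
  have e : t - d - (s - d) = t - s := by ring
  rwa [e] at hs

/-- Supersolutions on `ball 0 ρ × [0,1]` bounded below by `-C`. -/
structure Super (lam Lam ρ C : ℝ) (a : Spc m → Matrix (Fin (m + 1)) (Fin (m + 1)) ℝ)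
    (u : ℝ → Spc m → ℝ) : Prop where
  lam_pos : 0 < lam
  ell : ∀ x, EllM lam Lam (a x)
  C_nonneg : 0 ≤ C
  c2 : ∀ t ∈ Icc (0 : ℝ) 1, ∀ x ∈ ball (0 : Spc m) ρ, ContDiffAt ℝ 2 (u t) x
  ct : ∀ x ∈ ball (0 : Spc m) ρ, ContinuousOn (fun s => u s x) (Icc 0 1)
  ls : ∀ t ∈ Ioc (0 : ℝ) 1, ∀ x ∈ ball (0 : Spc m) ρ,
    LSlope (fun s => u s x) t (trA (a x) (D2 (u t) x))
  rl : ∀ t ∈ Ioo (0 : ℝ) 1, ∀ x ∈ ball (0 : Spc m) ρ, JRL u t x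
  lower : ∀ t ∈ Icc (0 : ℝ) 1, ∀ x ∈ ball (0 : Spc m) ρ, -C ≤ u t x

lemma EllM.Lam_nonneg {lam Lam : ℝ} {a : Matrix (Fin (m + 1)) (Fin (m + 1)) ℝ}
    (hlam : 0 < lam) (ha : EllM lam Lam a) : 0 ≤ Lam := by
  have := ha.2 (eVec m 0)
  rw [eVec_norm] at this
  linarith [this.1, this.2]

/-- Truncation of `s` to `[0, κ]`. -/
def clampK (κ s : ℝ) : ℝ := max 0 (min κ s)

lemma clampK_nonneg (κ s : ℝ) : 0 ≤ clampK κ s := le_max_left _ _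

lemma clampK_of_nonpos {κ s : ℝ} (hs : s ≤ 0) : clampK κ s = 0 :=
  max_eq_left ((min_le_right _ _).trans hs)

lemma clampK_of_mem {κ s : ℝ} (h0 : 0 ≤ s) (h1 : s ≤ κ) : clampK κ s = s := by
  rw [clampK, min_eq_right h1, max_eq_right h0]

lemma clampK_of_ge {κ s : ℝ} (hκ : 0 ≤ κ) (h1 : κ ≤ s) : clampK κ s = κ := by
  rw [clampK, min_eq_left h1, max_eq_right hκ]

lemma sum_clampK {κ t : ℝ} (hκ : 0 ≤ κ) (ht : 0 ≤ t) (J : ℕ) :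
    ∑ i ∈ Finset.range J, clampK κ (t - i * κ) = min t (J * κ) := by
  induction J with
  | zero => simp [ht]
  | succ J ih =>
    have e : ((J + 1 : ℕ) : ℝ) * κ = J * κ + κ := by push_cast; ring
    rw [Finset.sum_range_succ, ih, e]
    rcases le_total t (J * κ) with h | h
    · rw [clampK_of_nonpos (by linarith), min_eq_left h, min_eq_left (by linarith), add_zero]
    · rcases le_total t (J * κ + κ) with h2 | h2
      · rw [clampK_of_mem (by linarith) (by linarith), min_eq_right h, min_eq_left h2]; ring
      · rw [clampK_of_ge hκ (by linarith), min_eq_right h, min_eq_right h2]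

/-- A single summand of the Riemann sum in time, ramped up linearly on `[0, κ]`. -/
def ramp (κ ε : ℝ) (u : ℝ → Spc m → ℝ) (τ : ℝ) (x : Spc m) : ℝ :=
  clampK κ τ * u (ε + max (τ - κ) 0) x

/-- The left slope of `ramp`, minus its elliptic part. -/
def rampSlope (κ : ℝ) (F : ℝ) (LF : ℝ) (τ : ℝ) : ℝ :=
  if 0 < τ ∧ τ ≤ κ then F - τ * LF else 0

namespace Super

variable {lam Lam ρ C κ ε : ℝ} {a : Spc m → Matrix (Fin (m + 1)) (Fin (m + 1)) ℝ}
  {u : ℝ → Spc m → ℝ}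

lemma ramp_mem (hε : 0 < ε) (hκ : 0 < κ) (hε1 : ε < 1) {τ : ℝ} (hτ : τ ≤ 1 - ε) :
    ε + max (τ - κ) 0 ∈ Ioo (0 : ℝ) 1 := by
  constructor
  · have := le_max_right (τ - κ) 0
    linarith
  · rcases max_cases (τ - κ) 0 with h | h <;> rw [h.1] <;> linarith

lemma ramp_contDiffAt (H : Super lam Lam ρ C a u) (hε : 0 < ε) (hκ : 0 < κ) (hε1 : ε < 1) {τ : ℝ}
    (hτ : τ ≤ 1 - ε) {x : Spc m} (hx : x ∈ ball (0 : Spc m) ρ) :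
    ContDiffAt ℝ 2 (ramp κ ε u τ) x :=
  contDiffAt_const.mul (H.c2 _ (Ioo_subset_Icc_self (ramp_mem hε hκ hε1 hτ)) x hx)

lemma ramp_D2 (H : Super lam Lam ρ C a u) (hε : 0 < ε) (hκ : 0 < κ) (hε1 : ε < 1) {τ : ℝ}
    (hτ : τ ≤ 1 - ε) {x : Spc m} (hx : x ∈ ball (0 : Spc m) ρ) :
    D2 (ramp κ ε u τ) x = clampK κ τ • D2 (u (ε + max (τ - κ) 0)) x :=
  D2_const_mul (H.c2 _ (Ioo_subset_Icc_self (ramp_mem hε hκ hε1 hτ)) x hx) _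

lemma ramp_slope (H : Super lam Lam ρ C a u) (hε : 0 < ε) (hκ : 0 < κ) (hε1 : ε < 1) {τ : ℝ}
    (hτ : τ ≤ 1 - ε) {x : Spc m} (hx : x ∈ ball (0 : Spc m) ρ) :
    LSlope (fun s => ramp κ ε u s x) τ (trA (a x) (D2 (ramp κ ε u τ) x) +
      rampSlope κ (u ε x) (trA (a x) (D2 (u ε) x)) τ) := by
  rw [H.ramp_D2 hε hκ hε1 hτ hx, trA_smul]
  rcases le_or_gt τ 0 with h | h
  · rw [clampK_of_nonpos h, rampSlope, if_neg (by intro h'; linarith [h'.1]), zero_mul, add_zero]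
    refine (hasDerivAt_const τ (0 : ℝ)).lslope.congr ?_ ?_
    · simp [ramp, clampK_of_nonpos h]
    · filter_upwards [self_mem_nhdsWithin] with s hs
      have hs' : s < τ := hs
      simp [ramp, clampK_of_nonpos (hs'.le.trans h)]
  rcases le_or_gt τ κ with h' | h'
  · rw [clampK_of_mem h.le h', max_eq_right (by linarith), rampSlope, if_pos ⟨h, h'⟩, add_zero]
    have hd : HasDerivAt (fun s : ℝ => s * u ε x) (u ε x) τ := by
      simpa using (hasDerivAt_id τ).mul_const (u ε x)
    refine (hd.lslope.mono (by linarith)).congr ?_ ?_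
    · simp [ramp, clampK_of_mem h.le h', max_eq_right (show τ - κ ≤ 0 by linarith)]
    · filter_upwards [Ioo_mem_nhdsLT h] with s hs
      simp [ramp, clampK_of_mem hs.1.le (hs.2.le.trans h'),
        max_eq_right (show s - κ ≤ 0 by linarith [hs.2])]
  · rw [clampK_of_ge hκ.le h'.le, max_eq_left (by linarith), rampSlope,
      if_neg (by intro h2; linarith [h2.2]), add_zero]
    have e : τ - (κ - ε) = ε + (τ - κ) := by ring
    have hl : LSlope (fun s => u s x) (τ - (κ - ε)) (trA (a x) (D2 (u (ε + (τ - κ))) x)) := by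
      rw [e]
      exact H.ls _ ⟨by linarith, by linarith⟩ x hx
    refine (hl.shift.const_mul hκ).congr ?_ ?_
    · simp [ramp, clampK_of_ge hκ.le h'.le, max_eq_left (show 0 ≤ τ - κ by linarith), e]
    · filter_upwards [Ioo_mem_nhdsLT h'] with s hs
      have e' : s - (κ - ε) = ε + (s - κ) := by ring
      simp [ramp, clampK_of_ge hκ.le hs.1.le, max_eq_left (show 0 ≤ s - κ by linarith [hs.1]), e']

lemma ramp_jrl (H : Super lam Lam ρ C a u) (hε : 0 < ε) (hκ : 0 < κ) (hε1 : ε < 1) {τ : ℝ}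
    (hτ : τ ≤ 1 - ε) {x : Spc m} (hx : x ∈ ball (0 : Spc m) ρ) :
    JRL (ramp κ ε u) τ x := by
  rcases lt_or_ge τ κ with h | h
  · have hc : ContinuousAt (u ε) x := (H.c2 ε ⟨hε.le, hε1.le⟩ x hx).continuousAt
    have h1 : JRL (fun s y => clampK κ s * u ε y) τ x := by
      refine jrl_of_continuousAt ?_
      have h2 : Continuous fun q : ℝ × Spc m => clampK κ q.1 := by unfold clampK; fun_prop
      exact h2.continuousAt.mul (hc.comp (f := Prod.snd) (x := (τ, x)) continuousAt_snd)
    refine h1.congr ?_ ?_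
    · simp [ramp, max_eq_right (show τ - κ ≤ 0 by linarith)]
    · filter_upwards [Ioo_mem_nhdsGT h] with s hs y
      simp [ramp, max_eq_right (show s - κ ≤ 0 by linarith [hs.2])]
  · have e : τ - (κ - ε) = ε + (τ - κ) := by ring
    have h1 : JRL u (τ - (κ - ε)) x := by
      rw [e]
      exact H.rl _ ⟨by linarith, by linarith⟩ x hx
    refine (h1.shift.const_mul hκ).congr ?_ ?_
    · simp [ramp, clampK_of_ge hκ.le h, max_eq_left (show 0 ≤ τ - κ by linarith), e]
    · filter_upwards [self_mem_nhdsWithin] with s hs y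
      have hs' : τ < s := hs
      have e' : s - (κ - ε) = ε + (s - κ) := by ring
      simp [ramp, clampK_of_ge hκ.le (h.trans hs'.le),
        max_eq_left (show 0 ≤ s - κ by linarith), e']

lemma ramp_lower (H : Super lam Lam ρ C a u) (hε : 0 < ε) (hκ : 0 < κ) (hε1 : ε < 1) {τ : ℝ}
    (hτ : τ ≤ 1 - ε) {x : Spc m} (hx : x ∈ ball (0 : Spc m) ρ) :
    -C * clampK κ τ ≤ ramp κ ε u τ x := by
  have := mul_le_mul_of_nonneg_left
    (H.lower _ (Ioo_subset_Icc_self (ramp_mem hε hκ hε1 hτ)) x hx) (clampK_nonneg κ τ)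
  unfold ramp
  linarith

end Super

lemma sum_rampSlope {κ t F LF M : ℝ} (hκ : 0 < κ) (hM : |LF| ≤ M) (ht : 0 < t) {J : ℕ}
    (htJ : t ≤ J * κ) :
    F - κ * M ≤ ∑ i ∈ Finset.range J, rampSlope κ F LF (t - i * κ) := by
  induction J with
  | zero => simp at htJ; linarith
  | succ J ih =>
    have e : ((J + 1 : ℕ) : ℝ) * κ = J * κ + κ := by push_cast; ring
    rw [e] at htJ
    rw [Finset.sum_range_succ]
    rcases le_or_gt t (J * κ) with h | h
    · have h0 : rampSlope κ F LF (t - J * κ) = 0 := if_neg (by intro h'; linarith [h'.1])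
      rw [h0, add_zero]
      exact ih h
    · have h0 : ∑ i ∈ Finset.range J, rampSlope κ F LF (t - i * κ) = 0 := by
        refine Finset.sum_eq_zero fun i hi => if_neg ?_
        intro h'
        have h1 : (i : ℝ) + 1 ≤ J := by exact_mod_cast Finset.mem_range.1 hi
        have h2 := mul_le_mul_of_nonneg_right h1 hκ.le
        linarith [h'.2]
      rw [h0, zero_add, rampSlope, if_pos ⟨by linarith, by linarith⟩]
      have h2 : (t - J * κ) * LF ≤ (t - J * κ) * |LF| :=
        mul_le_mul_of_nonneg_left (le_abs_self _) (by linarith)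
      have h3 : (t - J * κ) * |LF| ≤ κ * M :=
        mul_le_mul (by linarith) hM (abs_nonneg _) hκ.le
      linarith

lemma D2_add_const (u : Spc m → ℝ) (c : ℝ) (x : Spc m) : D2 (fun y => u y + c) x = D2 u x := by
  have h : fderiv ℝ (fun y => u y + c) = fderiv ℝ u := funext fun y => fderiv_add_const c
  unfold D2
  rw [h]

/-- A parabolic quadratic correction. -/
def quadCorr (B dL t : ℝ) (x : Spc m) : ℝ := B * t * ‖x - 0‖ ^ 2 + B * dL * t ^ 2

lemma quadCorr_contDiffAt (B dL t : ℝ) (x : Spc m) : ContDiffAt ℝ 2 (quadCorr B dL t) x :=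
  (contDiffAt_const.mul (contDiff_normSq 0).contDiffAt).add contDiffAt_const

lemma quadCorr_D2 (B dL t : ℝ) (x : Spc m) :
    D2 (quadCorr B dL t) x = (B * t) • (2 : ℝ) • inB m := by
  have h2 := D2_const_mul (x := x) (contDiff_normSq (m := m) 0).contDiffAt (B * t)
  rw [D2_normSq] at h2
  exact (D2_add_const _ _ x).trans h2

lemma quadCorr_slope {lam Lam B : ℝ} {a : Matrix (Fin (m + 1)) (Fin (m + 1)) ℝ}
    (ha : EllM lam Lam a) (hB : 0 ≤ B) {t : ℝ} (ht : 0 ≤ t) (x : Spc m) :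
    LSlope (fun s => quadCorr B (Lam * (m + 1)) s x) t
      (trA a (D2 (quadCorr B (Lam * (m + 1)) t) x)) := by
  have hd : HasDerivAt (fun s => quadCorr B (Lam * (m + 1)) s x)
      (B * ‖x - 0‖ ^ 2 + B * (Lam * (m + 1)) * (2 * t)) t := by
    have h1 := ((hasDerivAt_id t).const_mul B).mul_const (‖x - 0‖ ^ 2)
    have h2 := (hasDerivAt_pow 2 t).const_mul (B * (Lam * (m + 1)))
    exact (h1.add h2).congr_deriv (by simp)
  refine hd.lslope.mono ?_
  rw [quadCorr_D2, trA_smul, trA_smul]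
  have h1 := mul_le_mul_of_nonneg_left (trA_inB_le ha) (mul_nonneg (mul_nonneg hB ht) zero_le_two)
  have h2 : 0 ≤ B * ‖x - 0‖ ^ 2 := by positivity
  linarith

lemma quadCorr_continuous (B dL : ℝ) :
    Continuous fun q : ℝ × Spc m => quadCorr B dL q.1 q.2 := by
  unfold quadCorr
  fun_prop

namespace Super

variable {lam Lam ρ C κ ε R M B : ℝ} {a : Spc m → Matrix (Fin (m + 1)) (Fin (m + 1)) ℝ}
  {u : ℝ → Spc m → ℝ} {J : ℕ}

lemma stack_sliceHyp (H : Super lam Lam ρ C a u) (hε : 0 < ε) (hκ : 0 < κ) (hε1 : ε < 1)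
    (hJ : J * κ = 1 - ε) (hR : 0 < R) (hRρ : R < ρ) (hM : 0 ≤ M)
    (hB : B * R ^ 2 = C) (hF : ∀ x ∈ ball (0 : Spc m) R, |trA (a x) (D2 (u ε) x)| ≤ M) :
    SliceHyp lam Lam R 0 (1 - ε) (C + κ * M) a
      (fun t x => (∑ i ∈ Finset.range J, ramp κ ε u (t - i * κ) x) + quadCorr B (Lam * (m + 1)) t x)
      (fun _ x => -u ε x + κ * M) := by
  have hB0 : 0 ≤ B := by
    have := H.C_nonneg
    rw [← hB] at this
    exact nonneg_of_mul_nonneg_left this (by positivity)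
  have hsub : closedBall (0 : Spc m) R ⊆ ball 0 ρ := closedBall_subset_ball hRρ
  have hτ : ∀ t ≤ 1 - ε, ∀ i : ℕ, t - i * κ ≤ 1 - ε := fun t ht i => by
    have : 0 ≤ (i : ℝ) * κ := by positivity
    linarith
  have hc2 : ∀ t ≤ 1 - ε, ∀ x ∈ ball (0 : Spc m) ρ, ContDiffAt ℝ 2 (fun x =>
      (∑ i ∈ Finset.range J, ramp κ ε u (t - i * κ) x) + quadCorr B (Lam * (m + 1)) t x) x :=
    fun t ht x hx => (ContDiffAt.sum fun i _ => H.ramp_contDiffAt hε hκ hε1 (hτ t ht i) hx).add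
      (quadCorr_contDiffAt _ _ _ _)
  refine ⟨H.lam_pos, hR, by have := H.C_nonneg; positivity, H.ell, ?_, ?_, ?_, ?_, ?_, ?_⟩
  · exact fun t ht x hx => hc2 t ht.2 x (hsub (ball_subset_closedBall hx))
  · exact fun t ht x hx => (hc2 t ht.2 x (hsub hx)).continuousAt.continuousWithinAt
  · intro t ht x hx
    have hxρ : x ∈ ball (0 : Spc m) ρ := hsub (by simp [hx])
    have h1 : -C * t ≤ ∑ i ∈ Finset.range J, ramp κ ε u (t - i * κ) x := by
      have h2 := Finset.sum_le_sum fun i (_ : i ∈ Finset.range J) =>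
        H.ramp_lower hε hκ hε1 (hτ t ht.2 i) hxρ
      rwa [← Finset.mul_sum, sum_clampK hκ.le ht.1, hJ, min_eq_left ht.2] at h2
    have hL := (H.ell 0).Lam_nonneg H.lam_pos
    have h3 : C * t ≤ quadCorr B (Lam * (m + 1)) t x := by
      rw [quadCorr, sub_zero, hx, ← hB]
      have : 0 ≤ B * (Lam * (m + 1)) * t ^ 2 := by positivity
      linarith
    linarith
  · intro t ht x hx η hη
    have h1 : JRL (fun t x => (∑ i ∈ Finset.range J, ramp κ ε u (t - i * κ) x) +
        quadCorr B (Lam * (m + 1)) t x) t x :=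
      (jrl_sum _ fun i _ => (H.ramp_jrl hε hκ hε1 (hτ t ht.2.le i) (hsub hx)).shift).add
        (jrl_of_continuousAt (quadCorr_continuous _ _).continuousAt)
    exact (h1 η hη).mono fun q hq _ => hq
  · intro t ht x hx
    have hxρ : x ∈ ball (0 : Spc m) ρ := hsub (ball_subset_closedBall hx)
    have h1 := (lslope_sum (Finset.range J) fun i _ =>
      (H.ramp_slope hε hκ hε1 (hτ t ht.2 i) hxρ).shift).add (quadCorr_slope (H.ell x) hB0 ht.1.le x)
    refine h1.mono ?_
    rw [D2_add (ContDiffAt.sum fun i _ => H.ramp_contDiffAt hε hκ hε1 (hτ t ht.2 i) hxρ)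
      (quadCorr_contDiffAt _ _ _ _),
      D2_sum _ fun i _ => H.ramp_contDiffAt hε hκ hε1 (hτ t ht.2 i) hxρ, trA_add, trA_sum,
      Finset.sum_add_distrib]
    have h2 := sum_rampSlope (F := u ε x) hκ (hF x hx) ht.1 (ht.2.trans_eq hJ.symm)
    linarith
  · intro t ht x hx
    have := H.lower ε ⟨hε.le, hε1.le⟩ x (hsub (ball_subset_closedBall hx))
    linarith

end Super

namespace SliceHyp

variable {lam Lam R t0 t1 C r : ℝ} {a : Spc m → Matrix (Fin (m + 1)) (Fin (m + 1)) ℝ}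
  {v S : ℝ → Spc m → ℝ}

lemma avg_le (H : SliceHyp lam Lam R t0 t1 C a v S) {t : ℝ} (ht : t ∈ Icc t0 t1) {x : Spc m}
    (hx : x ∈ closedBall (0 : Spc m) R) :
    avg r R v t ≤ (v t x + R * r) * (volume (closedBall (0 : Spc m) r)).toReal := by
  have hc : IntegrableOn (fun _ : Spc m => v t x + R * r) (closedBall 0 r) :=
    integrableOn_const (isCompact_closedBall (0 : Spc m) r).measure_lt_top.ne
  have h2 := setIntegral_mono_on (H.slice_integrableOn ht) hc measurableSet_closedBall
    fun p hp => by
      have h1 := H.slice_lip (r := r) ht p 0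
      have h2 := H.slice_le (r := r) ht 0 hx
      have h3 := mul_le_mul_of_nonneg_left (mem_closedBall.1 hp) H.R_pos.le
      rw [inner_zero_left] at h2
      linarith
  rwa [setIntegral_const, smul_eq_mul, Measure.real, mul_comm] at h2

lemma le_avg (H : SliceHyp lam Lam R t0 t1 C a v S) (hr : 0 ≤ r) {t c : ℝ} (ht : t ∈ Icc t0 t1)
    (hc : c ≤ 0) (h : ∀ x ∈ closedBall (0 : Spc m) R, c ≤ v t x) :
    (c - 2 * r * R) * (volume (closedBall (0 : Spc m) r)).toReal ≤ avg r R v t := by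
  have hci : IntegrableOn (fun _ : Spc m => c - 2 * r * R) (closedBall 0 r) :=
    integrableOn_const (isCompact_closedBall (0 : Spc m) r).measure_lt_top.ne
  have h2 := setIntegral_mono_on hci (H.slice_integrableOn (r := r) ht) measurableSet_closedBall
    fun p hp => by
      refine H.le_slice ht p (by linarith) fun x hx => ?_
      have h3 : inner ℝ p x ≤ ‖p‖ * ‖x‖ := real_inner_le_norm _ _
      have h4 : ‖p‖ * ‖x‖ ≤ r * R :=
        mul_le_mul (by simpa using hp) (by simpa using hx) (norm_nonneg _) hr
      have h5 : 0 ≤ r * R := mul_nonneg hr H.R_pos.le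
      linarith [h x hx]
  rwa [setIntegral_const, smul_eq_mul, Measure.real, mul_comm] at h2

end SliceHyp

namespace Super

variable {lam Lam ρ C κ ε R M B r e N k : ℝ}
  {a : Spc m → Matrix (Fin (m + 1)) (Fin (m + 1)) ℝ} {u : ℝ → Spc m → ℝ} {J : ℕ}

lemma isOpen_sublevel (H : Super lam Lam ρ C a u) {t : ℝ} (ht : t ∈ Icc (0 : ℝ) 1) (hRρ : R ≤ ρ)
    (c : ℝ) : IsOpen {x ∈ ball (0 : Spc m) R | u t x < c} :=
  ContinuousOn.isOpen_inter_preimage (fun x hx =>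
    (H.c2 t ht x (ball_subset_ball hRρ hx)).continuousAt.continuousWithinAt) isOpen_ball isOpen_Iio

lemma riemann_lower (H : Super lam Lam ρ C a u) (hε : 0 < ε) (hκ : 0 < κ) (hε1 : ε < 1)
    (hJ : J * κ = 1 - ε) (hR : 1 ≤ R) (hRρ : R < ρ) (hM : 0 ≤ M)
    (hB : B * R ^ 2 = C) (hF : ∀ x ∈ ball (0 : Spc m) R, |trA (a x) (D2 (u ε) x)| ≤ M)
    (hr : 0 < r) (he : 0 ≤ e) (hN : 0 ≤ N) (hk : C ≤ lam * k) (hk0 : 0 ≤ k)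
    (hZ : volume {x ∈ ball (0 : Spc m) R | u ε x < -e} ≤ ENNReal.ofReal N) {x : Spc m}
    (hx : ‖x‖ ≤ 1) :
    -(3 * r * R + e + κ * M + C * (k ^ (m + 1) * N) / (volume (closedBall (0 : Spc m) r)).toReal +
      B * (1 + Lam * (m + 1))) ≤ ∑ j ∈ Finset.range J, κ * u (ε + j * κ) x := by
  have HS := H.stack_sliceHyp hε hκ hε1 hJ (by linarith) hRρ hM hB hF
  set v : ℝ → Spc m → ℝ := fun t x =>
    (∑ i ∈ Finset.range J, ramp κ ε u (t - i * κ) x) + quadCorr B (Lam * (m + 1)) t x with hv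
  set P := (volume (closedBall (0 : Spc m) r)).toReal with hP
  have hPpos : 0 < P := ENNReal.toReal_pos (measure_closedBall_pos _ _ hr).ne'
    (isCompact_closedBall (0 : Spc m) r).measure_lt_top.ne
  have hκM0 : 0 ≤ κ * M := by positivity
  have hC := H.C_nonneg
  have hkN : 0 ≤ k ^ (m + 1) * N := by positivity
  have hρ0 : -(e + κ * M) ≤ 0 := by linarith
  set s0 := -(e + κ * M) * P - C * (k ^ (m + 1) * N) with hs0
  have hs0n : s0 ≤ 0 := by
    have h1 := mul_nonneg hC hkN
    have h2 : 0 ≤ (e + κ * M) * P := by positivity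
    linarith
  have hslope : 0 ≤ C - e → ∀ t ∈ Ioc 0 (1 - ε), LSlope (SliceHyp.avg r R v) t s0 := by
    intro hCe t ht
    refine (HS.avg_slope hr ht (ρ := -(e + κ * M)) hk0 hN
      (H.isOpen_sublevel ⟨hε.le, hε1.le⟩ hRρ.le (-e)) (fun y hy => hy.1) hZ (by linarith)
      (by linarith) ?_ fun h => absurd h (not_lt.2 hρ0)).mono ?_
    · intro p _ y hy hyZ _
      have h1 : -e ≤ u ε y := by
        by_contra! h
        exact hyZ ⟨hy, h⟩
      linarith
    · have h1 := mul_nonneg he hkN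
      rw [hs0, ← hP]
      linarith
  have hslope' : ∀ t ∈ Ioc 0 (1 - ε), LSlope (SliceHyp.avg r R v) t s0 := by
    rcases le_or_gt e C with h | h
    · exact hslope (by linarith)
    · intro t ht
      refine (HS.avg_slope hr ht (ρ := -(C + κ * M)) hk0 le_rfl isOpen_empty (empty_subset _)
        (by simp) (by linarith) (by linarith) ?_ fun h => absurd h (not_lt.2 (by linarith))).mono ?_
      · intro p _ y hy _ _
        have h1 := H.lower ε ⟨hε.le, hε1.le⟩ y (ball_subset_ball hRρ.le hy)
        linarith
      · have h1 := mul_nonneg hC hkN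
        have h2 : (e - C) * P ≥ 0 := mul_nonneg (by linarith) hPpos.le
        rw [hs0, ← hP]
        linarith
  have h01 : (0 : ℝ) ≤ 1 - ε := by linarith
  have hmono := le_of_lslope (h := fun t => SliceHyp.avg r R v t + -s0 * t) h01
    (fun t ht => ((hslope' t ht).add (hasDerivAt_linear (-s0) t).lslope).mono (by simp))
    (fun t ht => (HS.avg_rlsc hr ht).add (hasDerivAt_linear (-s0) t).continuousAt.rlsc)
  have hx1 : x ∈ closedBall (0 : Spc m) R := by simpa using hx.trans hR
  have h2 := HS.avg_le (r := r) ⟨h01, le_rfl⟩ hx1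
  have h3 := HS.le_avg (c := 0) hr.le ⟨le_rfl, h01⟩ le_rfl fun y hy => by
    have : ∑ i ∈ Finset.range J, ramp κ ε u (0 - i * κ) y = 0 :=
      Finset.sum_eq_zero fun i _ => by
        have : 0 ≤ (i : ℝ) * κ := by positivity
        rw [ramp, clampK_of_nonpos (by linarith), zero_mul]
    rw [hv]
    simp only [this, quadCorr]
    simp
  rw [← hP] at h2 h3
  have h4 : -(s0 * ε) ≥ 0 := by nlinarith
  have h5 : (-(3 * r * R) + s0 / P) * P ≤ v (1 - ε) x * P := by
    rw [add_mul, div_mul_cancel₀ _ hPpos.ne']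
    linarith
  have h6 := le_of_mul_le_mul_right h5 hPpos
  have h7 : s0 / P = -(e + κ * M) - C * (k ^ (m + 1) * N) / P := by
    rw [hs0]
    field_simp
  rw [h7] at h6
  have h8 : v (1 - ε) x = (∑ j ∈ Finset.range J, κ * u (ε + j * κ) x) +
      quadCorr B (Lam * (m + 1)) (1 - ε) x := by
    rw [hv]
    refine congrArg (· + quadCorr B (Lam * (m + 1)) (1 - ε) x) ?_
    rw [← Finset.sum_range_reflect (fun j : ℕ => κ * u (ε + j * κ) x)]
    refine Finset.sum_congr rfl fun i hi => ?_
    have hi' := Finset.mem_range.1 hi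
    have hc : ((J - 1 - i : ℕ) : ℝ) = J - 1 - i := by
      rw [Nat.cast_sub (by omega), Nat.cast_sub (by omega), Nat.cast_one]
    have hij : (i : ℝ) + 1 ≤ J := by exact_mod_cast hi'
    have h9 := mul_le_mul_of_nonneg_right hij hκ.le
    rw [hc, ramp, ← hJ, clampK_of_ge hκ.le (by linarith), max_eq_left (by linarith)]
    congr 3
    ring
  have hL := (H.ell 0).Lam_nonneg H.lam_pos
  have hB0 : 0 ≤ B := by
    rw [← hB] at hC
    exact nonneg_of_mul_nonneg_left hC (by positivity)
  have h9 : quadCorr B (Lam * (m + 1)) (1 - ε) x ≤ B * (1 + Lam * (m + 1)) := by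
    have h10 : ‖x - 0‖ ^ 2 ≤ 1 := by
      rw [sub_zero]
      exact pow_le_one₀ (norm_nonneg _) hx
    have h11 : (1 - ε) ^ 2 ≤ 1 := pow_le_one₀ h01 (by linarith)
    have h12 : B * (1 - ε) * ‖x - 0‖ ^ 2 ≤ B * 1 * 1 := by gcongr; linarith
    have h13 : B * (Lam * (m + 1)) * (1 - ε) ^ 2 ≤ B * (Lam * (m + 1)) * 1 := by gcongr
    rw [quadCorr]
    linarith
  linarith

end Super

lemma riemann_sum_le {f : ℝ → ℝ} {b c η : ℝ} (hbc : b < c) (hf : ContinuousOn f (Icc b c))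
    (hη : 0 < η) : ∀ᶠ J : ℕ in atTop,
      ∑ j ∈ Finset.range J, (c - b) / J * f (b + j * ((c - b) / J)) ≤ (∫ s in b..c, f s) + η := by
  have hcb : 0 < c - b := sub_pos.2 hbc
  obtain ⟨d, hd, hd'⟩ := Metric.uniformContinuousOn_iff_le.1
    (isCompact_Icc.uniformContinuousOn_of_continuous hf) (η / (c - b)) (by positivity)
  filter_upwards [(tendsto_const_div_atTop_nhds_zero_nat (c - b)).eventually (gt_mem_nhds hd),
    eventually_gt_atTop 0] with J hJ hJ0
  have hJ1 : (0 : ℝ) < J := by exact_mod_cast hJ0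
  set κ := (c - b) / J with hκ
  have hκ0 : 0 < κ := by positivity
  have hJκ : J * κ = c - b := by rw [hκ]; field_simp
  set p : ℕ → ℝ := fun j => b + j * κ with hp
  have hp0 : p 0 = b := by simp [hp]
  have hpJ : p J = c := by simp [hp, hJκ]
  have hps : ∀ j, p (j + 1) = p j + κ := fun j => by simp only [hp]; push_cast; ring
  have hpI : ∀ j < J, Icc (p j) (p (j + 1)) ⊆ Icc b c := by
    intro j hj
    refine Icc_subset_Icc ?_ ?_
    · have : 0 ≤ (j : ℝ) * κ := by positivity
      simp only [hp]; linarith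
    · have h1 : (j : ℝ) + 1 ≤ J := by exact_mod_cast hj
      have h2 := mul_le_mul_of_nonneg_right h1 hκ0.le
      rw [hps]
      simp only [hp]
      linarith
  have hle : ∀ j, p j ≤ p (j + 1) := fun j => by rw [hps]; linarith
  have hint : ∀ j < J, IntervalIntegrable f volume (p j) (p (j + 1)) := fun j hj =>
    (hf.mono (hpI j hj)).intervalIntegrable_of_Icc (hle j)
  have h1 := intervalIntegral.sum_integral_adjacent_intervals hint
  rw [hp0, hpJ] at h1
  rw [← h1]
  have h2 : ∀ j ∈ Finset.range J, κ * f (p j) ≤ (∫ s in p j..p (j + 1), f s) +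
      κ * (η / (c - b)) := by
    intro j hj
    have hj := Finset.mem_range.1 hj
    have h3 := intervalIntegral.integral_mono_on (hle j)
      (intervalIntegrable_const (c := f (p j) - η / (c - b))) (hint j hj) fun s hs => by
        have h4 := hd' (p j) (hpI j hj ⟨le_rfl, hle j⟩) s (hpI j hj hs) (by
          rw [Real.dist_eq, abs_sub_comm, abs_of_nonneg (by linarith [hs.1])]
          have := hs.2
          rw [hps] at this
          linarith)
        have := (abs_le.1 h4).2
        linarith
    rw [intervalIntegral.integral_const, hps, smul_eq_mul] at h3
    rw [hps]
    linarith
  have h3 := Finset.sum_le_sum h2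
  rw [Finset.sum_add_distrib, Finset.sum_const, Finset.card_range, nsmul_eq_mul] at h3
  have h4 : (J : ℝ) * (κ * (η / (c - b))) = η := by
    rw [← mul_assoc, hJκ]; field_simp
  linarith

lemma ContDiffAt.continuousAt_D2 {u : Spc m → ℝ} {x : Spc m} (hu : ContDiffAt ℝ 2 u x) :
    ContinuousAt (D2 u) x :=
  ((hu.fderiv_right (m := 1) (by norm_num)).fderiv_right (m := 0) (by norm_num)).continuousAt

namespace Super

variable {lam Lam ρ C R : ℝ}
  {a : Spc m → Matrix (Fin (m + 1)) (Fin (m + 1)) ℝ} {u : ℝ → Spc m → ℝ}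

lemma exists_bound_L (H : Super lam Lam ρ C a u) (hRρ : R < ρ) {t : ℝ} (ht : t ∈ Icc (0 : ℝ) 1) :
    ∃ M, 0 ≤ M ∧ ∀ x ∈ ball (0 : Spc m) R, |trA (a x) (D2 (u t) x)| ≤ M := by
  obtain ⟨M, hM⟩ := (isCompact_closedBall (0 : Spc m) R).exists_bound_of_continuousOn
    (f := D2 (u t)) fun x hx =>
      (H.c2 t ht x (closedBall_subset_ball hRρ hx)).continuousAt_D2.continuousWithinAt
  have hL : 0 ≤ Lam * (m + 1) :=
    mul_nonneg ((H.ell 0).Lam_nonneg H.lam_pos) (by positivity)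
  refine ⟨|M| * (Lam * (m + 1)), by positivity, fun x hx => ?_⟩
  have hx' := ball_subset_closedBall hx
  refine (trA_le_of_norm H.lam_pos.le (H.ell x)
    (D2_symm (H.c2 t ht x (closedBall_subset_ball hRρ hx')))).trans ?_
  exact mul_le_mul_of_nonneg_right ((hM x hx').trans (le_abs_self _)) hL

lemma tendsto_sublevel (H : Super lam Lam ρ C a u) (hRρ : R ≤ ρ)
    (h0 : ∀ x ∈ ball (0 : Spc m) ρ, 0 ≤ u 0 x) {e : ℝ} (he : 0 < e) :
    Tendsto (fun n : ℕ => volume {x ∈ ball (0 : Spc m) R | u (1 / ((n : ℝ) + 2)) x < -e})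
      atTop (𝓝 0) := by
  have hmem : ∀ n : ℕ, 1 / ((n : ℝ) + 2) ∈ Icc (0 : ℝ) 1 := fun n => by
    have hn : (0 : ℝ) ≤ n := n.cast_nonneg
    exact ⟨by positivity, (div_le_one (by positivity)).2 (by linarith)⟩
  have hlim : Tendsto (fun n : ℕ => 1 / ((n : ℝ) + 2)) atTop (𝓝 0) :=
    tendsto_const_nhds.div_atTop (tendsto_atTop_add_const_right _ _ tendsto_natCast_atTop_atTop)
  have := tendsto_measure_of_tendsto_indicator (μ := volume) atTop
    (As := fun n : ℕ => {x ∈ ball (0 : Spc m) R | u (1 / ((n : ℝ) + 2)) x < -e}) (A := ∅)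
    (B := ball 0 R) (fun n => (H.isOpen_sublevel (hmem n) hRρ _).measurableSet) measurableSet_ball
    measure_ball_lt_top.ne (Eventually.of_forall fun n x hx => hx.1) fun x => by
      by_cases hx : x ∈ ball (0 : Spc m) R
      · have hc := (H.ct x (ball_subset_ball hRρ hx)) 0 (by simp)
        have h1 : Tendsto (fun n : ℕ => u (1 / ((n : ℝ) + 2)) x) atTop (𝓝 (u 0 x)) :=
          hc.tendsto.comp (tendsto_nhdsWithin_iff.2 ⟨hlim, Eventually.of_forall hmem⟩)
        have h2 := h0 x (ball_subset_ball hRρ hx)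
        filter_upwards [h1.eventually (lt_mem_nhds (show -e < u 0 x by linarith))] with n hn
        exact ⟨fun h => absurd h.2 (not_lt.2 hn.le), fun h => h.elim⟩
      · exact Eventually.of_forall fun n => ⟨fun h => hx h.1, fun h => h.elim⟩
  simpa using this

end Super

/-- Time averages of a supersolution with nonnegative initial data are almost nonnegative if the
domain is large. -/
lemma exists_radius_integral_lower {lam Lam C γ : ℝ} (hγ : 0 < γ) : ∃ R₀ ≥ 1, ∀ R ≥ R₀,
    ∀ (a : Spc m → Matrix (Fin (m + 1)) (Fin (m + 1)) ℝ) (u : ℝ → Spc m → ℝ),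
      Super lam Lam (2 * R) C a u → (∀ x ∈ ball (0 : Spc m) (2 * R), 0 ≤ u 0 x) →
        ∀ x : Spc m, ‖x‖ ≤ 1 → -γ ≤ ∫ s in (0 : ℝ)..1, u s x := by
  refine ⟨1 + 4 * |C| * (1 + |Lam| * (m + 1)) / γ, ?_, fun R hR a u H h0 x hx => ?_⟩
  · have : 0 ≤ 4 * |C| * (1 + |Lam| * (m + 1)) / γ := by positivity
    linarith
  have hC := H.C_nonneg
  have hlam := H.lam_pos
  have hL := (H.ell 0).Lam_nonneg hlam
  rw [abs_of_nonneg hC, abs_of_nonneg hL] at hR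
  have hR1 : 1 ≤ R := by
    have : 0 ≤ 4 * C * (1 + Lam * (m + 1)) / γ := by positivity
    linarith
  have hR0 : 0 < R := by linarith
  have hRρ : R < 2 * R := by linarith
  set B := C / R ^ 2 with hB
  have hBR : B * R ^ 2 = C := by rw [hB]; field_simp
  have hBsmall : B * (1 + Lam * (m + 1)) ≤ γ / 4 := by
    have h1 : 4 * C * (1 + Lam * (m + 1)) ≤ R * γ := by
      rw [← div_le_iff₀ hγ]; linarith
    have h2 : B ≤ C / R := by
      rw [hB]
      exact div_le_div_of_nonneg_left hC hR0 (by nlinarith)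
    have h3 : B * (1 + Lam * (m + 1)) ≤ C / R * (1 + Lam * (m + 1)) :=
      mul_le_mul_of_nonneg_right h2 (by positivity)
    have h4 : C / R * (1 + Lam * (m + 1)) ≤ γ / 4 := by
      rw [div_mul_eq_mul_div, div_le_iff₀ hR0]; linarith
    linarith
  set r := γ / (24 * R) with hr
  have hr0 : 0 < r := by positivity
  have hrR : 3 * r * R = γ / 8 := by rw [hr]; field_simp; norm_num
  set P := (volume (closedBall (0 : Spc m) r)).toReal with hP
  have hPpos : 0 < P := ENNReal.toReal_pos (measure_closedBall_pos _ _ hr0).ne'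
    (isCompact_closedBall (0 : Spc m) r).measure_lt_top.ne
  set k := C / lam with hk
  have hk0 : 0 ≤ k := by positivity
  have hk1 : C ≤ lam * k := by rw [hk]; field_simp; exact le_rfl
  set N := P * γ / (8 * (C * k ^ (m + 1) + 1)) with hN
  have hN0 : 0 < N := by positivity
  have hNsmall : C * (k ^ (m + 1) * N) / P ≤ γ / 8 := by
    have h1 : C * (k ^ (m + 1) * N) / P
        = C * k ^ (m + 1) / (C * k ^ (m + 1) + 1) * (γ / 8) := by
      rw [hN]; field_simp
    rw [h1]
    refine mul_le_of_le_one_left (by positivity) ((div_le_one (by positivity)).2 (by linarith))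
  have hlim : Tendsto (fun n : ℕ => C * (1 / ((n : ℝ) + 2))) atTop (𝓝 (C * 0)) :=
    (tendsto_const_nhds.div_atTop
      (tendsto_atTop_add_const_right _ _ tendsto_natCast_atTop_atTop)).const_mul C
  rw [mul_zero] at hlim
  obtain ⟨n, hn1, hn2⟩ := (((H.tendsto_sublevel hRρ.le h0 (e := γ / 8) (by positivity)).eventually
    (gt_mem_nhds (ENNReal.ofReal_pos.2 hN0))).and
      (hlim.eventually (gt_mem_nhds (show 0 < γ / 8 by positivity)))).exists
  set ε := 1 / ((n : ℝ) + 2) with hε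
  have hε0 : 0 < ε := by positivity
  have hε1 : ε < 1 := (div_lt_one (by positivity)).2 (by linarith [n.cast_nonneg (α := ℝ)])
  obtain ⟨M, hM0, hM⟩ := H.exists_bound_L hRρ ⟨hε0.le, hε1.le⟩
  have hx2 : x ∈ ball (0 : Spc m) (2 * R) := by
    rw [mem_ball_zero_iff]; linarith
  have hct := H.ct x hx2
  have hlim2 : Tendsto (fun J : ℕ => (1 - ε) / J * M) atTop (𝓝 (0 * M)) :=
    (tendsto_const_div_atTop_nhds_zero_nat _).mul_const M
  rw [zero_mul] at hlim2
  obtain ⟨J, hJ1, hJ2, hJ3⟩ := ((riemann_sum_le hε1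
    (hct.mono (Icc_subset_Icc_left hε0.le)) (show 0 < γ / 8 by positivity)).and
      ((hlim2.eventually (gt_mem_nhds (show 0 < γ / 8 by positivity))).and
        (eventually_gt_atTop 0))).exists
  have hJ0 : (0 : ℝ) < J := by exact_mod_cast hJ3
  have hmain := H.riemann_lower (κ := (1 - ε) / J) (J := J) (e := γ / 8) (N := N) hε0
    (div_pos (by linarith) hJ0) hε1 (by field_simp) hR1 hRρ hM0 hBR hM hr0 (by positivity)
    hN0.le hk1 hk0 hn1.le hx
  have hint1 : IntervalIntegrable (fun s => u s x) volume 0 ε :=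
    (hct.mono (Icc_subset_Icc_right hε1.le)).intervalIntegrable_of_Icc hε0.le
  have hint2 : IntervalIntegrable (fun s => u s x) volume ε 1 :=
    (hct.mono (Icc_subset_Icc_left hε0.le)).intervalIntegrable_of_Icc hε1.le
  have h3 := intervalIntegral.integral_mono_on hε0.le
    (intervalIntegrable_const (c := -C)) hint1 fun s hs =>
      H.lower s ⟨hs.1, hs.2.trans hε1.le⟩ x hx2
  rw [intervalIntegral.integral_const, smul_eq_mul] at h3
  rw [← intervalIntegral.integral_add_adjacent_intervals hint1 hint2]
  linarith

namespace SliceHyp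

variable {lam Lam R t0 t1 C r : ℝ} {a : Spc m → Matrix (Fin (m + 1)) (Fin (m + 1)) ℝ}
  {v S : ℝ → Spc m → ℝ}

lemma avg_slope' (H : SliceHyp lam Lam R t0 t1 C a v S) (hr : 0 < r) {t : ℝ}
    (ht : t ∈ Ioc t0 t1) :
    LSlope (avg r R v) t (-(C * (volume (closedBall (0 : Spc m) r)).toReal)) := by
  refine (H.avg_slope hr ht (ρ := -C) (k := 0) (N := 0) (Z := ∅) le_rfl le_rfl isOpen_empty
    (empty_subset _) (by simp) le_rfl (by simp) ?_ fun h => absurd h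
      (not_lt.2 (neg_nonpos.2 H.C_nonneg))).mono (by simp)
  intro p _ y hy _ _
  linarith [H.src t ht y hy]

end SliceHyp

namespace Super

variable {lam Lam ρ C : ℝ}
  {a : Spc m → Matrix (Fin (m + 1)) (Fin (m + 1)) ℝ} {u : ℝ → Spc m → ℝ}

lemma bump_contDiffAt (H : Super lam Lam ρ C a u) {t : ℝ} (ht : t ∈ Icc (0 : ℝ) 1) {x : Spc m}
    (hx : x ∈ ball (0 : Spc m) ρ) (c : ℝ) :
    ContDiffAt ℝ 2 (fun y => u t y + C * ‖y - 0‖ ^ 2 + c) x :=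
  ((H.c2 t ht x hx).add (contDiffAt_const.mul (contDiff_normSq 0).contDiffAt)).add
    contDiffAt_const

lemma bump_sliceHyp (H : Super lam Lam ρ C a u) (hρ : 1 < ρ) {σ η : ℝ} (hσ1 : σ < 1)
    (hη : 0 ≤ η) :
    SliceHyp lam Lam 1 (1 - σ) 1 (2 * C * (Lam * (m + 1))) a
      (fun t x => u t x + C * ‖x - 0‖ ^ 2 + η) (fun _ x => 2 * C * trA (a x) (inB m)) := by
  have hL := (H.ell 0).Lam_nonneg H.lam_pos
  have hC := H.C_nonneg
  have hsub : closedBall (0 : Spc m) 1 ⊆ ball 0 ρ := closedBall_subset_ball hρ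
  have hI : ∀ t ∈ Icc (1 - σ) 1, t ∈ Icc (0 : ℝ) 1 := fun t ht => ⟨by linarith [ht.1], ht.2⟩
  refine ⟨H.lam_pos, one_pos, by positivity, H.ell, ?_, ?_, ?_, ?_, ?_, ?_⟩
  · exact fun t ht x hx => H.bump_contDiffAt (hI t ⟨ht.1.le, ht.2⟩)
      (hsub (ball_subset_closedBall hx)) _
  · exact fun t ht x hx =>
      (H.bump_contDiffAt (hI t ht) (hsub hx) _).continuousAt.continuousWithinAt
  · intro t ht x hx
    have h1 := H.lower t (hI t ht) x (hsub (by simp [hx]))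
    rw [sub_zero, hx]
    linarith
  · intro t ht x hx e he
    have hc : Continuous fun q : ℝ × Spc m => C * ‖q.2 - 0‖ ^ 2 := by fun_prop
    have h1 := (H.rl t ⟨by linarith [ht.1], ht.2⟩ x (hsub hx)).add
      (jrl_of_continuousAt (v := fun _ y => C * ‖y - 0‖ ^ 2) hc.continuousAt)
    filter_upwards [h1 e he] with q hq _
    linarith
  · intro t ht x hx
    have hx' := hsub (ball_subset_closedBall hx)
    have ht' := hI t ⟨ht.1.le, ht.2⟩
    have hq : ContDiffAt ℝ 2 (fun y : Spc m => C * ‖y - 0‖ ^ 2) x :=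
      contDiffAt_const.mul (contDiff_normSq 0).contDiffAt
    have hD : D2 (fun y => u t y + C * ‖y - 0‖ ^ 2 + η) x
        = D2 (u t) x + C • (2 : ℝ) • inB m := by
      rw [D2_add_const, D2_add (H.c2 t ht' x hx') hq,
        D2_const_mul (contDiff_normSq (m := m) 0).contDiffAt, D2_normSq]
    rw [hD, trA_add, trA_smul, trA_smul]
    have h1 := (H.ls t ⟨by linarith [ht.1], ht.2⟩ x hx').add
      (hasDerivAt_const t (C * ‖x - 0‖ ^ 2 + η)).lslope
    refine (h1.mono (by linarith)).congr (by ring) (Eventually.of_forall fun s => by ring)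
  · intro t ht x hx
    have h1 := mul_le_mul_of_nonneg_left (trA_inB_le (H.ell x)) hC
    linarith

end Super

/-- If the sublevel sets of a supersolution are small at most times, then the supersolution is
almost nonnegative. -/
lemma exists_growth_of_times {lam Lam C η : ℝ} (hlam : 0 < lam) (hC : 0 ≤ C) (hη : 0 < η) :
    ∃ N > 0, ∃ β > 0, ∀ (a : Spc m → Matrix (Fin (m + 1)) (Fin (m + 1)) ℝ) (u : ℝ → Spc m → ℝ)
      (ρ : ℝ), Super lam Lam ρ C a u → 1 < ρ → ∀ Bad : Set ℝ, volume Bad ≤ ENNReal.ofReal β →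
        (∀ t ∈ Ioc (0 : ℝ) 1, t ∉ Bad →
          volume {x ∈ ball (0 : Spc m) 1 | u t x < -η} ≤ ENNReal.ofReal N) → -(2 * η) ≤ u 1 0 := by
  set C' := 2 * C * (|Lam| * (m + 1)) with hC'
  have hC'0 : 0 ≤ C' := by positivity
  set σ := min (η / (2 * C' + 1)) (1 / 2) with hσ
  have hσ0 : 0 < σ := lt_min (by positivity) (by norm_num)
  have hσ1 : σ < 1 := (min_le_right _ _).trans_lt (by norm_num)
  have hσC : C' * σ ≤ η / 2 := by
    have h1 : σ * (2 * C' + 1) ≤ η := by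
      rw [← le_div_iff₀ (by positivity)]; exact min_le_left _ _
    linarith
  set r := η / 5 with hr
  have hr0 : 0 < r := by positivity
  set P := (volume (closedBall (0 : Spc m) r)).toReal with hP
  have hPpos : 0 < P := ENNReal.toReal_pos (measure_closedBall_pos _ _ hr0).ne'
    (isCompact_closedBall (0 : Spc m) r).measure_lt_top.ne
  set k := 4 * (C' * σ + C + 2 * r + 1) / (lam * σ) with hk
  have hk0 : 0 < k := by positivity
  have hkl : lam * k * σ = 4 * (C' * σ + C + 2 * r + 1) := by rw [hk]; field_simp
  refine ⟨P / (2 * k ^ (m + 1)), by positivity, σ / 2, by positivity, ?_⟩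
  intro a u ρ H hρ Bad hBad hgood
  set N := P / (2 * k ^ (m + 1)) with hN
  have hN0 : 0 < N := by positivity
  have hkN : k ^ (m + 1) * N = P / 2 := by rw [hN]; field_simp
  by_contra! hneg
  have HS := H.bump_sliceHyp hρ hσ1 hη.le
  rw [← abs_of_nonneg ((H.ell 0).Lam_nonneg hlam), ← hC', abs_of_nonneg
    ((H.ell 0).Lam_nonneg hlam)] at HS
  set v : ℝ → Spc m → ℝ := fun t x => u t x + C * ‖x - 0‖ ^ 2 + η with hv
  have h0 : (0 : Spc m) ∈ closedBall (0 : Spc m) 1 := by simp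
  have hv1 : v 1 0 < -η := by
    simp only [hv]
    simp
    linarith
  have hI : (1 : ℝ) ∈ Icc (1 - σ) 1 := ⟨by linarith, le_rfl⟩
  have hslice : ∀ t ∈ Ioc (1 - σ) 1, ∀ p : Spc m, ‖p‖ ≤ r → slice r 1 v t p < -η / 2 := by
    intro t ht p hp
    have h1 := HS.slice_mono hr0 hp ht.1.le ht.2 le_rfl
    have h2 := HS.slice_le (r := r) hI p h0
    rw [inner_zero_right] at h2
    have h3 := mul_le_mul_of_nonneg_left (show 1 - t ≤ σ by linarith [ht.1]) hC'0
    linarith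
  have hmain := growth_of_lslope (h := SliceHyp.avg r 1 v) (a := 1 - σ) (b := 1) (C := C' * P)
    (K := (lam * k / 2 - C') * P) (β := σ / 2) (Bad := Bad) (by linarith)
    (by have : 0 ≤ lam * k / 2 * P := by positivity
        linarith) (by positivity) hBad (fun t ht => HS.avg_slope' hr0 ht) ?_
    (fun t ht => HS.avg_rlsc hr0 ht)
  · have h1 := HS.avg_le (r := r) hI h0
    have h2 := HS.le_avg (r := r) (t := 1 - σ) (c := -C) hr0.le ⟨le_rfl, by linarith⟩
      (by linarith) fun x hx => by
        have h3 := H.lower (1 - σ) ⟨by linarith, by linarith⟩ x (closedBall_subset_ball hρ hx)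
        have h4 : 0 ≤ C * ‖x - 0‖ ^ 2 := by positivity
        simp only [hv]
        linarith
    rw [← hP] at h1 h2
    have h3 : (v 1 0 + 1 * r) * P ≤ 0 := mul_nonpos_of_nonpos_of_nonneg (by linarith) hPpos.le
    have h4 : (lam * k * σ / 4 - C' * σ - C - 2 * r) * P ≤ 0 := by linarith
    rw [hkl] at h4
    have h5 := nonpos_of_mul_nonpos_left h4 hPpos
    linarith
  · intro t ht htB
    have ht' : t ∈ Icc (0 : ℝ) 1 := ⟨by linarith [ht.1], ht.2⟩
    refine (HS.avg_slope hr0 ht (ρ := lam * k - C') (k := k) hk0.le hN0.le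
      (H.isOpen_sublevel ht' hρ.le (-η)) (fun y hy => hy.1)
      (hgood t ⟨by linarith [ht.1], ht.2⟩ htB) (by have := mul_pos hlam hk0; linarith) le_rfl ?_
      ?_).mono ?_
    · intro p hp x hx hxZ hxe
      refine absurd ⟨hx, ?_⟩ hxZ
      have h1 := hslice t ht p hp
      have h2 : inner ℝ p x ≤ ‖p‖ * ‖x‖ := real_inner_le_norm _ _
      have h3 : ‖p‖ * ‖x‖ ≤ r * 1 :=
        mul_le_mul hp (mem_ball_zero_iff.1 hx).le (norm_nonneg _) hr0.le
      have h4 : 0 ≤ C * ‖x - 0‖ ^ 2 := by positivity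
      simp only [hv] at hxe
      linarith
    · intro _ p hp h
      have := hslice t ht p hp
      linarith
    · rw [hkN, ← hP]
      linarith

lemma Super.measurableSet_sublevel {lam Lam ρ C : ℝ}
    {a : Spc m → Matrix (Fin (m + 1)) (Fin (m + 1)) ℝ} {u : ℝ → Spc m → ℝ}
    (H : Super lam Lam ρ C a u) (hρ : 1 < ρ) (c : ℝ) :
    MeasurableSet {q : ℝ × Spc m | q.1 ∈ Ioc (0 : ℝ) 1 ∧ q.2 ∈ ball (0 : Spc m) 1 ∧
      u q.1 q.2 < c} := by
  let F : ℝ → Spc m → ℝ := fun t x =>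
    (ball (0 : Spc m) 1).indicator (u (projIcc (0 : ℝ) 1 zero_le_one t)) x
  have hsub : ball (0 : Spc m) 1 ⊆ ball 0 ρ := ball_subset_ball hρ.le
  have hF : Measurable (Function.uncurry F) := by
    refine measurable_uncurry_of_continuous_of_measurable ?_ ?_
    · intro x
      by_cases hx : x ∈ ball (0 : Spc m) 1
      · simp only [F, indicator_of_mem hx]
        have h1 := (H.ct x (hsub hx)).domRestrict
        exact h1.comp (continuous_projIcc (h := zero_le_one))
      · simp only [F, indicator_of_notMem hx]
        exact continuous_const
    · intro t
      have hc : ContinuousOn (u (projIcc (0 : ℝ) 1 zero_le_one t)) (ball (0 : Spc m) 1) :=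
        fun x hx => (H.c2 _ (projIcc (0 : ℝ) 1 zero_le_one t).2 x
          (hsub hx)).continuousAt.continuousWithinAt
      have := hc.measurable_piecewise (continuousOn_const (c := (0 : ℝ))) measurableSet_ball
      have e : F t = (ball (0 : Spc m) 1).piecewise
          (u (projIcc (0 : ℝ) 1 zero_le_one t)) (fun _ => 0) := by
        ext x
        by_cases hx : x ∈ ball (0 : Spc m) 1
        · simp only [F, indicator_of_mem hx, piecewise_eq_of_mem _ _ _ hx]
        · simp only [F, indicator_of_notMem hx, piecewise_eq_of_notMem _ _ _ hx]
      rwa [e]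
  have : {q : ℝ × Spc m | q.1 ∈ Ioc (0 : ℝ) 1 ∧ q.2 ∈ ball (0 : Spc m) 1 ∧ u q.1 q.2 < c} =
      (Ioc (0 : ℝ) 1 ×ˢ ball (0 : Spc m) 1) ∩ (Function.uncurry F) ⁻¹' (Iio c) := by
    ext ⟨t, x⟩
    constructor
    · rintro ⟨h1, h2, h3⟩
      refine ⟨⟨h1, h2⟩, ?_⟩
      simpa only [mem_preimage, Function.uncurry, F, indicator_of_mem h2,
        projIcc_of_mem zero_le_one (Ioc_subset_Icc_self h1), mem_Iio] using h3
    · rintro ⟨⟨h1, h2⟩, h3⟩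
      refine ⟨h1, h2, ?_⟩
      simpa only [mem_preimage, Function.uncurry, F, indicator_of_mem h2,
        projIcc_of_mem zero_le_one (Ioc_subset_Icc_self h1), mem_Iio] using h3
  rw [this]
  exact (measurableSet_Ioc.prod measurableSet_ball).inter (hF measurableSet_Iio)

/-- Growth estimate in terms of the time spent below the level `-η` at each point. -/
theorem exists_growth_of_fibers {lam Lam C η : ℝ} (hlam : 0 < lam) (hC : 0 ≤ C) (hη : 0 < η) :
    ∃ b > 0, ∀ (a : Spc m → Matrix (Fin (m + 1)) (Fin (m + 1)) ℝ) (u : ℝ → Spc m → ℝ) (ρ : ℝ),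
      Super lam Lam ρ C a u → 1 < ρ →
      (∀ x ∈ ball (0 : Spc m) 1, volume {t ∈ Ioc (0 : ℝ) 1 | u t x < -η} ≤ ENNReal.ofReal b) →
      -(2 * η) ≤ u 1 0 := by
  obtain ⟨N, hN, β, hβ, h⟩ := exists_growth_of_times (m := m) (Lam := Lam) hlam hC hη
  have hV0 : volume (ball (0 : Spc m) 1) ≠ 0 := (measure_ball_pos _ _ one_pos).ne'
  have hV1 : volume (ball (0 : Spc m) 1) ≠ ⊤ := measure_ball_lt_top.ne
  have hV : 0 < (volume (ball (0 : Spc m) 1)).toReal := ENNReal.toReal_pos hV0 hV1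
  refine ⟨N * β / (volume (ball (0 : Spc m) 1)).toReal, by positivity, fun a u ρ H hρ hx => ?_⟩
  set E : Set (ℝ × Spc m) := {q | q.1 ∈ Ioc (0 : ℝ) 1 ∧ q.2 ∈ ball (0 : Spc m) 1 ∧ u q.1 q.2 < -η}
    with hE
  have hEm : MeasurableSet E := H.measurableSet_sublevel hρ (-η)
  have h1 : ∫⁻ t : ℝ, volume (Prod.mk t ⁻¹' E) ≤ ENNReal.ofReal (N * β) := by
    rw [← Measure.prod_apply hEm, Measure.prod_apply_symm hEm]
    calc ∫⁻ x : Spc m, volume ((fun t : ℝ => (t, x)) ⁻¹' E)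
        ≤ ∫⁻ x : Spc m, (ball (0 : Spc m) 1).indicator
            (fun _ => ENNReal.ofReal (N * β / (volume (ball (0 : Spc m) 1)).toReal)) x := by
          refine lintegral_mono fun x => ?_
          by_cases hxb : x ∈ ball (0 : Spc m) 1
          · rw [indicator_of_mem hxb]
            refine le_trans (measure_mono ?_) (hx x hxb)
            rintro t ⟨h1, -, h3⟩
            exact ⟨h1, h3⟩
          · rw [indicator_of_notMem hxb]
            have : (fun t : ℝ => (t, x)) ⁻¹' E = ∅ := by
              ext t
              simp only [mem_preimage, mem_empty_iff_false, iff_false]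
              exact fun h => hxb h.2.1
            rw [this, measure_empty]
      _ = ENNReal.ofReal (N * β) := by
          rw [lintegral_indicator_const measurableSet_ball, ENNReal.ofReal_div_of_pos hV,
            ENNReal.ofReal_toReal hV1, ENNReal.div_mul_cancel hV0 hV1]
  have hN0 : ENNReal.ofReal N ≠ 0 := by simpa using hN
  have h2 : volume {t : ℝ | ENNReal.ofReal N ≤ volume (Prod.mk t ⁻¹' E)} ≤ ENNReal.ofReal β := by
    have h3 := (mul_meas_ge_le_lintegral (μ := (volume : Measure ℝ))
      (measurable_measure_prodMk_left (ν := (volume : Measure (Spc m))) hEm)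
      (ENNReal.ofReal N)).trans h1
    rw [ENNReal.ofReal_mul hN.le] at h3
    exact (ENNReal.mul_le_mul_iff_right hN0 ENNReal.ofReal_ne_top).1 h3
  refine h a u ρ H hρ _ h2 fun t ht hbad => ?_
  have h4 : volume (Prod.mk t ⁻¹' E) < ENNReal.ofReal N := not_le.1 hbad
  refine le_trans (measure_mono ?_) h4.le
  rintro x ⟨hx1, hx2⟩
  exact ⟨ht, hx1, hx2⟩

/-- The concave increasing function `s ↦ (1 - e^{-ks})/k`. -/
def expTrunc (k s : ℝ) : ℝ := (1 - Real.exp (-(k * s))) / k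

lemma hasDerivAt_exp_neg_mul (k s : ℝ) :
    HasDerivAt (fun s => Real.exp (-(k * s))) (-k * Real.exp (-(k * s))) s := by
  have h : HasDerivAt (fun s : ℝ => -(k * s)) (-k) s := by
    simpa [neg_mul] using (hasDerivAt_id s).const_mul (-k)
  simpa [mul_comm] using h.exp

lemma hasDerivAt_expTrunc {k : ℝ} (hk : 0 < k) (s : ℝ) :
    HasDerivAt (expTrunc k) (Real.exp (-(k * s))) s := by
  have := ((hasDerivAt_exp_neg_mul k s).const_sub 1).div_const k
  refine this.congr_deriv ?_
  field_simp

lemma contDiff_expTrunc (k : ℝ) : ContDiff ℝ 2 (expTrunc k) := by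
  unfold expTrunc
  fun_prop

lemma monotone_expTrunc {k : ℝ} (hk : 0 < k) : Monotone (expTrunc k) := by
  intro s t hst
  have : Real.exp (-(k * t)) ≤ Real.exp (-(k * s)) := Real.exp_le_exp.2 (by nlinarith)
  unfold expTrunc
  gcongr

lemma expTrunc_le {k : ℝ} (hk : 0 < k) (s : ℝ) : expTrunc k s ≤ 1 / k := by
  have := Real.exp_pos (-(k * s))
  unfold expTrunc
  gcongr
  linarith

lemma expTrunc_le_self {k : ℝ} (hk : 0 < k) (s : ℝ) : expTrunc k s ≤ s := by
  have := Real.add_one_le_exp (-(k * s))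
  rw [expTrunc, div_le_iff₀ hk]
  linarith

lemma expTrunc_nonneg {k s : ℝ} (hk : 0 < k) (hs : 0 ≤ s) : 0 ≤ expTrunc k s := by
  have := monotone_expTrunc hk hs
  simpa [expTrunc] using this

namespace Super

variable {lam Lam ρ C : ℝ} {a : Spc m → Matrix (Fin (m + 1)) (Fin (m + 1)) ℝ}
  {u : ℝ → Spc m → ℝ}

lemma comp_expTrunc (H : Super lam Lam ρ C a u)
    (hd : ∀ t ∈ Ioc (0 : ℝ) 1, ∀ x ∈ ball (0 : Spc m) ρ,
      HasDerivAt (fun s => u s x) (trA (a x) (D2 (u t) x)) t) {k : ℝ} (hk : 0 < k) :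
    Super lam Lam ρ (-expTrunc k (-C)) a (fun t x => expTrunc k (u t x)) where
  lam_pos := H.lam_pos
  ell := H.ell
  C_nonneg := by
    have := expTrunc_le_self hk (-C)
    linarith [H.C_nonneg]
  c2 t ht x hx := (contDiff_expTrunc k).contDiffAt.comp x (H.c2 t ht x hx)
  ct x hx := (contDiff_expTrunc k).continuous.comp_continuousOn (H.ct x hx)
  ls t ht x hx := by
    have h1 : HasDerivAt (fun s => expTrunc k (u s x))
        (Real.exp (-(k * u t x)) * trA (a x) (D2 (u t) x)) t :=
      HasDerivAt.comp (h₂ := expTrunc k) t (hasDerivAt_expTrunc hk (u t x)) (hd t ht x hx)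
    refine h1.lslope.mono ?_
    rw [D2_comp_real (H.c2 t (Ioc_subset_Icc_self ht) x hx) (hasDerivAt_expTrunc hk)
      (hasDerivAt_exp_neg_mul k _), trA_add, trA_smul, trA_smul]
    have h2 := trA_smulRight_nonneg H.lam_pos.le (H.ell x) (fderiv ℝ (u t) x)
    have h3 := mul_nonneg (mul_nonneg hk.le (Real.exp_pos (-(k * u t x))).le) h2
    linarith
  rl t ht x hx := by
    intro η hη
    have h1 : ∀ᶠ s in 𝓝 (u t x), expTrunc k (u t x) - η < expTrunc k s :=
      (contDiff_expTrunc k).continuous.continuousAt.eventually (lt_mem_nhds (sub_lt_self _ hη))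
    obtain ⟨l, hl, hl'⟩ := exists_Ioc_subset_of_mem_nhds h1 ⟨u t x - 1, by linarith⟩
    filter_upwards [H.rl t ht x hx (u t x - l) (by linarith)] with q hq
    rcases le_total (u q.1 q.2) (u t x) with h | h
    · exact hl' ⟨by linarith, h⟩
    · have := monotone_expTrunc hk h
      linarith
  lower t ht x hx := by
    rw [neg_neg]
    exact monotone_expTrunc hk (H.lower t ht x hx)

end Super

theorem exists_radius_lower {lam Lam C η : ℝ} (hlam : 0 < lam) (hC : 0 ≤ C) (hη : 0 < η) :
    ∃ R ≥ 1, ∀ (a : Spc m → Matrix (Fin (m + 1)) (Fin (m + 1)) ℝ) (u : ℝ → Spc m → ℝ),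
      Super lam Lam (2 * R) C a u →
      (∀ t ∈ Ioc (0 : ℝ) 1, ∀ x ∈ ball (0 : Spc m) (2 * R),
        HasDerivAt (fun s => u s x) (trA (a x) (D2 (u t) x)) t) →
      (∀ x ∈ ball (0 : Spc m) (2 * R), 0 ≤ u 0 x) → -(2 * η) ≤ u 1 0 := by
  obtain ⟨b, hb, h⟩ := exists_growth_of_fibers (m := m) (Lam := Lam) hlam hC hη
  set k := 2 / (b * η) with hk'
  have hk : 0 < k := by positivity
  obtain ⟨R, hR1, hR⟩ := exists_radius_integral_lower (m := m) (lam := lam) (Lam := Lam)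
    (C := -expTrunc k (-C)) (γ := b * η / 2) (by positivity)
  refine ⟨R, hR1, fun a u H hd h0 => h a u (2 * R) H (by linarith) fun x hx => ?_⟩
  have hx1 : ‖x‖ ≤ 1 := (mem_ball_zero_iff.1 hx).le
  have hx2 : x ∈ ball (0 : Spc m) (2 * R) := ball_subset_ball (by linarith) hx
  have h1 := hR R le_rfl a _ (H.comp_expTrunc hd hk) (fun y hy => expTrunc_nonneg hk (h0 y hy)) x hx1
  have hint : IntervalIntegrable (fun s => expTrunc k (u s x)) volume 0 1 := by
    refine ContinuousOn.intervalIntegrable ?_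
    rw [uIcc_of_le zero_le_one]
    exact (contDiff_expTrunc k).continuous.comp_continuousOn (H.ct x hx2)
  have hint2 : IntervalIntegrable (fun s => 1 / k - expTrunc k (u s x)) volume 0 1 :=
    intervalIntegrable_const.sub hint
  have h2 : ∫ s in (0 : ℝ)..1, (1 / k - expTrunc k (u s x)) ≤ b * η := by
    rw [intervalIntegral.integral_sub intervalIntegrable_const hint]
    have : 1 / k = b * η / 2 := by rw [hk', one_div_div]
    rw [intervalIntegral.integral_const, this, smul_eq_mul]
    linarith
  rw [intervalIntegral.integral_of_le zero_le_one] at h2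
  have h3 := mul_meas_ge_le_integral_of_nonneg (μ := volume.restrict (Ioc (0 : ℝ) 1))
    (f := fun s => 1 / k - expTrunc k (u s x))
    (Eventually.of_forall fun s => sub_nonneg.2 (expTrunc_le hk _))
    ((intervalIntegrable_iff_integrableOn_Ioc_of_le zero_le_one).1 hint2) η
  have h4 : (volume.restrict (Ioc (0 : ℝ) 1)).real {s | η ≤ 1 / k - expTrunc k (u s x)} ≤ b := by
    have := h3.trans h2
    rw [mul_comm b η] at this
    exact le_of_mul_le_mul_left this hη
  have h5 := ENNReal.ofReal_le_ofReal h4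
  rw [Measure.real, ENNReal.ofReal_toReal (measure_ne_top _ _),
    Measure.restrict_apply' measurableSet_Ioc] at h5
  refine le_trans (measure_mono ?_) h5
  rintro t ⟨ht, hut⟩
  refine ⟨?_, ht⟩
  have := expTrunc_le_self hk (u t x)
  have : 0 < 1 / k := by positivity
  simp only [mem_ofPred_eq]
  linarith

/-- Joint lower semicontinuity of `w` at `z` from the future. -/
def FutureLsc (w : Spc m × ℝ → ℝ) (z : Spc m × ℝ) : Prop :=
  ∀ η > 0, ∀ᶠ q in 𝓝 z, z.2 ≤ q.2 → w z - η < w q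

theorem exists_radius_lower_box {lam Lam C η : ℝ} (hlam : 0 < lam) (hC : 0 ≤ C) (hη : 0 < η) :
    ∃ R ≥ 1, ∀ (A : Spc m → Matrix (Fin (m + 1)) (Fin (m + 1)) ℝ) (w : Spc m × ℝ → ℝ)
      (y : Spc m) (r a s k : ℝ), IsElliptic lam Lam A → a < s → (s - a) * (2 * R) ^ 2 ≤ r ^ 2 →
      0 < r → SolvesL A w (ball y r ×ˢ Icc a s) →
      (∀ z ∈ ball y r ×ˢ Ioo a s, FutureLsc w z) →
      (∀ z ∈ ball y r ×ˢ Icc a s, k - C ≤ w z) → (∀ x ∈ ball y r, k ≤ w (x, a)) →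
      k - 2 * η ≤ w (y, s) := by
  obtain ⟨R, hR1, hR⟩ := exists_radius_lower (m := m) (Lam := Lam) hlam hC hη
  refine ⟨R, hR1, fun A w y r a s k hA has hsr hr hw hrl hlow h0 => ?_⟩
  set τ := s - a with hτ'
  have hτ : 0 < τ := sub_pos.2 has
  set σ := √τ with hσ'
  have hσ : 0 < σ := Real.sqrt_pos.2 hτ
  have hσ2 : σ ^ 2 = τ := Real.sq_sqrt hτ.le
  have hσR : σ * (2 * R) ≤ r := by
    refine le_of_sq_le_sq ?_ hr.le
    rwa [mul_pow, hσ2]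
  have hmem : ∀ x ∈ ball (0 : Spc m) (2 * R), y + σ • x ∈ ball y r := by
    intro x hx
    rw [mem_ball_zero_iff] at hx
    rw [mem_ball, dist_eq_norm, add_sub_cancel_left, norm_smul, Real.norm_of_nonneg hσ.le]
    exact (mul_lt_mul_of_pos_left hx hσ).trans_le hσR
  have htime : ∀ t ∈ Icc (0 : ℝ) 1, a + τ * t ∈ Icc a s := by
    rintro t ⟨h1, h2⟩
    constructor <;> nlinarith
  have hsp : ∀ t ∈ Icc (0 : ℝ) 1, ∀ x ∈ ball (0 : Spc m) (2 * R),
      ContDiffAt ℝ 2 (fun y => w (y, a + τ * t)) (y + σ • x) := fun t ht x hx =>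
    (hw (y + σ • x, a + τ * t) ⟨hmem x hx, htime t ht⟩).1
  set u : ℝ → Spc m → ℝ := fun t x => w (y + σ • x, a + τ * t) + -k with hu
  have hc2 : ∀ t ∈ Icc (0 : ℝ) 1, ∀ x ∈ ball (0 : Spc m) (2 * R), ContDiffAt ℝ 2 (u t) x := by
    intro t ht x hx
    refine ContDiffAt.add ?_ contDiffAt_const
    exact ContDiffAt.comp (g := fun y => w (y, a + τ * t)) x (hsp t ht x hx) (by fun_prop)
  have hd : ∀ t ∈ Icc (0 : ℝ) 1, ∀ x ∈ ball (0 : Spc m) (2 * R),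
      HasDerivAt (fun s => u s x) (trA (A (y + σ • x)) (D2 (u t) x)) t := by
    intro t ht x hx
    have h1 := (hw (y + σ • x, a + τ * t) ⟨hmem x hx, htime t ht⟩).2
    rw [Lop_eq A w _ _ (hsp t ht x hx)] at h1
    have h2 : HasDerivAt (fun t => a + τ * t) τ t := by
      simpa using ((hasDerivAt_id t).const_mul τ).const_add a
    have h3 := (HasDerivAt.comp (h₂ := fun s => w (y + σ • x, s)) t h1 h2).add_const (-k)
    refine h3.congr_deriv ?_
    have h4 : D2 (u t) x = σ ^ 2 • D2 (fun y => w (y, a + τ * t)) (y + σ • x) := by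
      rw [← D2_comp_affine y σ (hsp t ht x hx)]
      exact D2_add_const _ _ _
    rw [h4, trA_smul, hσ2, mul_comm]
  have H : Super lam Lam (2 * R) C (fun x => A (y + σ • x)) u :=
    { lam_pos := hlam
      ell := fun x => hA.ellM _
      C_nonneg := hC
      c2 := hc2
      ct := fun x hx t ht => (hd t ht x hx).continuousAt.continuousWithinAt
      ls := fun t ht x hx => (hd t (Ioc_subset_Icc_self ht) x hx).lslope
      rl := by
        intro t ht x hx η hη
        have h1 := hrl (y + σ • x, a + τ * t) ⟨hmem x hx, by nlinarith [ht.1], by nlinarith [ht.2]⟩ η hη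
        have h2 : Tendsto (fun q : ℝ × Spc m => (y + σ • q.2, a + τ * q.1)) (𝓝[>] t ×ˢ 𝓝 x)
            (𝓝 (y + σ • x, a + τ * t)) := by
          have h3 : Continuous (fun q : ℝ × Spc m => (y + σ • q.2, a + τ * q.1)) := by fun_prop
          have h4 := h3.tendsto (t, x)
          rw [nhds_prod_eq] at h4
          exact h4.mono_left (Filter.prod_mono nhdsWithin_le_nhds le_rfl)
        filter_upwards [h2.eventually h1,
          tendsto_fst.eventually (self_mem_nhdsWithin : Ioi t ∈ 𝓝[>] t)] with q h5 h6
        have h7 : t < q.1 := h6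
        have := h5 (by nlinarith)
        simp only [hu]
        linarith
      lower := fun t ht x hx => by
        have := hlow (y + σ • x, a + τ * t) ⟨hmem x hx, htime t ht⟩
        simp only [hu]
        linarith }
  have h1 := hR _ _ H (fun t ht x hx => hd t (Ioc_subset_Icc_self ht) x hx) fun x hx => by
    have := h0 _ (hmem x hx)
    simp only [hu, mul_zero, add_zero]
    linarith
  have h2 : a + τ * 1 = s := by rw [hτ']; ring
  simp only [hu, smul_zero, add_zero, h2] at h1
  linarith

lemma futureLsc_of_lipschitz {lam Lam C r₀ t₁ : ℝ} {x₁ : Spc m} {N : ℕ}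
    {A : Spc m → Matrix (Fin (m + 1)) (Fin (m + 1)) ℝ} {w : Spc m × ℝ → ℝ}
    {U : Set (Spc m × ℝ)} (hlam : 0 < lam) (hA : IsElliptic lam Lam A) (hU : IsOpen U)
    (hFU : ∀ z ∈ U, FutureLsc w z) (hC : 0 ≤ C)
    (hw : SolvesL A w (closedBall x₁ r₀ ×ˢ Icc (t₁ - r₀) (t₁ + r₀)))
    (hlow : ∀ z ∈ closedBall x₁ r₀ ×ˢ Icc (t₁ - r₀) (t₁ + r₀), -C ≤ w z)
    (hLip : ∀ t ∈ Icc (t₁ - r₀) (t₁ + r₀), (∃ x ∈ closedBall x₁ r₀, (x, t) ∉ U) →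
      ∀ x ∈ closedBall x₁ r₀, ∀ y ∈ closedBall x₁ r₀, |w (x, t) - w (y, t)| ≤ N * ‖x - y‖) :
    ∀ z ∈ ball x₁ r₀ ×ˢ Ioo (t₁ - r₀) (t₁ + r₀), FutureLsc w z := by
  rintro ⟨x, t⟩ ⟨hx, ht⟩
  simp only at hx ht
  by_cases hzU : (x, t) ∈ U
  · exact hFU _ hzU
  have htI := Ioo_subset_Icc_self ht
  have hxB := ball_subset_closedBall hx
  set T : Set ℝ := Prod.snd '' ((closedBall x₁ r₀ ×ˢ Icc (t₁ - r₀) (t₁ + r₀)) \ U) with hT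
  have hTc : IsCompact T :=
    (((isCompact_closedBall x₁ r₀).prod isCompact_Icc).diff hU).image continuous_snd
  have hTmem : ∀ s, s ∈ T ↔ s ∈ Icc (t₁ - r₀) (t₁ + r₀) ∧ ∃ x ∈ closedBall x₁ r₀, (x, s) ∉ U := by
    intro s
    constructor
    · rintro ⟨⟨y, s'⟩, ⟨⟨h1, h2⟩, h3⟩, rfl⟩
      exact ⟨h2, y, h1, h3⟩
    · rintro ⟨h2, y, h1, h3⟩
      exact ⟨(y, s), ⟨⟨h1, h2⟩, h3⟩, rfl⟩
  have htT : t ∈ T := (hTmem t).2 ⟨htI, x, hxB, hzU⟩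
  intro η hη
  obtain ⟨R, hR1, hR⟩ := exists_radius_lower_box (m := m) (lam := lam) (Lam := Lam)
    (C := C + |w (x, t)|) (η := η / 8) hlam (by positivity) (by positivity)
  set r := min ((r₀ - dist x x₁) / 2) (η / (8 * (N + 1))) with hr'
  have hdx : dist x x₁ < r₀ := hx
  have hr : 0 < r := lt_min (by linarith) (by positivity)
  have hr1 : dist x x₁ + 2 * r ≤ r₀ := by
    have := min_le_left ((r₀ - dist x x₁) / 2) (η / (8 * (N + 1)))
    linarith
  have hr2 : N * (2 * r) ≤ η / 4 := by
    have h1 := min_le_right ((r₀ - dist x x₁) / 2) (η / (8 * ((N : ℝ) + 1)))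
    rw [← hr', le_div_iff₀ (by positivity)] at h1
    nlinarith
  have hev : ∀ᶠ s in 𝓝 t, |w (x, s) - w (x, t)| < η / 4 ∧ s ∈ Ioo (t₁ - r₀) (t₁ + r₀) ∧
      (s - t) * (2 * R) ^ 2 < r ^ 2 := by
    refine Eventually.and ?_ (Eventually.and (Ioo_mem_nhds ht.1 ht.2) ?_)
    · have h1 := (hw (x, t) ⟨hxB, htI⟩).2.continuousAt
      exact h1.eventually (ball_mem_nhds _ (by positivity : 0 < η / 4))
    · have h1 : ContinuousAt (fun s => (s - t) * (2 * R) ^ 2) t := by fun_prop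
      refine h1.eventually (gt_mem_nhds ?_)
      simp only [sub_self, zero_mul]
      positivity
  obtain ⟨ε, hε, hball⟩ := Metric.eventually_nhds_iff.1 hev
  have hq : ∀ᶠ q : Spc m × ℝ in 𝓝 (x, t), q ∈ ball x r ×ˢ ball t ε :=
    prod_mem_nhds (ball_mem_nhds _ hr) (ball_mem_nhds _ hε)
  filter_upwards [hq]
  rintro ⟨y, s⟩ ⟨hy, hs⟩ hts
  simp only at hy hs hts
  rw [mem_ball] at hy hs
  have hsub : ∀ x' ∈ ball y r, x' ∈ closedBall x₁ r₀ ∧ ‖x - x'‖ ≤ 2 * r := by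
    intro x' hx'
    rw [mem_ball] at hx'
    have h1 : dist x' x ≤ 2 * r := by linarith [dist_triangle x' y x]
    refine ⟨?_, by rwa [← dist_eq_norm, dist_comm]⟩
    rw [mem_closedBall]
    linarith [dist_triangle x' x x₁]
  have hbelow : ∀ s', s' ∈ Icc t s → s' ∈ T → ∀ x' ∈ ball y r, w (x, t) - η / 2 ≤ w (x', s') := by
    intro s' hs' hs'T x' hx'
    obtain ⟨h1, h2⟩ := (hTmem s').1 hs'T
    have h3 : dist s' t < ε := by
      rw [Real.dist_eq, abs_of_nonneg (by linarith [hs'.1])]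
      rw [Real.dist_eq, abs_of_nonneg (by linarith)] at hs
      linarith [hs'.2]
    have h4 := (abs_le.1 (hLip s' h1 h2 x hxB x' (hsub x' hx').1)).2
    have h5 := mul_le_mul_of_nonneg_left (hsub x' hx').2 (Nat.cast_nonneg (α := ℝ) N)
    have h6 := (abs_lt.1 (hball h3).1).1
    linarith
  by_cases hsT : s ∈ T
  · have := hbelow s ⟨hts, le_rfl⟩ hsT y (mem_ball_self hr)
    linarith
  obtain ⟨a, ha, hmax⟩ := (hTc.inter_right (isClosed_Icc (a := t) (b := s))).exists_isGreatest
    ⟨t, htT, le_rfl, hts⟩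
  have has : a < s := lt_of_le_of_ne ha.2.2 (fun h => hsT (h ▸ ha.1))
  obtain ⟨-, hsI, hsR⟩ := hball hs
  have haI := ((hTmem a).1 ha.1).1
  have hboxsub : ball y r ×ˢ Icc a s ⊆ closedBall x₁ r₀ ×ˢ Icc (t₁ - r₀) (t₁ + r₀) :=
    prod_mono (fun x' hx' => (hsub x' hx').1) (Icc_subset_Icc haI.1 hsI.2.le)
  have := hR A w y r a s (w (x, t) - η / 2) hA has ?_ hr (fun z hz => hw z (hboxsub hz)) ?_ ?_
    (hbelow a ⟨ha.2.1, ha.2.2⟩ ha.1)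
  · linarith
  · refine le_trans ?_ hsR.le
    have := ha.2.1
    gcongr
  · rintro ⟨x', s'⟩ ⟨hx', hs'⟩
    refine hFU _ ?_
    by_contra hcon
    have hs'T : s' ∈ T := (hTmem s').2
      ⟨(hboxsub ⟨hx', Ioo_subset_Icc_self hs'⟩).2, x', (hsub x' hx').1, hcon⟩
    have : s' ≤ a := hmax ⟨hs'T, by linarith [ha.2.1, hs'.1], hs'.2.le⟩
    linarith [hs'.1]
  · intro z hz
    have := hlow z (hboxsub hz)
    linarith [le_abs_self (w (x, t))]

theorem SolvesL.futureLsc {lam Lam C : ℝ}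
    {A : Spc m → Matrix (Fin (m + 1)) (Fin (m + 1)) ℝ} {w : Spc m × ℝ → ℝ}
    {O : Set (Spc m × ℝ)} (hlam : 0 < lam) (hA : IsElliptic lam Lam A) (hO : IsOpen O)
    (hC : 0 ≤ C) (hw : SolvesL A w O) (hlow : ∀ z ∈ O, -C ≤ w z) :
    ∀ z ∈ O, FutureLsc w z := by
  set U : Set (Spc m × ℝ) := interior {z | FutureLsc w z} with hU
  have hFU : ∀ z ∈ U, FutureLsc w z := fun z hz => interior_subset hz
  by_contra! hcon
  obtain ⟨z₀, hz₀, hnot⟩ := hcon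
  have hz₀U : z₀ ∉ U := fun h => hnot (hFU z₀ h)
  obtain ⟨ε, hε, hεO⟩ := Metric.isOpen_iff.1 hO z₀ hz₀
  set a := ε / 2 with ha'
  have ha : 0 < a := by positivity
  set X : Set (Spc m × ℝ) := ball z₀ a \ U with hX
  have hXl : IsLocallyClosed X :=
    isOpen_ball.isLocallyClosed.inter isOpen_interior.isClosed_compl.isLocallyClosed
  have : LocallyCompactSpace X := hXl.locallyCompactSpace
  have : Nonempty X := ⟨⟨z₀, mem_ball_self ha, hz₀U⟩⟩
  have hmemO : ∀ z ∈ X, ∀ x ∈ ball z.1 a, (x, z.2) ∈ O := by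
    intro z hz x hx
    refine hεO ?_
    rw [mem_ball]
    have h1 : dist (x, z.2) z < a := by
      rw [Prod.dist_eq, dist_self]
      exact max_lt hx ha
    have h2 : dist z z₀ < a := hz.1
    linarith [dist_triangle (x, z.2) z z₀]
  set Cl : ℕ → Set X := fun N => {z | ∀ x ∈ ball z.1.1 (a / (N + 1)),
    ∀ y ∈ ball z.1.1 (a / (N + 1)), |w (x, z.1.2) - w (y, z.1.2)| ≤ N * ‖x - y‖} with hCl
  have hrad : ∀ N : ℕ, a / (N + 1) ≤ a := fun N => by
    refine div_le_self ha.le ?_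
    linarith [Nat.cast_nonneg (α := ℝ) N]
  have hclosed : ∀ N, IsClosed (Cl N) := by
    intro N
    rw [← isOpen_compl_iff, isOpen_iff_mem_nhds]
    intro z hz
    simp only [hCl, mem_compl_iff, mem_ofPred_eq, not_forall, not_le] at hz
    obtain ⟨x, hx, y, hy, hxy⟩ := hz
    have hcont : ∀ x ∈ ball z.1.1 (a / (N + 1)), ContinuousAt (fun s => w (x, s)) z.1.2 :=
      fun x hx => (hw _ (hmemO z.1 z.2 x (ball_subset_ball (hrad N) hx))).2.continuousAt
    have h1 : ContinuousAt (fun z : X => |w (x, z.1.2) - w (y, z.1.2)|) z := by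
      have h2 : ContinuousAt (fun z : X => z.1.2) z := by fun_prop
      exact ((ContinuousAt.comp (f := fun z : X => z.1.2) (hcont x hx) h2).sub
        (ContinuousAt.comp (f := fun z : X => z.1.2) (hcont y hy) h2)).abs
    have hb : ∀ x ∈ ball z.1.1 (a / (N + 1)), ∀ᶠ z' : X in 𝓝 z, x ∈ ball z'.1.1 (a / (N + 1)) := by
      intro x hx
      have h3 : Continuous (fun z' : X => dist x z'.1.1) := by fun_prop
      exact h3.continuousAt.eventually (gt_mem_nhds hx)
    filter_upwards [h1.eventually (lt_mem_nhds hxy), hb x hx, hb y hy] with z' h4 h5 h6 hcl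
    exact absurd (hcl x h5 y h6) (not_le.2 h4)
  have hcover : ⋃ N, Cl N = univ := by
    rw [eq_univ_iff_forall]
    intro z
    have hz : (z.1.1, z.1.2) ∈ O := hmemO z.1 z.2 _ (mem_ball_self ha)
    obtain ⟨L, s, hs, hLs⟩ := ((hw _ hz).1.of_le one_le_two).exists_lipschitzOnWith
    obtain ⟨δ, hδ, hδs⟩ := Metric.mem_nhds_iff.1 hs
    obtain ⟨N, hN⟩ := exists_nat_ge (max (L : ℝ) (a / δ))
    rw [mem_iUnion]
    refine ⟨N, fun x hx y hy => ?_⟩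
    have hN1 : (L : ℝ) ≤ N := (le_max_left _ _).trans hN
    have hN2 : a / (N + 1) ≤ δ := by
      have := (le_max_right _ _).trans hN
      rw [div_le_iff₀ hδ] at this
      rw [div_le_iff₀ (by positivity)]
      nlinarith
    have h1 := hLs.dist_le_mul x (hδs (ball_subset_ball hN2 hx)) y (hδs (ball_subset_ball hN2 hy))
    rw [Real.dist_eq, dist_eq_norm] at h1
    exact h1.trans (by gcongr)
  obtain ⟨N, z, hz⟩ := nonempty_interior_of_iUnion_of_closed hclosed hcover
  obtain ⟨ρ, hρ, hρz⟩ := Metric.mem_nhds_iff.1 (mem_interior_iff_mem_nhds.1 hz)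
  obtain ⟨ρ', hρ', hρz'⟩ := Metric.isOpen_iff.1 (isOpen_ball (x := z₀) (ε := a)) z.1 z.2.1
  set r := min (min ρ ρ') (a / (N + 1)) / 4 with hr'
  have hr : 0 < r := by positivity
  have hr4 : 4 * r = min (min ρ ρ') (a / (N + 1)) := by rw [hr']; ring
  have hrρ : 4 * r ≤ ρ := hr4.le.trans ((min_le_left _ _).trans (min_le_left _ _))
  have hrρ' : 4 * r ≤ ρ' := hr4.le.trans ((min_le_left _ _).trans (min_le_right _ _))
  have hra : 4 * r ≤ a / (N + 1) := hr4.le.trans (min_le_right _ _)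
  have hbox : ∀ x ∈ closedBall z.1.1 r, ∀ t ∈ Icc (z.1.2 - r) (z.1.2 + r),
      dist (x, t) z.1 < 4 * r := by
    intro x hx t ht
    rw [Prod.dist_eq]
    refine max_lt ?_ ?_
    · exact lt_of_le_of_lt (mem_closedBall.1 hx) (by linarith)
    · simp only [Real.dist_eq]
      rw [abs_lt]
      constructor <;> linarith [ht.1, ht.2]
  have hboxO : closedBall z.1.1 r ×ˢ Icc (z.1.2 - r) (z.1.2 + r) ⊆ O := by
    rintro ⟨x, t⟩ ⟨hx, ht⟩
    refine hεO (ball_subset_ball (by linarith) (hρz' ?_))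
    exact (hbox x hx t ht).trans_le hrρ'
  have key := futureLsc_of_lipschitz (x₁ := z.1.1) (t₁ := z.1.2) (r₀ := r) (N := N) (U := U)
    hlam hA isOpen_interior hFU hC (fun q hq => hw q (hboxO hq)) (fun q hq => hlow q (hboxO hq)) ?_
  · refine z.2.2 (mem_interior.2 ⟨_, key, isOpen_ball.prod isOpen_Ioo, mem_ball_self hr, ?_⟩)
    constructor <;> linarith
  · rintro t ht ⟨x, hx, hxU⟩ y hy q hq
    have h1 : (x, t) ∈ X := ⟨hρz' ((hbox x hx t ht).trans_le hrρ'), hxU⟩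
    have h2 : (⟨(x, t), h1⟩ : X) ∈ Cl N := hρz ((hbox x hx t ht).trans_le hrρ)
    have h3 : ∀ y ∈ closedBall z.1.1 r, y ∈ ball x (a / (N + 1)) := by
      intro y hy
      rw [mem_closedBall] at hx hy
      rw [mem_ball]
      have := dist_triangle_right y x z.1.1
      linarith
    exact h2 y (h3 y hy) q (h3 q hq)

/-- Comparison principle for a strict subsolution `ψ`; the contact set is only required to be
compactly contained in `D`. -/
theorem le_of_strict_subsolution {lam Lam t₀ : ℝ}
    {A : Spc m → Matrix (Fin (m + 1)) (Fin (m + 1)) ℝ} {w ψ ψt : Spc m × ℝ → ℝ}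
    {Q D : Set (Spc m × ℝ)} (hlam : 0 < lam) (hA : IsElliptic lam Lam A)
    (hQ : IsCompact Q) (hQt : ∀ z ∈ Q, z.2 ≤ t₀) (hw : SolvesL A w D)
    (hlsc : ∀ z ∈ D, z.2 < t₀ → FutureLsc w z) (hψ : Continuous ψ)
    (hcl : ∀ ε > 0, closure {z | z ∈ Q ∧ z ∈ D ∧ w z ≤ ψ z - ε} ⊆ D)
    (hint : ∀ z ∈ Q, z ∈ D → w z < ψ z → ∀ᶠ y in 𝓝 z, y.2 ≤ z.2 → y ∈ Q ∧ y ∈ D)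
    (hψ2 : ∀ z ∈ Q, z ∈ D → w z < ψ z → ContDiffAt ℝ 2 (fun x => ψ (x, z.2)) z.1)
    (hψt : ∀ z ∈ Q, z ∈ D → w z < ψ z → HasDerivAt (fun s => ψ (z.1, s)) (ψt z) z.2)
    (hψL : ∀ z ∈ Q, z ∈ D → w z < ψ z → ψt z < trA (A z.1) (D2 (fun x => ψ (x, z.2)) z.1)) :
    ∀ z ∈ Q, z ∈ D → z.2 = t₀ → ψ z ≤ w z := by
  intro z₀ hz₀Q hz₀D hz₀t
  by_contra! hlt
  set ε := ψ z₀ - w z₀ with hε'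
  have hε : 0 < ε := sub_pos.2 hlt
  set B : Set (Spc m × ℝ) := {z | z ∈ Q ∧ z ∈ D ∧ w z ≤ ψ z - ε} with hB
  have hz₀B : z₀ ∈ B := ⟨hz₀Q, hz₀D, by rw [hε']; linarith⟩
  have hBlt : ∀ z ∈ B, w z < ψ z := fun z hz => by linarith [hz.2.2]
  have hBQ : closure B ⊆ Q := closure_minimal (fun z hz => hz.1) hQ.isClosed
  have hBc : IsCompact (closure B) := hQ.of_isClosed_subset isClosed_closure hBQ
  obtain ⟨z₁, hz₁, hmin⟩ := hBc.exists_isMinOn ⟨z₀, subset_closure hz₀B⟩ continuousOn_snd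
  have hz₁D := hcl ε hε hz₁
  obtain ⟨x₁, hx₁⟩ : ∃ x, (x, z₁.2) ∈ B := by
    rcases (hQt z₁ (hBQ hz₁)).lt_or_eq with h | h
    · refine ⟨z₁.1, hBQ hz₁, hz₁D, le_of_forall_pos_lt_add fun η hη => ?_⟩
      have h1 := hlsc z₁ hz₁D h (η / 2) (by positivity)
      have h2 : ∀ᶠ z in 𝓝 z₁, ψ z < ψ z₁ + η / 2 :=
        hψ.continuousAt.eventually (gt_mem_nhds (by linarith))
      obtain ⟨z, ⟨h3, h4⟩, hzB⟩ := mem_closure_iff_nhds.1 hz₁ _ (h1.and h2)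
      have h5 := h3 (hmin (subset_closure hzB))
      have h6 := hzB.2.2
      change w z₁ < ψ z₁ - ε + η
      linarith
    · refine ⟨z₀.1, ?_⟩
      rw [h, ← hz₀t]
      exact hz₀B
  set s := z₁.2 with hs
  have hcont : ∀ x, (x, s) ∈ D → ContinuousAt (fun y => w (y, s) - ψ (y, s)) x := fun x hx =>
    (hw _ hx).1.continuousAt.sub (by fun_prop)
  set F : Set (Spc m) := {x | (x, s) ∈ B} with hF
  have hclF : closure F ⊆ {x | (x, s) ∈ closure B} :=
    closure_minimal (fun x hx => subset_closure hx)
      (isClosed_closure.preimage (by fun_prop : Continuous fun x : Spc m => (x, s)))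
  have hFD : ∀ x ∈ closure F, (x, s) ∈ D := fun x hx => hcl ε hε (hclF hx)
  have hFcl : IsClosed F := by
    refine isClosed_of_closure_subset fun x hx => ⟨hBQ (hclF hx), hFD x hx, ?_⟩
    have h1 := hcont x (hFD x hx)
    by_contra! h2
    have h3 : ∀ᶠ y in 𝓝 x, -ε < w (y, s) - ψ (y, s) := h1.eventually (lt_mem_nhds (by linarith))
    obtain ⟨y, h4, h5⟩ := mem_closure_iff_nhds.1 hx _ h3
    have h6 := h5.2.2
    simp only [mem_ofPred_eq] at h4
    linarith
  have hFc : IsCompact F := by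
    refine (hQ.image continuous_fst).of_isClosed_subset hFcl fun x hx => ⟨(x, s), hx.1, rfl⟩
  obtain ⟨x, hx, hxmin⟩ := hFc.exists_isMinOn ⟨x₁, hx₁⟩
    (fun y hy => (hcont y hy.2.1).continuousWithinAt)
  have hxB : (x, s) ∈ B := hx
  have hxlt := hBlt _ hxB
  have hev := hint _ hxB.1 hxB.2.1 hxlt
  have hloc : IsLocalMin (fun y => w (y, s) - ψ (y, s)) x := by
    have h1 : ContinuousAt (fun y : Spc m => (y, s)) x := by fun_prop
    filter_upwards [h1.eventually hev] with y hy
    obtain ⟨h2, h3⟩ := hy le_rfl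
    by_cases h4 : w (y, s) ≤ ψ (y, s) - ε
    · exact hxmin (show y ∈ F from ⟨h2, h3, h4⟩)
    · have h5 := hxB.2.2
      linarith
  obtain ⟨hw2, hwt⟩ := hw _ hxB.2.1
  have hp2 := hψ2 _ hxB.1 hxB.2.1 hxlt
  have hpL := hψL _ hxB.1 hxB.2.1 hxlt
  rw [Lop_eq A w x s hw2] at hwt
  simp only at hw2 hp2 hpL hwt
  have hD2 : trA (A x) (D2 (fun y => w (y, s) - ψ (y, s)) x) =
      trA (A x) (D2 (fun y => w (y, s)) x) - trA (A x) (D2 (fun y => ψ (y, s)) x) := by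
    have h1 : (fun y => w (y, s) - ψ (y, s)) = fun y => w (y, s) + (-1) * ψ (y, s) := by
      ext y; ring
    rw [h1, D2_add hw2 (contDiffAt_const.mul hp2), D2_const_mul hp2, trA_add, trA_smul]
    ring
  have hnn : 0 ≤ trA (A x) (D2 (fun y => w (y, s) - ψ (y, s)) x) :=
    (D2_psd_of_isLocalMin (hw2.sub hp2) hloc).trA_nonneg hlam.le (hA.ellM x)
  have hd := hwt.sub (hψt (x, s) hxB.1 hxB.2.1 hxlt)
  have hpos : 0 < trA (A x) (D2 (fun y => w (y, s)) x) - ψt (x, s) := by linarith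
  have hslope := hd.lslope _ (half_pos hpos)
  have h1 : ContinuousAt (fun τ : ℝ => (x, τ)) s := by fun_prop
  have hev' : ∀ᶠ τ in 𝓝[<] s, τ ≤ s → (x, τ) ∈ Q ∧ (x, τ) ∈ D :=
    nhdsWithin_le_nhds (h1.eventually hev)
  obtain ⟨τ, h2, h3, h4⟩ := (hev'.and (hslope.and self_mem_nhdsWithin)).exists
  have h4' : τ < s := h4
  obtain ⟨h5, h6⟩ := h2 h4'.le
  have h7 : (x, τ) ∈ B := by
    refine ⟨h5, h6, ?_⟩
    have h8 := hxB.2.2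
    simp only [Pi.sub_apply] at h3
    nlinarith
  have : s ≤ τ := hmin (subset_closure h7)
  linarith

lemma xprime_apply (x : Spc m) (i : Fin m) : xprime x i = x i.castSucc := rfl

lemma continuous_xprime : Continuous (xprime : Spc m → Spc' m) := by
  refine (PiLp.continuous_toLp 2 _).comp (continuous_pi fun i => ?_)
  fun_prop

lemma continuous_xlast : Continuous (xlast : Spc m → ℝ) := by
  unfold xlast
  fun_prop

/-- The open cylinder whose nonpositive times form `CylB g r`. -/
lemma CylB_eq (g : Spc' m → ℝ → ℝ) (r : ℝ) : CylB g r =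
    {p : Spc m × ℝ | (∀ i : Fin m, -r < xprime p.1 i ∧ xprime p.1 i < r) ∧ -r ^ 2 < p.2 ∧
      g (xprime p.1) p.2 < xlast p.1 ∧ xlast p.1 < g (xprime p.1) p.2 + r} ∩ {p | p.2 ≤ 0} := by
  ext p
  simp only [CylB, mem_ofPred_eq, mem_inter_iff]
  tauto

section
variable {g : Spc' m → ℝ → ℝ}

lemma continuous_graph (hg : Continuous fun q : Spc' m × ℝ => g q.1 q.2) :
    Continuous fun p : Spc m × ℝ => g (xprime p.1) p.2 :=
  hg.comp ((continuous_xprime.comp continuous_fst).prodMk continuous_snd)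

lemma isOpen_cyl_aux (hg : Continuous fun q : Spc' m × ℝ => g q.1 q.2) (r : ℝ) :
    IsOpen
    {p : Spc m × ℝ | (∀ i : Fin m, -r < xprime p.1 i ∧ xprime p.1 i < r) ∧ -r ^ 2 < p.2 ∧
      g (xprime p.1) p.2 < xlast p.1 ∧ xlast p.1 < g (xprime p.1) p.2 + r} := by
  have h1 := continuous_graph hg
  have h2 : Continuous fun p : Spc m × ℝ => xlast p.1 := continuous_xlast.comp continuous_fst
  refine IsOpen.inter ?_ (IsOpen.inter ?_ (IsOpen.inter ?_ ?_))
  · simp only [xprime_apply]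
    have : {p : Spc m × ℝ | ∀ i : Fin m, -r < p.1 i.castSucc ∧ p.1 i.castSucc < r} =
        ⋂ i : Fin m, {p : Spc m × ℝ | -r < p.1 i.castSucc ∧ p.1 i.castSucc < r} := by
      ext p; simp
    change IsOpen {p : Spc m × ℝ | ∀ i : Fin m, -r < p.1 i.castSucc ∧ p.1 i.castSucc < r}
    rw [this]
    refine isOpen_iInter_of_finite fun i => ?_
    have hc : Continuous fun p : Spc m × ℝ => p.1 i.castSucc := by fun_prop
    exact (isOpen_lt continuous_const hc).inter (isOpen_lt hc continuous_const)
  · exact isOpen_lt continuous_const continuous_snd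
  · exact isOpen_lt h1 h2
  · exact isOpen_lt h2 (h1.add continuous_const)

lemma eventually_mem_CylB (hg : Continuous fun q : Spc' m × ℝ => g q.1 q.2)
    {r : ℝ} {z : Spc m × ℝ} (hz : z ∈ CylB g r) :
    ∀ᶠ y in 𝓝 z, y.2 ≤ z.2 → y ∈ CylB g r := by
  rw [CylB_eq] at hz ⊢
  filter_upwards [(isOpen_cyl_aux hg r).mem_nhds hz.1] with y hy hyz
  exact ⟨hy, hyz.trans hz.2⟩

lemma SolvesL.futureLsc_CylB (hg : Continuous fun q : Spc' m × ℝ => g q.1 q.2)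
    {lam Lam C r : ℝ}
    {A : Spc m → Matrix (Fin (m + 1)) (Fin (m + 1)) ℝ} {w : Spc m × ℝ → ℝ}
    (hlam : 0 < lam) (hA : IsElliptic lam Lam A) (hC : 0 ≤ C) (hw : SolvesL A w (CylB g r))
    (hlow : ∀ z ∈ CylB g r, -C ≤ w z) : ∀ z ∈ CylB g r, z.2 < 0 → FutureLsc w z := by
  intro z hz hz0
  have hO := (isOpen_cyl_aux hg r).inter (isOpen_lt continuous_snd (continuous_const (y := (0 : ℝ))))
  rw [CylB_eq] at *
  have hsub := inter_subset_inter_right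
    {p : Spc m × ℝ | (∀ i : Fin m, -r < xprime p.1 i ∧ xprime p.1 i < r) ∧ -r ^ 2 < p.2 ∧
      g (xprime p.1) p.2 < xlast p.1 ∧ xlast p.1 < g (xprime p.1) p.2 + r}
    (fun p (hp : p.2 < 0) => hp.le : {p : Spc m × ℝ | p.2 < 0} ⊆ {p | p.2 ≤ 0})
  exact SolvesL.futureLsc hlam hA hO hC (fun q hq => hw q (hsub hq)) (fun q hq => hlow q (hsub hq))
    z ⟨hz.1, hz0⟩

end

/-- The paraboloidal profile of the barrier. -/
def barQ (L ρ : ℝ) (z₀ z : Spc m × ℝ) : ℝ :=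
  ‖z.1 - z₀.1‖ ^ 2 / (2 * L * ρ) ^ 2 + (z₀.2 - z.2) / ρ ^ 2

lemma continuous_barQ (L ρ : ℝ) (z₀ : Spc m × ℝ) : Continuous (barQ L ρ z₀) := by
  unfold barQ
  fun_prop

lemma barQ_le_one {L ρ : ℝ} (hL : 0 < L) (hρ : 0 < ρ) {z₀ z : Spc m × ℝ} (h : barQ L ρ z₀ z ≤ 1)
    (ht : z.2 ≤ z₀.2) : ‖z.1 - z₀.1‖ ≤ 2 * L * ρ ∧ z₀.2 - ρ ^ 2 ≤ z.2 := by
  have h1 : 0 ≤ ‖z.1 - z₀.1‖ ^ 2 / (2 * L * ρ) ^ 2 := by positivity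
  have h2 : 0 ≤ (z₀.2 - z.2) / ρ ^ 2 := div_nonneg (sub_nonneg.2 ht) (by positivity)
  unfold barQ at h
  constructor
  · have h3 : ‖z.1 - z₀.1‖ ^ 2 / (2 * L * ρ) ^ 2 ≤ 1 := by linarith
    rw [div_le_one (by positivity)] at h3
    exact le_of_sq_le_sq h3 (by positivity)
  · have h3 : (z₀.2 - z.2) / ρ ^ 2 ≤ 1 := by linarith
    rw [div_le_one (by positivity)] at h3
    linarith

/-- The barrier, equal to `a` on `barQ = 1`. -/
def barrier (α L ρ a b : ℝ) (z₀ z : Spc m × ℝ) : ℝ :=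
  (b - a) * Real.exp (-(α * barQ L ρ z₀ z)) + (a - (b - a) * Real.exp (-α))

lemma barrier_hasDerivAt (α L ρ a b : ℝ) (z₀ z : Spc m × ℝ) :
    HasDerivAt (fun s => barrier α L ρ a b z₀ (z.1, s))
      ((b - a) * (Real.exp (-(α * barQ L ρ z₀ z)) * (α / ρ ^ 2))) z.2 := by
  unfold barrier
  have h1 : HasDerivAt (fun s => barQ L ρ z₀ (z.1, s)) (-1 / ρ ^ 2) z.2 := by
    change HasDerivAt (fun s : ℝ => ‖z.1 - z₀.1‖ ^ 2 / (2 * L * ρ) ^ 2 + (z₀.2 - s) / ρ ^ 2) _ _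
    exact (((hasDerivAt_id z.2).const_sub z₀.2).div_const (ρ ^ 2)).const_add _
  have h2 : HasDerivAt (fun s => -(α * barQ L ρ z₀ (z.1, s))) (α / ρ ^ 2) z.2 := by
    have := h1.const_mul (-α)
    simp only [neg_mul] at this
    refine this.congr_deriv ?_
    ring
  exact (h2.exp.const_mul (b - a)).add_const _

lemma barQ_contDiff (L ρ : ℝ) (z₀ : Spc m × ℝ) (t : ℝ) :
    ContDiff ℝ 2 (fun x : Spc m => barQ L ρ z₀ (x, t)) := by
  change ContDiff ℝ 2 fun x : Spc m => ‖x - z₀.1‖ ^ 2 / (2 * L * ρ) ^ 2 + (z₀.2 - t) / ρ ^ 2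
  exact ((contDiff_normSq z₀.1).div_const _).add contDiff_const

lemma barrier_contDiff (α L ρ a b : ℝ) (z₀ : Spc m × ℝ) (t : ℝ) :
    ContDiff ℝ 2 (fun x : Spc m => barrier α L ρ a b z₀ (x, t)) := by
  unfold barrier
  exact (contDiff_const.mul (((contDiff_const.mul (barQ_contDiff L ρ z₀ t)).neg).exp)).add
    contDiff_const

lemma barrier_strict {lam Lam α L ρ a b : ℝ} {A : Matrix (Fin (m + 1)) (Fin (m + 1)) ℝ}
    (hA : EllM lam Lam A) (hlam : 0 < lam) (hL : 0 < L) (hρ : 0 < ρ) (hab : a < b) (hα : 0 < α)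
    (hαL : 1 + Lam * (m + 1) / (2 * L ^ 2) < α * lam / (4 * L ^ 4)) {z₀ z : Spc m × ℝ}
    (hz : ρ ≤ ‖z.1 - z₀.1‖) :
    (b - a) * (Real.exp (-(α * barQ L ρ z₀ z)) * (α / ρ ^ 2)) <
      trA A (D2 (fun x => barrier α L ρ a b z₀ (x, z.2)) z.1) := by
  set e := Real.exp (-(α * barQ L ρ z₀ z)) with he'
  have he : 0 < e := Real.exp_pos _
  set c := 1 / (2 * L * ρ) ^ 2 with hc'
  have hc : 0 < c := by positivity
  have hq2 := barQ_contDiff (m := m) L ρ z₀ z.2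
  have hfun : (fun x : Spc m => barQ L ρ z₀ (x, z.2)) =
      fun x => c * ‖x - z₀.1‖ ^ 2 + (z₀.2 - z.2) / ρ ^ 2 := by
    ext x
    simp only [barQ, hc']
    ring
  have hD2 : D2 (fun x : Spc m => barQ L ρ z₀ (x, z.2)) z.1 = c • (2 : ℝ) • inB m := by
    rw [hfun, D2_add_const, D2_const_mul (contDiff_normSq z₀.1).contDiffAt, D2_normSq]
  have hfd : fderiv ℝ (fun x : Spc m => barQ L ρ z₀ (x, z.2)) z.1 =
      inB m ((2 * c) • (z.1 - z₀.1)) := by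
    rw [hfun, (((hasFDerivAt_normSq z₀.1 z.1).const_mul c).add_const _).fderiv]
    ext v
    simp only [map_smul, smul_apply, smul_eq_mul, inB_apply]
    ring
  have h2 : HasDerivAt (fun s => -α * Real.exp (-(α * s))) (-α * (-α * e)) (barQ L ρ z₀ z) :=
    (hasDerivAt_exp_neg_mul α _).const_mul (-α)
  have hB : D2 (fun x => barrier α L ρ a b z₀ (x, z.2)) z.1 = (b - a) •
      ((-α * e) • (c • (2 : ℝ) • inB m) + (-α * (-α * e)) •
        (inB m ((2 * c) • (z.1 - z₀.1))).smulRight (inB m ((2 * c) • (z.1 - z₀.1)))) := by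
    unfold barrier
    rw [D2_add_const, D2_const_mul ((contDiff_const.mul hq2).neg.exp).contDiffAt,
      D2_comp_real hq2.contDiffAt (hasDerivAt_exp_neg_mul α) h2, hD2, hfd]
  rw [hB, trA_smul]
  refine mul_lt_mul_of_pos_left ?_ (sub_pos.2 hab)
  rw [trA_add, trA_smul, trA_smul, trA_smul, trA_smul]
  have h3 := (trA_smulRight_bounds hA ((2 * c) • (z.1 - z₀.1))).1
  have h4 := trA_inB_le hA
  rw [norm_smul, Real.norm_of_nonneg (by positivity), mul_pow] at h3
  have h5 : ρ ^ 2 ≤ ‖z.1 - z₀.1‖ ^ 2 := by gcongr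
  have h6 : lam * ((2 * c) ^ 2 * ρ ^ 2) ≤
      trA A ((inB m ((2 * c) • (z.1 - z₀.1))).smulRight (inB m ((2 * c) • (z.1 - z₀.1)))) :=
    le_trans (by gcongr) h3
  have h7 : (-α * e) * (c * (2 * (Lam * (m + 1)))) ≤ (-α * e) * (c * (2 * trA A (inB m))) := by
    refine mul_le_mul_of_nonpos_left (by gcongr) ?_
    have := mul_pos hα he
    linarith
  have h8 : (α * α * e) * (lam * ((2 * c) ^ 2 * ρ ^ 2)) ≤ (-α * (-α * e)) *
      trA A ((inB m ((2 * c) • (z.1 - z₀.1))).smulRight (inB m ((2 * c) • (z.1 - z₀.1)))) := by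
    have : -α * (-α * e) = α * α * e := by ring
    rw [this]
    gcongr
  have h9 : e * (α / ρ ^ 2) < (-α * e) * (c * (2 * (Lam * (m + 1)))) +
      (α * α * e) * (lam * ((2 * c) ^ 2 * ρ ^ 2)) := by
    have h10 := mul_lt_mul_of_pos_left hαL (by positivity : 0 < e * α / ρ ^ 2)
    have h11 : (-α * e) * (c * (2 * (Lam * (m + 1)))) =
        -(e * α / ρ ^ 2 * (Lam * (m + 1) / (2 * L ^ 2))) := by
      rw [hc']; field_simp
    have h12 : (α * α * e) * (lam * ((2 * c) ^ 2 * ρ ^ 2)) =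
        e * α / ρ ^ 2 * (α * lam / (4 * L ^ 4)) := by
      rw [hc']; field_simp; ring
    have h13 : e * (α / ρ ^ 2) = e * α / ρ ^ 2 := by ring
    rw [h11, h12, h13]
    linarith
  linarith

lemma continuous_barrier (α L ρ a b : ℝ) (z₀ : Spc m × ℝ) :
    Continuous (barrier α L ρ a b z₀) :=
  (continuous_const.mul (((continuous_const.mul (continuous_barQ L ρ z₀)).neg).rexp)).add
    continuous_const

lemma barrier_le_left {α L ρ a b : ℝ} {z₀ z : Spc m × ℝ} (hα : 0 < α) (hab : a ≤ b)
    (hz : 1 ≤ barQ L ρ z₀ z) : barrier α L ρ a b z₀ z ≤ a := by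
  have h1 : Real.exp (-(α * barQ L ρ z₀ z)) ≤ Real.exp (-α) :=
    Real.exp_le_exp.2 (by nlinarith)
  have := mul_le_mul_of_nonneg_left h1 (sub_nonneg.2 hab)
  unfold barrier
  linarith

lemma barQ_nonneg (L ρ : ℝ) {z₀ z : Spc m × ℝ} (hz : z.2 ≤ z₀.2) : 0 ≤ barQ L ρ z₀ z := by
  have : 0 ≤ z₀.2 - z.2 := sub_nonneg.2 hz
  unfold barQ
  positivity

lemma barrier_le_right {α L ρ a b : ℝ} {z₀ z : Spc m × ℝ} (hα : 0 < α) (hab : a ≤ b)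
    (hz : z.2 ≤ z₀.2) : barrier α L ρ a b z₀ z ≤ b := by
  have hq := barQ_nonneg L ρ hz
  have h1 : Real.exp (-(α * barQ L ρ z₀ z)) ≤ 1 :=
    Real.exp_le_one_iff.2 (neg_nonpos.2 (by positivity))
  have h3 := mul_le_mul_of_nonneg_left h1 (sub_nonneg.2 hab)
  have h4 := mul_nonneg (sub_nonneg.2 hab) (Real.exp_pos (-α)).le
  unfold barrier
  linarith

lemma isClosed_barQ_sublevel (L ρ : ℝ) (z₀ : Spc m × ℝ) :
    IsClosed {z : Spc m × ℝ | z.2 ≤ z₀.2 ∧ barQ L ρ z₀ z ≤ 1} :=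
  (isClosed_le continuous_snd continuous_const).inter
    (isClosed_le (continuous_barQ L ρ z₀) continuous_const)

lemma isCompact_barQ_sublevel {L ρ : ℝ} (hL : 0 < L) (hρ : 0 < ρ) (z₀ : Spc m × ℝ) :
    IsCompact {z : Spc m × ℝ | z.2 ≤ z₀.2 ∧ barQ L ρ z₀ z ≤ 1} := by
  refine ((isCompact_closedBall z₀.1 (2 * L * ρ)).prod
    (isCompact_Icc (a := z₀.2 - ρ ^ 2) (b := z₀.2))).of_isClosed_subset
    (isClosed_barQ_sublevel L ρ z₀) fun z hz => ?_
  obtain ⟨h1, h2⟩ := barQ_le_one hL hρ hz.2 hz.1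
  exact ⟨mem_closedBall_iff_norm.2 h1, h2, hz.1⟩

lemma barQ_eq_quarter {L ρ t₀ : ℝ} (hL : 0 < L) (hρ : 0 < ρ) {x₀ y₀ : Spc m}
    (h : ‖x₀ - y₀‖ = L * ρ) : barQ L ρ (y₀, t₀) (x₀, t₀) = 1 / 4 := by
  simp only [barQ, h]
  field_simp
  ring

/-- Propagation of a lower bound from a ball to its centre of dilation, by means of the barrier. -/
theorem exists_barrier_lower (m : ℕ) {lam Lam L : ℝ} (hlam : 0 < lam) (hLam : 0 ≤ Lam)
    (hL : 0 < L) :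
    ∃ κ : ℝ, 0 < κ ∧ κ < 1 ∧ ∀ (A : Spc m → Matrix (Fin (m + 1)) (Fin (m + 1)) ℝ)
      (g : Spc' m → ℝ → ℝ) (r C : ℝ) (w : Spc m × ℝ → ℝ), IsElliptic lam Lam A →
      Continuous (fun q : Spc' m × ℝ => g q.1 q.2) → SolvesL A w (CylB g r) →
      VanishesOn (fun q => max (-w q) 0) (CylB g r) (graphSet g) → 0 ≤ C →
      (∀ z ∈ CylB g r, -C ≤ w z) →
      ∀ (x₀ y₀ : Spc m) (t₀ ρ a b : ℝ), 0 < ρ → (x₀, t₀) ∈ CylB g r → a ≤ b →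
      y₀ = x₀ + (L * ρ) • eVec m (Fin.last m) →
      (∀ x t, ‖x - y₀‖ ≤ 2 * L * ρ → t₀ - ρ ^ 2 ≤ t → t ≤ t₀ →
        (∀ i, -r < xprime x i ∧ xprime x i < r) ∧ -r ^ 2 < t ∧ xlast x < g (xprime x) t + r) →
      (∀ z ∈ CylB g r, ‖z.1 - y₀‖ ≤ 2 * L * ρ → t₀ - ρ ^ 2 ≤ z.2 → z.2 ≤ t₀ → a ≤ w z) →
      (∀ z ∈ CylB g r, ‖z.1 - y₀‖ ≤ ρ → t₀ - ρ ^ 2 ≤ z.2 → z.2 ≤ t₀ → b ≤ w z) →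
      (∀ x t, ‖x - y₀‖ ≤ 2 * L * ρ → t₀ - ρ ^ 2 ≤ t → t ≤ t₀ → xlast x = g (xprime x) t → b ≤ 0) →
      a + (b - a) * κ ≤ w (x₀, t₀) := by
  set α := 4 * L ^ 4 / lam * (2 + Lam * (m + 1) / (2 * L ^ 2)) with hα'
  have hα : 0 < α := by positivity
  have hαL : 1 + Lam * (m + 1) / (2 * L ^ 2) < α * lam / (4 * L ^ 4) := by
    have : α * lam / (4 * L ^ 4) = 2 + Lam * (m + 1) / (2 * L ^ 2) := by
      rw [hα']; field_simp
    rw [this]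
    linarith
  refine ⟨Real.exp (-(α * (1 / 4))) - Real.exp (-α), ?_, ?_, ?_⟩
  · exact sub_pos.2 (Real.exp_lt_exp.2 (by linarith))
  · have h1 := Real.exp_pos (-α)
    have h2 : Real.exp (-(α * (1 / 4))) < 1 := Real.exp_lt_one_iff.2 (by linarith)
    linarith
  intro A g r C w hA hg hw hv hC hlow x₀ y₀ t₀ ρ a b hρ hx₀ hab hy₀ hside ha hb hΓ
  have hdist : ‖x₀ - y₀‖ = L * ρ := by
    rw [hy₀, sub_add_cancel_left, norm_neg, norm_smul, eVec_norm, mul_one,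
      Real.norm_of_nonneg (by positivity)]
  have hLρ : 0 < L * ρ := by positivity
  rcases hab.eq_or_lt with rfl | hab'
  · simpa using ha (x₀, t₀) hx₀ (by simp only [hdist]; linarith) (by simp only; nlinarith) le_rfl
  obtain ⟨z₀, hz₀⟩ : ∃ z₀ : Spc m × ℝ, z₀ = (y₀, t₀) := ⟨_, rfl⟩
  have hz1 : z₀.1 = y₀ := by rw [hz₀]
  have hz2 : z₀.2 = t₀ := by rw [hz₀]
  have hqx : barQ L ρ z₀ (x₀, t₀) = 1 / 4 := by rw [hz₀]; exact barQ_eq_quarter hL hρ hdist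
  clear hz₀
  subst hz1 hz2
  have hQb : ∀ z ∈ {z : Spc m × ℝ | z.2 ≤ z₀.2 ∧ barQ L ρ z₀ z ≤ 1},
      ‖z.1 - z₀.1‖ ≤ 2 * L * ρ ∧ z₀.2 - ρ ^ 2 ≤ z.2 := fun z hz =>
    barQ_le_one hL hρ hz.2 hz.1
  have hbad : ∀ z ∈ {z : Spc m × ℝ | z.2 ≤ z₀.2 ∧ barQ L ρ z₀ z ≤ 1}, z ∈ CylB g r → w z < barrier α L ρ a b z₀ z → barQ L ρ z₀ z < 1 ∧ ρ ≤ ‖z.1 - z₀.1‖ := by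
    intro z hz hzD hlt
    obtain ⟨h1, h2⟩ := hQb z hz
    constructor
    · by_contra! h
      exact absurd hlt (not_lt.2 ((barrier_le_left hα hab h).trans (ha z hzD h1 h2 hz.1)))
    · by_contra! h
      exact absurd hlt (not_lt.2 ((barrier_le_right hα hab hz.1).trans (hb z hzD h.le h2 hz.1)))
  have ht₀ : z₀.2 ≤ 0 := hx₀.2.2.1
  have hmain := le_of_strict_subsolution (t₀ := z₀.2) (ψ := barrier α L ρ a b z₀)
    (Q := {z : Spc m × ℝ | z.2 ≤ z₀.2 ∧ barQ L ρ z₀ z ≤ 1}) (D := CylB g r) (w := w)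
    (ψt := fun z => (b - a) * (Real.exp (-(α * barQ L ρ z₀ z)) * (α / ρ ^ 2)))
    hlam hA (isCompact_barQ_sublevel hL hρ z₀) (fun z hz => hz.1) hw
    (fun z hz ht => hw.futureLsc_CylB hg hlam hA hC hlow z hz (ht.trans_le ht₀)) (continuous_barrier α L ρ a b z₀) ?_ ?_
    (fun z _ _ _ => (barrier_contDiff α L ρ a b z₀ z.2).contDiffAt)
    (fun z _ _ _ => barrier_hasDerivAt α L ρ a b z₀ z)
    (fun z hz hzD hlt => barrier_strict (hA.ellM _) hlam hL hρ hab' hα hαL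
      (hbad z hz hzD hlt).2)
    (x₀, z₀.2) ⟨le_rfl, by rw [hqx]; norm_num⟩ hx₀ rfl
  · refine le_trans (le_of_eq ?_) hmain
    simp only [barrier, hqx]
    ring
  · intro ε hε P hP
    have hPQ : P ∈ {z : Spc m × ℝ | z.2 ≤ z₀.2 ∧ barQ L ρ z₀ z ≤ 1} := closure_minimal (fun z hz => hz.1) (isClosed_barQ_sublevel L ρ z₀) hP
    obtain ⟨h1, h2⟩ := hQb P hPQ
    obtain ⟨h3, h4, h5⟩ := hside P.1 P.2 h1 h2 hPQ.1
    have hge : g (xprime P.1) P.2 ≤ xlast P.1 := by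
      have hcl : IsClosed {p : Spc m × ℝ | g (xprime p.1) p.2 ≤ xlast p.1} :=
        isClosed_le (continuous_graph hg) (continuous_xlast.comp continuous_fst)
      exact closure_minimal (fun z hz => hz.2.1.2.2.2.1.le) hcl hP
    rcases hge.lt_or_eq with h | h
    · exact ⟨h3, h4, hPQ.1.trans ht₀, h, h5⟩
    · exfalso
      have hb0 : b ≤ 0 := hΓ P.1 P.2 h1 h2 hPQ.1 h.symm
      have hPcl : P ∈ closure (CylB g r) := closure_mono (fun z hz => hz.2.1) hP
      have hlim := hv P ⟨h.symm, hPcl⟩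
      have hev := eventually_nhdsWithin_iff.1 (hlim.eventually (gt_mem_nhds hε))
      obtain ⟨z, hz1, hz2⟩ := mem_closure_iff_nhds.1 hP _ hev
      have h6 := hz1 hz2.2.1
      have h7 := barrier_le_right (L := L) (ρ := ρ) hα hab hz2.1.1
      have h8 := le_max_left (-w z) 0
      linarith [hz2.2.2]
  · intro z hz hzD hlt
    have hq := (hbad z hz hzD hlt).1
    filter_upwards [eventually_mem_CylB hg hzD,
      (continuous_barQ L ρ z₀).continuousAt.eventually (gt_mem_nhds hq)] with y h1 h2 h3
    exact ⟨⟨h3.trans hz.1, h2.le⟩, h1 h3⟩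

lemma norm_xprime_sub_le (x y : Spc m) : ‖xprime x - xprime y‖ ≤ ‖x - y‖ := by
  rw [EuclideanSpace.norm_eq, EuclideanSpace.norm_eq, Fin.sum_univ_castSucc]
  exact Real.sqrt_le_sqrt (le_add_of_nonneg_right (sq_nonneg _))

lemma abs_xlast_sub_le (x y : Spc m) : |xlast x - xlast y| ≤ ‖x - y‖ :=
  PiLp.norm_apply_le (x - y) (Fin.last m)

lemma abs_xprime_sub_le (x y : Spc m) (i : Fin m) : |xprime x i - xprime y i| ≤ ‖x - y‖ :=
  PiLp.norm_apply_le (x - y) i.castSucc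

lemma xprime_add_smul_eVec_last (x : Spc m) (c : ℝ) :
    xprime (x + c • eVec m (Fin.last m)) = xprime x := by
  ext i
  simp [xprime_apply, eVec, (Fin.castSucc_lt_last i).ne]

lemma xlast_add_smul_eVec_last (x : Spc m) (c : ℝ) :
    xlast (x + c • eVec m (Fin.last m)) = xlast x + c := by
  simp [xlast, eVec]

/-- The height above the graph is Lipschitz for the parabolic distance. -/
lemma abs_hGamma_sub_le {g : Spc' m → ℝ → ℝ} {K ρ t s : ℝ} (hK : 0 ≤ K)
    (hH : HolderSemi 1 (1 / 2) K g) (hρ : 0 ≤ ρ) (x y : Spc m) (hts : |t - s| ≤ ρ ^ 2) :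
    |hGamma g (x, t) - hGamma g (y, s)| ≤ (1 + K) * ‖x - y‖ + K * ρ := by
  have h1 := hH (xprime x) (xprime y) t s
  rw [Real.rpow_one, ← Real.sqrt_eq_rpow] at h1
  have h2 : √|t - s| ≤ ρ := Real.sqrt_le_iff.2 ⟨hρ, hts⟩
  have h3 := mul_le_mul_of_nonneg_left (add_le_add (norm_xprime_sub_le x y) h2) hK
  calc |hGamma g (x, t) - hGamma g (y, s)|
      = |(xlast x - xlast y) - (g (xprime x) t - g (xprime y) s)| := by
        simp only [hGamma]; ring_nf
    _ ≤ |xlast x - xlast y| + |g (xprime x) t - g (xprime y) s| := abs_sub _ _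
    _ ≤ _ := by linarith [abs_xlast_sub_le x y]

/-- A quantitative lower bound at a point of `CylB g r` follows from a lower bound `a` in a
parabolic box of size `B * ρ`, and a lower bound `b` at the points of the box that are higher
by `2 * ρ`. -/
def BoxGrowth (g : Spc' m → ℝ → ℝ) (w : Spc m × ℝ → ℝ) (r B κ : ℝ) : Prop :=
  ∀ (p : Spc m × ℝ) (ρ a b : ℝ), 0 < ρ → p ∈ CylB g r → a ≤ b →
    (∀ i, |xprime p.1 i| < r - B * ρ) → -r ^ 2 + ρ ^ 2 < p.2 → hGamma g p + B * ρ < r →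
    (∀ z ∈ CylB g r, (∀ i, |xprime z.1 i - xprime p.1 i| ≤ B * ρ) → p.2 - ρ ^ 2 ≤ z.2 →
      a ≤ w z) →
    (∀ z ∈ CylB g r, (∀ i, |xprime z.1 i - xprime p.1 i| ≤ B * ρ) → p.2 - ρ ^ 2 ≤ z.2 →
      hGamma g p + 2 * ρ ≤ hGamma g z → b ≤ w z) →
    (b ≤ 0 ∨ B * ρ < hGamma g p) → a + (b - a) * κ ≤ w p

theorem exists_boxGrowth (m : ℕ) {lam Lam K : ℝ} (hlam : 0 < lam) (hLam : 0 ≤ Lam) (hK : 0 ≤ K) :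
    ∃ B κ : ℝ, 0 < B ∧ 0 < κ ∧ κ < 1 ∧ ∀ (A : Spc m → Matrix (Fin (m + 1)) (Fin (m + 1)) ℝ)
      (g : Spc' m → ℝ → ℝ) (r C : ℝ) (w : Spc m × ℝ → ℝ), IsElliptic lam Lam A →
      Continuous (fun q : Spc' m × ℝ => g q.1 q.2) → HolderSemi 1 (1 / 2) K g →
      SolvesL A w (CylB g r) →
      VanishesOn (fun q => max (-w q) 0) (CylB g r) (graphSet g) → 0 ≤ C →
      (∀ z ∈ CylB g r, -C ≤ w z) → BoxGrowth g w r B κ := by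
  have hL : 0 < 3 + 2 * K := by positivity
  obtain ⟨κ, hκ, hκ1, h⟩ := exists_barrier_lower m hlam hLam hL
  obtain ⟨B, hB⟩ : ∃ B, B = (3 + 2 * K) + (1 + K) * (2 * (3 + 2 * K)) + K := ⟨_, rfl⟩
  refine ⟨B, κ, by rw [hB]; positivity, hκ, hκ1, ?_⟩
  intro A g r C w hA hg hH hw hv hC hlow ⟨x₀, t₀⟩ ρ a b hρ hx₀ hab hside htime htop ha hb hΓ
  simp only at hside htime ha hb
  obtain ⟨y₀, hy₀⟩ : ∃ y₀, y₀ = x₀ + ((3 + 2 * K) * ρ) • eVec m (Fin.last m) := ⟨_, rfl⟩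
  have hy' : xprime y₀ = xprime x₀ := by rw [hy₀, xprime_add_smul_eVec_last]
  have hhy : hGamma g (y₀, t₀) = hGamma g (x₀, t₀) + (3 + 2 * K) * ρ := by
    simp only [hGamma, hy']
    rw [hy₀, xlast_add_smul_eVec_last]
    ring
  have hKρ : 0 ≤ K * ρ := by positivity
  have hKKρ : 0 ≤ K * K * ρ := by positivity
  have hBρ : B * ρ = 9 * ρ + 13 * (K * ρ) + 4 * (K * K * ρ) := by rw [hB]; ring
  have hnear : ∀ x, ‖x - y₀‖ ≤ 2 * (3 + 2 * K) * ρ → ∀ i,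
      |xprime x i - xprime x₀ i| ≤ B * ρ := by
    intro x hx i
    have := abs_xprime_sub_le x y₀ i
    rw [hy'] at this
    linarith
  have hheight : ∀ x t, t₀ - ρ ^ 2 ≤ t → t ≤ t₀ →
      |hGamma g (x, t) - hGamma g (y₀, t₀)| ≤ (1 + K) * ‖x - y₀‖ + K * ρ := by
    intro x t h1 h2
    refine abs_hGamma_sub_le hK hH hρ.le x y₀ ?_
    rw [abs_le]
    constructor <;> nlinarith
  have hheight' : ∀ x t, ‖x - y₀‖ ≤ 2 * (3 + 2 * K) * ρ → t₀ - ρ ^ 2 ≤ t → t ≤ t₀ →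
      hGamma g (x₀, t₀) - B * ρ ≤ hGamma g (x, t) ∧
        hGamma g (x, t) ≤ hGamma g (x₀, t₀) + B * ρ := by
    intro x t hx h1 h2
    have h3 := mul_le_mul_of_nonneg_left hx (by positivity : 0 ≤ 1 + K)
    obtain ⟨h4, h5⟩ := abs_le.1 (hheight x t h1 h2)
    constructor <;> nlinarith
  refine h A g r C w hA hg hw hv hC hlow x₀ y₀ t₀ ρ a b hρ hx₀ hab hy₀ ?_ ?_ ?_ ?_
  · intro x t hx h1 h2
    refine ⟨fun i => ?_, by linarith, ?_⟩
    · have h3 := abs_xprime_sub_le x y₀ i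
      rw [hy'] at h3
      obtain ⟨h4, h5⟩ := abs_le.1 h3
      obtain ⟨h6, h7⟩ := abs_lt.1 (hside i)
      constructor <;> linarith
    · have := (hheight' x t hx h1 h2).2
      simp only [hGamma] at this htop
      linarith
  · exact fun z hz hx h1 _ => ha z hz (hnear z.1 hx) h1
  · intro z hz hx h1 h2
    refine hb z hz (hnear z.1 (hx.trans (by linarith))) h1 ?_
    have h3 := (abs_le.1 (hheight z.1 z.2 h1 h2)).1
    have h4 := mul_le_mul_of_nonneg_left hx (by positivity : 0 ≤ 1 + K)
    linarith
  · intro x t hx h1 h2 h3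
    refine hΓ.resolve_right fun h4 => ?_
    have := (hheight' x t hx h1 h2).1
    have h5 : hGamma g (x, t) = 0 := sub_eq_zero.2 h3
    linarith

section
variable {g : Spc' m → ℝ → ℝ} {w : Spc m × ℝ → ℝ} {r B κ δ C : ℝ}

lemma hGamma_bounds {p : Spc m × ℝ} (hp : p ∈ CylB g r) : 0 < hGamma g p ∧ hGamma g p < r := by
  obtain ⟨-, -, -, h1, h2⟩ := hp
  simp only [hGamma]
  constructor <;> linarith

lemma mem_ASet_iff {p : Spc m × ℝ} : p ∈ ASet g δ r ↔ p ∈ CylB g r ∧ δ * r ≤ hGamma g p := by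
  simp only [ASet, hGamma, mem_sep_iff, le_sub_iff_add_le']

lemma CylB_mono {r' : ℝ} (h0 : 0 ≤ r') (h : r' ≤ r) : CylB g r' ⊆ CylB g r := by
  intro p ⟨h1, h2, h3, h4, h5⟩
  refine ⟨fun i => ⟨?_, ?_⟩, ?_, h3, h4, ?_⟩
  · linarith [(h1 i).1]
  · linarith [(h1 i).2]
  · nlinarith
  · linarith

/-- If `w` is nonnegative away from the graph, its negative part decays geometrically in the
distance to the lateral boundary. -/
lemma BoxGrowth.decay (h : BoxGrowth g w r B κ) (hB : 0 < B) (hκ : κ < 1) (hr : 0 < r)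
    (hδ : 0 < δ) (hδ' : (1 + B) * δ < 1) (hC : 0 ≤ C) (hlow : ∀ z ∈ CylB g r, -C ≤ w z)
    (hA : ∀ z ∈ ASet g δ r, 0 ≤ w z) (k : ℕ) : ∀ z ∈ CylB g r,
      (∀ i, |xprime z.1 i| < r - k * (B * (δ * r))) → -r ^ 2 + k * (δ * r) ^ 2 < z.2 →
      -(C * (1 - κ) ^ k) ≤ w z := by
  have hρ : 0 < δ * r := mul_pos hδ hr
  have hBρ : 0 < B * (δ * r) := mul_pos hB hρ
  induction k with
  | zero => exact fun z hz _ _ => by simpa using hlow z hz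
  | succ k ih =>
    intro p hp hx ht
    push_cast at hx ht
    have hpow : 0 ≤ C * (1 - κ) ^ k := mul_nonneg hC (pow_nonneg (sub_nonneg.2 hκ.le) k)
    have hpow' : 0 ≤ C * (1 - κ) ^ (k + 1) :=
      mul_nonneg hC (pow_nonneg (sub_nonneg.2 hκ.le) _)
    by_cases hpA : p ∈ ASet g δ r
    · linarith [hA p hpA]
    have hph : hGamma g p < δ * r := by
      by_contra! hh
      exact hpA (mem_ASet_iff.2 ⟨hp, hh⟩)
    have hk : 0 ≤ (k : ℝ) * (B * (δ * r)) := by positivity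
    have hk' : 0 ≤ (k : ℝ) * (δ * r) ^ 2 := by positivity
    have := h p (δ * r) (-(C * (1 - κ) ^ k)) 0 hρ hp (by linarith)
      (fun i => by linarith [hx i]) (by linarith) (by nlinarith)
      (fun z hz hzx hzt => ih z hz (fun i => by
        have h1 := hzx i
        have h2 := hx i
        rw [abs_le] at h1
        rw [abs_lt] at h2 ⊢
        constructor <;> linarith) (by linarith))
      (fun z hz _ _ hh => hA z (mem_ASet_iff.2 ⟨hz, by linarith [(hGamma_bounds hp).1]⟩))
      (Or.inl le_rfl)
    refine le_trans (le_of_eq ?_) this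
    ring

/-- A lower bound away from the graph propagates down to half the height. -/
lemma BoxGrowth.descend (h : BoxGrowth g w r B κ) (hB : 0 < B) (hκ0 : 0 < κ) (hκ : κ < 1)
    (hr : 0 < r) (hδ : 0 < δ) (hδ' : (1 + B) * δ < 1) {D : ℝ} (hCD : 0 ≤ C + D)
    (hlow : ∀ z ∈ CylB g r, -C ≤ w z) (hA : ∀ z ∈ ASet g δ r, D ≤ w z) {n : ℕ} (hn : B < n)
    {ρ : ℝ} (hnρ : n * ρ = δ * r / 2) (k : ℕ) (hk : k ≤ n) : ∀ z ∈ CylB g r,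
      (∀ i, |xprime z.1 i| < r - k * (B * ρ)) →
      -r ^ 2 + k * ρ ^ 2 < z.2 →
      δ * r - k * ρ ≤ hGamma g z → -C + (C + D) * κ ^ k ≤ w z := by
  have hn0 : (0 : ℝ) < n := hB.trans hn
  have hn1 : (1 : ℝ) ≤ n := by
    exact_mod_cast Nat.one_le_iff_ne_zero.2 (by rintro rfl; simp at hn0)
  have hρ0 : 0 < ρ := pos_of_mul_pos_right (hnρ ▸ by positivity : 0 < n * ρ) hn0.le
  have hBρ : 0 < B * ρ := mul_pos hB hρ0
  induction k with
  | zero =>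
    intro z hz _ _ hh
    have := hA z (mem_ASet_iff.2 ⟨hz, by simpa using hh⟩)
    simpa using this
  | succ k ih =>
    intro p hp hx ht hph
    have hkn : ((k : ℝ) + 1) ≤ n := by exact_mod_cast hk
    push_cast at hx ht hph
    have ih' := ih (by omega)
    have hk0 : 0 ≤ (k : ℝ) * (B * ρ) := by positivity
    have hk1 : 0 ≤ (k : ℝ) * ρ ^ 2 := by positivity
    have hk2 : 0 ≤ (k : ℝ) * ρ := by positivity
    have hpow : 0 ≤ (C + D) * κ ^ k := mul_nonneg hCD (pow_nonneg hκ0.le k)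
    by_cases hpA : p ∈ ASet g δ r
    · have h1 : κ ^ (k + 1) ≤ 1 := pow_le_one₀ hκ0.le hκ.le
      have := mul_le_mul_of_nonneg_left h1 hCD
      linarith [hA p hpA]
    have hph' : hGamma g p < δ * r := by
      by_contra! hh
      exact hpA (mem_ASet_iff.2 ⟨hp, hh⟩)
    have hknρ := mul_le_mul_of_nonneg_right hkn hρ0.le
    have hBnρ := mul_lt_mul_of_pos_right hn hρ0
    have hρδ : ρ ≤ δ * r := by nlinarith
    have := h p ρ (-C) (-C + (C + D) * κ ^ k) hρ0 hp (by linarith)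
      (fun i => by linarith [hx i]) (by linarith) (by nlinarith)
      (fun z hz _ _ => hlow z hz)
      (fun z hz hzx hzt hh => ih' z hz (fun i => by
        have h1 := hzx i
        have h2 := hx i
        rw [abs_le] at h1
        rw [abs_lt] at h2 ⊢
        constructor <;> linarith) (by linarith) (by linarith))
      (Or.inr (by linarith))
    refine le_trans (le_of_eq ?_) this
    ring

end

lemma SolvesL.mono {A : Spc m → Matrix (Fin (m + 1)) (Fin (m + 1)) ℝ} {u : Spc m × ℝ → ℝ}
    {Ω Ω' : Set (Spc m × ℝ)} (h : SolvesL A u Ω) (hΩ : Ω' ⊆ Ω) : SolvesL A u Ω' :=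
  fun p hp => h p (hΩ hp)

lemma VanishesOn.mono {u : Spc m × ℝ → ℝ} {Ω Ω' Γ : Set (Spc m × ℝ)} (h : VanishesOn u Ω Γ)
    (hΩ : Ω' ⊆ Ω) : VanishesOn u Ω' Γ :=
  fun P hP => (h P ⟨hP.1, closure_mono hΩ hP.2⟩).mono_left (nhdsWithin_mono P hΩ)

section
variable {g : Spc' m → ℝ → ℝ} {w : Spc m × ℝ → ℝ} {r B κ δ C : ℝ}

lemma BoxGrowth.decay_half (h : BoxGrowth g w r B κ) (hB : 0 < B) (hκ : κ < 1) (hr : 0 < r)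
    (hδ : 0 < δ) (hδ' : (1 + B) * δ < 1) (hC : 0 ≤ C) (hlow : ∀ z ∈ CylB g r, -C ≤ w z)
    (hA : ∀ z ∈ ASet g δ r, 0 ≤ w z) {k : ℕ} (hk : k * ((1 + B) * δ) ≤ 1 / 2) :
    ∀ z ∈ CylB g (r / 2), -(C * (1 - κ) ^ k) ≤ w z := by
  intro z hz
  have hBδ : 0 < B * δ := mul_pos hB hδ
  have hkδ : 0 ≤ k * δ := by positivity
  have hkB : 0 ≤ k * (B * δ) := by positivity
  have hδ1 : δ ≤ 1 := by linarith
  refine h.decay hB hκ hr hδ hδ' hC hlow hA k z (CylB_mono (by linarith) (by linarith) hz)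
    (fun i => ?_) ?_
  · obtain ⟨h1, h2⟩ := hz.1 i
    have h3 : k * (B * (δ * r)) ≤ r / 2 := by
      have := mul_le_mul_of_nonneg_right (by linarith : k * (B * δ) ≤ 1 / 2) hr.le
      linarith
    rw [abs_lt]
    constructor <;> linarith
  · have h1 := hz.2.1
    have h2 : k * δ * δ ≤ 1 / 2 := by nlinarith
    have h3 := mul_le_mul_of_nonneg_right h2 (sq_nonneg r)
    have h4 : 0 < r ^ 2 := by positivity
    linarith

lemma BoxGrowth.descend_half (h : BoxGrowth g w r B κ) (hB : 0 < B) (hκ0 : 0 < κ) (hκ : κ < 1)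
    (hr : 0 < r) (hδ : 0 < δ) (hδ' : (1 + B) * δ < 1) {D : ℝ} (hCD : 0 ≤ C + D)
    (hlow : ∀ z ∈ CylB g r, -C ≤ w z) (hA : ∀ z ∈ ASet g δ r, D ≤ w z) {n : ℕ} (hn : B < n) :
    ∀ z ∈ ASet g δ (r / 2), -C + (C + D) * κ ^ n ≤ w z := by
  intro z hz
  obtain ⟨hz, hh⟩ := mem_ASet_iff.1 hz
  have hn0 : (0 : ℝ) < n := hB.trans hn
  have hn1 : (1 : ℝ) ≤ n := by
    exact_mod_cast Nat.one_le_iff_ne_zero.2 (by rintro rfl; simp at hn0)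
  have hBδ : 0 < B * δ := mul_pos hB hδ
  have hδr : 0 < δ * r := mul_pos hδ hr
  have hBδr : B * (δ * r) < r := by nlinarith
  have hδr1 : δ * r < r := by nlinarith
  obtain ⟨ρ, hnρ⟩ : ∃ ρ : ℝ, n * ρ = δ * r / 2 := ⟨δ * r / 2 / n, by field_simp⟩
  have hρ0 : 0 < ρ := pos_of_mul_pos_right (hnρ ▸ by positivity : 0 < n * ρ) hn0.le
  refine h.descend hB hκ0 hκ hr hδ hδ' hCD hlow hA hn hnρ n le_rfl z
    (CylB_mono (by linarith) (by linarith) hz) (fun i => ?_) ?_ (by linarith)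
  · obtain ⟨h1, h2⟩ := hz.1 i
    have h3 : n * (B * ρ) ≤ r / 2 := by
      rw [mul_left_comm, hnρ]
      linarith
    rw [abs_lt]
    constructor <;> linarith
  · have h1 := hz.2.1
    have h2 : ρ ≤ n * ρ := le_mul_of_one_le_left hρ0.le hn1
    have h3 : n * ρ ^ 2 ≤ r ^ 2 / 4 := by
      rw [pow_two, ← mul_assoc]
      nlinarith
    have h4 : 0 < r ^ 2 := by positivity
    linarith

end

end

/-- **Positivity on a segment by iteration of the key lemma** (consequence (2.6)
of Lemma 2.5). -/
theorem positivity_on_segment (m : ℕ) (hm : 1 ≤ m) (lam Lam K : ℝ)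
    (hlam : 0 < lam) (hlamLam : lam ≤ Lam) (hK : 0 < K) :
    ∃ M δ : ℝ, 0 < M ∧ 0 < δ ∧ δ < 1 ∧
      ∀ (A : Spc m → Matrix (Fin (m + 1)) (Fin (m + 1)) ℝ), IsElliptic lam Lam A →
      ∀ g : Spc' m → ℝ → ℝ,
        Continuous (fun q : Spc' m × ℝ => g q.1 q.2) → g 0 0 = 0 →
        HolderSemi 1 (1 / 2) K g →
      ∀ r : ℝ, 0 < r → r ≤ 1 →
      ∀ w : Spc m × ℝ → ℝ,
        SolvesL A w (CylB g r) →
        VanishesOn (fun q => max (-w q) 0) (CylB g r) (graphSet g) →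
        (∀ p ∈ ASet g δ r, M ≤ w p) →
        (∀ p ∈ CylB g r, -1 ≤ w p) →
        ∀ s : ℝ, 0 < s → s < r → 0 < w (mkPt 0 s, 0) := by
  obtain ⟨B, κ, hB, hκ0, hκ1, hbox⟩ := exists_boxGrowth m hlam (hlam.le.trans hlamLam) hK.le
  obtain ⟨n, hn⟩ := exists_nat_gt B
  obtain ⟨θ, hθ⟩ : ∃ θ, θ = κ ^ n / 2 := ⟨_, rfl⟩
  have hθ0 : 0 < θ := by rw [hθ]; positivity
  obtain ⟨k, hk⟩ := exists_pow_lt_of_lt_one hθ0 (by linarith : 1 - κ < 1)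
  obtain ⟨δ, hδ⟩ : ∃ δ, δ = 1 / (2 * (1 + B) * (1 + k)) := ⟨_, rfl⟩
  have hδ0 : 0 < δ := by rw [hδ]; positivity
  have hBδ0 : 0 < (1 + B) * δ := by positivity
  have hkδ0 : 0 ≤ k * ((1 + B) * δ) := by positivity
  have hδk : (1 + B) * δ + k * ((1 + B) * δ) = 1 / 2 := by rw [hδ]; field_simp
  have hδ2 : δ ≤ 1 / 2 := by
    have := mul_pos hB hδ0
    linarith
  refine ⟨1 / θ, δ, by positivity, hδ0, by linarith, ?_⟩
  intro A hA g hg hg0 hH r hr _ w hw hv hM hlow s hs hsr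
  have hr' : ∀ j : ℕ, 0 < r / 2 ^ j := fun j => by positivity
  have hsub : ∀ j : ℕ, CylB g (r / 2 ^ j) ⊆ CylB g r := fun j =>
    CylB_mono (hr' j).le (div_le_self hr.le (one_le_pow₀ one_le_two))
  have hiter : ∀ j : ℕ, (∀ z ∈ CylB g (r / 2 ^ j), -θ ^ j ≤ w z) ∧
      ∀ z ∈ ASet g δ (r / 2 ^ j), θ ^ j * (1 / θ) ≤ w z := by
    intro j
    induction j with
    | zero => exact ⟨by simpa only [pow_zero, div_one] using hlow,
        by simpa only [pow_zero, div_one, one_mul] using hM⟩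
    | succ j ih =>
      obtain ⟨h1, h2⟩ := ih
      have hθj : 0 < θ ^ j := pow_pos hθ0 j
      have hD : 0 < θ ^ j * (1 / θ) := by positivity
      have hgrow := hbox A g _ (θ ^ j) w hA hg hH (hw.mono (hsub j)) (hv.mono (hsub j)) hθj.le h1
      rw [pow_succ 2 j, ← div_div]
      constructor
      · intro z hz
        have h3 := hgrow.decay_half hB hκ1 (hr' j) hδ0 (by linarith) hθj.le h1
          (fun z hz => hD.le.trans (h2 z hz)) (k := k) (by linarith) z hz
        have h4 := mul_le_mul_of_nonneg_left hk.le hθj.le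
        rw [pow_succ]
        linarith
      · intro z hz
        have h3 := hgrow.descend_half hB hκ0 hκ1 (hr' j) hδ0 (by linarith) (by positivity)
          h1 h2 hn z hz
        have h4 : θ ^ (j + 1) * (1 / θ) = θ ^ j := by
          rw [pow_succ]
          field_simp
        have h5 : κ ^ n = 2 * θ := by rw [hθ]; ring
        have h6 : -θ ^ j + (θ ^ j + θ ^ j * (1 / θ)) * κ ^ n = θ ^ j + 2 * (θ ^ j * θ) := by
          rw [h5]
          field_simp
          ring
        have h7 : 0 < θ ^ j * θ := by positivity
        linarith
  obtain ⟨j, hj1, hj2⟩ : ∃ j : ℕ, ¬ r / 2 ^ j ≤ s ∧ r / 2 ^ (j + 1) ≤ s := by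
    refine Nat.exists_not_and_succ_of_not_zero_of_exists (by simpa using hsr) ?_
    obtain ⟨j, hj⟩ := pow_unbounded_of_one_lt (r / s) one_lt_two
    exact ⟨j, (div_le_iff₀ (by positivity)).2 (by rw [div_lt_iff₀ hs] at hj; linarith)⟩
  rw [not_le] at hj1
  rw [pow_succ, ← div_div] at hj2
  have hx : xprime (mkPt (0 : Spc' m) s) = 0 := by
    ext i
    simp [xprime, mkPt]
  have hl : xlast (mkPt (0 : Spc' m) s) = s := by simp [xlast, mkPt]
  refine lt_of_lt_of_le ?_ ((hiter j).2 (mkPt 0 s, 0) ⟨⟨fun i => ?_, ?_, le_rfl, ?_, ?_⟩, ?_⟩)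
  · positivity
  · simp [hx, hr]
  · simpa using pow_pos (hr' j) 2
  · simpa only [hx, hl, hg0] using hs
  · simpa only [hx, hl, hg0, zero_add] using hj1
  · simp only [hx, hl, hg0, zero_add]
    have := mul_le_mul_of_nonneg_right hδ2 (hr' j).le
    linarith
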